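/- There exist constants β ∈ (0,1), an integer b ≥ 2, constants c_u, c_B ∈ (0,1], and a threshold a₀ ∈ ℕ such that for every integer a ≥ a₀ and every q ∈ ℕ the following holds. Set λ_q = a^{(b^q)} and δ_q = λ_q^{−2β}. Suppose (u_q, B_q, p_q, R^u_q, R^B_q) are smooth functions of (x,t) ∈ ℝ³ × [0,1], 2π-periodic in each spatial coordinate, such that u_q and B_q are divergence-free with zero spatial mean, R^u_q takes values in symmetric trace-free 3×3 matrices, R^B_q takes values in skew-symmetric 3×3 matrices, the relaxed MHD system ∂_t u_q + div(u_q⊗u_q − B_q⊗B_q) + ∇p_q = div R^u_q, ∂_t B_q + div(u_q⊗B_q − B_q⊗u_q) = div R^B_q holds pointwise, and the bounds ‖B_q‖_{L^∞_t L²_x} ≤ 1 − δ_q^{1/2}, ‖B_q‖_{C¹_{x,t}} ≤ λ_q², ‖R^B_q‖_{L^∞_t L¹_x} ≤ c_B δ_{q+1}, ‖u_q‖_{L^∞_t L²_x} ≤ 1 − δ_q^{1/2}, ‖u_q‖_{C¹_{x,t}} ≤ λ_q², ‖R^u_q‖_{L^∞_t L¹_x} ≤ c_u δ_{q+1} hold.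 Then there exist smooth, spatially 2π-periodic (u_{q+1}, B_{q+1}, p_{q+1}, R^u_{q+1}, R^B_{q+1}) of the same type solving the relaxed MHD system and satisfying the analogous bounds with q replaced by q+1, and moreover ‖u_{q+1} − u_q‖_{L^∞_t L²_x} ≤ δ_{q+1}^{1/2} and ‖B_{q+1} − B_q‖_{L^∞_t L²_x} ≤ δ_{q+1}^{1/2}. -/

import Mathlib

/-!
STATEMENT 1: The Main Iteration Proposition for the relaxed MHD system.
With λ_q = a^(b^q) and δ_q = λ_q^{−2β}, given a smooth spatially periodic solution
(u_q, B_q, p_q, R^u_q, R^B_q) of the relaxed MHD system satisfying the inductive bounds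
at level q, there is a solution at level q+1 satisfying the inductive bounds and
‖u_{q+1} − u_q‖_{L^∞_t L²_x} ≤ δ_{q+1}^{1/2}, ‖B_{q+1} − B_q‖_{L^∞_t L²_x} ≤ δ_{q+1}^{1/2}.
-/

noncomputable section

open MeasureTheory Real Matrix

/-- The fundamental domain [−π,π]³ of the torus T³. -/
def dom : Set (Fin 3 → ℝ) := Set.Icc (fun _ => -π) (fun _ => π)

/-- Partial derivative in the i-th coordinate direction. -/
def pd (i : Fin 3) (f : (Fin 3 → ℝ) → ℝ) (x : Fin 3 → ℝ) : ℝ := fderiv ℝ f x (Pi.single i 1)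

/-- A function on ℝ³ is 2π-periodic in each coordinate. -/
def Periodic3 (f : (Fin 3 → ℝ) → ℝ) : Prop :=
  ∀ (x : Fin 3 → ℝ) (i : Fin 3), f (x + (2 * π) • (Pi.single i 1 : Fin 3 → ℝ)) = f x

/-- The frequency parameter λ_q = a^(b^q). -/
def lam (a b q : ℕ) : ℝ := (a : ℝ) ^ (b ^ q)

/-- The amplitude parameter δ_q = λ_q^(−2β). -/
def del (a b : ℕ) (β : ℝ) (q : ℕ) : ℝ := lam a b q ^ (-(2 * β))

/-- Euclidean norm of a vector in ℝ³. -/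
def enormV (v : Fin 3 → ℝ) : ℝ := Real.sqrt (∑ i, v i ^ 2)

/-- Frobenius norm of a 3×3 matrix. -/
def enormM (A : Matrix (Fin 3) (Fin 3) ℝ) : ℝ := Real.sqrt (∑ i, ∑ j, A i j ^ 2)

/-- The L²(T³) norm of a vector field. -/
def L2norm (f : (Fin 3 → ℝ) → (Fin 3 → ℝ)) : ℝ :=
  (∫ x in dom, enormV (f x) ^ 2) ^ ((1 : ℝ) / 2)

/-- The L¹(T³) norm of a matrix field. -/
def L1norm (R : (Fin 3 → ℝ) → Matrix (Fin 3) (Fin 3) ℝ) : ℝ :=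
  ∫ x in dom, enormM (R x)

/-- The C¹_{x,t} norm on T³ × [0,1]: sup |f| + sup |∇_x f| + sup |∂_t f|. -/
def C1norm (u : ℝ → (Fin 3 → ℝ) → (Fin 3 → ℝ)) : ℝ :=
  (⨆ q : Set.Icc (0 : ℝ) 1 × (Fin 3 → ℝ), enormV (u q.1.1 q.2)) +
  (⨆ q : Set.Icc (0 : ℝ) 1 × (Fin 3 → ℝ),
    Real.sqrt (∑ i, ∑ j, (pd j (fun y => u q.1.1 y i) q.2) ^ 2)) +
  (⨆ q : Set.Icc (0 : ℝ) 1 × (Fin 3 → ℝ),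
    enormV (fun i => deriv (fun s => u s q.2 i) q.1.1))

/-- `(u, B, p, Ru, RB)` is a smooth, spatially periodic solution of the relaxed MHD
system, with `u`, `B` divergence-free and of zero mean, `Ru` symmetric trace-free and
`RB` skew-symmetric. -/
def RelaxedMHDSolution (u B : ℝ → (Fin 3 → ℝ) → (Fin 3 → ℝ)) (p : ℝ → (Fin 3 → ℝ) → ℝ)
    (Ru RB : ℝ → (Fin 3 → ℝ) → Matrix (Fin 3) (Fin 3) ℝ) : Prop :=
  -- smoothness, jointly in (t,x)
  (∀ i, ContDiff ℝ (⊤ : ℕ∞) (fun w : ℝ × (Fin 3 → ℝ) => u w.1 w.2 i)) ∧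
  (∀ i, ContDiff ℝ (⊤ : ℕ∞) (fun w : ℝ × (Fin 3 → ℝ) => B w.1 w.2 i)) ∧
  ContDiff ℝ (⊤ : ℕ∞) (fun w : ℝ × (Fin 3 → ℝ) => p w.1 w.2) ∧
  (∀ i j, ContDiff ℝ (⊤ : ℕ∞) (fun w : ℝ × (Fin 3 → ℝ) => Ru w.1 w.2 i j)) ∧
  (∀ i j, ContDiff ℝ (⊤ : ℕ∞) (fun w : ℝ × (Fin 3 → ℝ) => RB w.1 w.2 i j)) ∧
  -- spatial periodicity
  (∀ t i, Periodic3 (fun x => u t x i)) ∧ (∀ t i, Periodic3 (fun x => B t x i)) ∧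
  (∀ t, Periodic3 (p t)) ∧
  (∀ t i j, Periodic3 (fun x => Ru t x i j)) ∧ (∀ t i j, Periodic3 (fun x => RB t x i j)) ∧
  -- u and B are divergence-free with zero mean
  (∀ t x, ∑ i, pd i (fun y => u t y i) x = 0) ∧
  (∀ t x, ∑ i, pd i (fun y => B t y i) x = 0) ∧
  (∀ t i, ∫ x in dom, u t x i = 0) ∧ (∀ t i, ∫ x in dom, B t x i = 0) ∧
  -- Ru is symmetric trace-free, RB is skew-symmetric
  (∀ t x, (Ru t x).IsSymm) ∧ (∀ t x, Matrix.trace (Ru t x) = 0) ∧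
  (∀ t x, (RB t x)ᵀ = -(RB t x)) ∧
  -- the relaxed momentum equation
  (∀ t x i, deriv (fun s => u s x i) t
      + (∑ j, pd j (fun y => u t y i * u t y j - B t y i * B t y j) x)
      + pd i (p t) x
    = ∑ j, pd j (fun y => Ru t y i j) x) ∧
  -- the relaxed induction equation
  (∀ t x i, deriv (fun s => B s x i) t
      + (∑ j, pd j (fun y => u t y i * B t y j - B t y i * u t y j) x)
    = ∑ j, pd j (fun y => RB t y i j) x)

/-- The inductive bounds at level q. -/
def InductiveBounds (a b : ℕ) (β cu cB : ℝ) (q : ℕ)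
    (u B : ℝ → (Fin 3 → ℝ) → (Fin 3 → ℝ))
    (Ru RB : ℝ → (Fin 3 → ℝ) → Matrix (Fin 3) (Fin 3) ℝ) : Prop :=
  (∀ t ∈ Set.Icc (0 : ℝ) 1, L2norm (B t) ≤ 1 - del a b β q ^ ((1 : ℝ) / 2)) ∧
  C1norm B ≤ lam a b q ^ 2 ∧
  (∀ t ∈ Set.Icc (0 : ℝ) 1, L1norm (RB t) ≤ cB * del a b β (q + 1)) ∧
  (∀ t ∈ Set.Icc (0 : ℝ) 1, L2norm (u t) ≤ 1 - del a b β q ^ ((1 : ℝ) / 2)) ∧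
  C1norm u ≤ lam a b q ^ 2 ∧
  (∀ t ∈ Set.Icc (0 : ℝ) 1, L1norm (Ru t) ≤ cu * del a b β (q + 1))

noncomputable section
open MeasureTheory Real Matrix

abbrev EE := ℝ × (Fin 3 → ℝ)

/-- smooth functions, spatially periodic -/
def SP : Subalgebra ℝ (EE → ℝ) where
  carrier := {f | ContDiff ℝ (⊤ : ℕ∞) f ∧
    ∀ (t : ℝ) (x : Fin 3 → ℝ) (i : Fin 3),
      f (t, x + (2 * π) • (Pi.single i 1 : Fin 3 → ℝ)) = f (t, x)}
  mul_mem' := by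
    rintro f g ⟨hf, hf'⟩ ⟨hg, hg'⟩
    refine ⟨hf.mul hg, fun t x i => ?_⟩
    simp only [Pi.mul_apply, hf', hg']
  add_mem' := by
    rintro f g ⟨hf, hf'⟩ ⟨hg, hg'⟩
    refine ⟨hf.add hg, fun t x i => ?_⟩
    simp only [Pi.add_apply, hf', hg']
  algebraMap_mem' := by
    intro r
    exact ⟨contDiff_const, fun t x i => rfl⟩

instance : CoeFun SP (fun _ => EE → ℝ) := ⟨fun f => f.1⟩

theorem sm (f : SP) : ContDiff ℝ (⊤ : ℕ∞) (f : EE → ℝ) := f.2.1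
theorem df (f : SP) : Differentiable ℝ (f : EE → ℝ) :=
  (sm f).differentiable (by simp)
theorem ct (f : SP) : Continuous (f : EE → ℝ) := (sm f).continuous
theorem pe (f : SP) (t : ℝ) (x : Fin 3 → ℝ) (i : Fin 3) :
    f (t, x + (2 * π) • (Pi.single i 1 : Fin 3 → ℝ)) = f (t, x) := f.2.2 t x i

@[simp] theorem SP.add_apply (f g : SP) (z : EE) : (f + g) z = f z + g z := rfl
@[simp] theorem SP.sub_apply (f g : SP) (z : EE) : (f - g) z = f z - g z := rfl
@[simp] theorem SP.neg_apply (f : SP) (z : EE) : (-f) z = - f z := rfl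
@[simp] theorem SP.mul_apply (f g : SP) (z : EE) : (f * g) z = f z * g z := rfl
@[simp] theorem SP.smul_apply (c : ℝ) (f : SP) (z : EE) : (c • f) z = c * f z := rfl
@[simp] theorem SP.zero_apply (z : EE) : (0 : SP) z = 0 := rfl
@[simp] theorem SP.one_apply (z : EE) : (1 : SP) z = 1 := rfl
@[simp] theorem SP.algebraMap_apply (r : ℝ) (z : EE) : (algebraMap ℝ SP r) z = r := rfl
@[simp] theorem SP.sum_apply {ι : Type*} (s : Finset ι) (f : ι → SP) (z : EE) :
    (∑ i ∈ s, f i) z = ∑ i ∈ s, f i z := by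
  classical
  induction s using Finset.induction_on with
  | empty => simp
  | insert a s ha ih => rw [Finset.sum_insert ha, Finset.sum_insert ha, SP.add_apply, ih]
@[simp] theorem SP.pow_apply (f : SP) (n : ℕ) (z : EE) : (f ^ n) z = f z ^ n := rfl

theorem SP.ext' {f g : SP} (h : ∀ z, f z = g z) : f = g := Subtype.ext (funext h)

theorem fderiv_smooth {f : EE → ℝ} (hf : ContDiff ℝ (⊤ : ℕ∞) f) (v : EE) :
    ContDiff ℝ (⊤ : ℕ∞) (fun z => fderiv ℝ f z v) := by
  have : ContDiff ℝ (⊤ : ℕ∞) (fderiv ℝ f) := hf.fderiv_right (by simp)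
  exact this.clm_apply contDiff_const

/-- directional derivative as a linear map on smooth periodic functions -/
def D (v : EE) : SP →ₗ[ℝ] SP where
  toFun f := ⟨fun z => fderiv ℝ (f : EE → ℝ) z v, fderiv_smooth (sm f) v, by
    intro t x i
    have h : (f : EE → ℝ) = fun z => f (z + ((0 : ℝ), (2 * π) • (Pi.single i 1 : Fin 3 → ℝ))) := by
      funext z
      obtain ⟨s, y⟩ := z
      simp only [Prod.mk_add_mk, add_zero]
      exact (pe f s y i).symm
    have h2 := fderiv_comp_add_right (𝕜 := ℝ) (f := (f : EE → ℝ)) (x := (t, x))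
      ((0 : ℝ), (2 * π) • (Pi.single i 1 : Fin 3 → ℝ))
    rw [← h] at h2
    simp only [h2]
    simp⟩
  map_add' f g := SP.ext' fun z => by
    change fderiv ℝ (fun z => f z + g z) z v = _
    rw [fderiv_fun_add (df f z) (df g z)]; rfl
  map_smul' c f := SP.ext' fun z => by
    change fderiv ℝ (fun z => c • f z) z v = _
    rw [fderiv_fun_const_smul (df f z)]; rfl

theorem D_apply (v : EE) (f : SP) (z : EE) : D v f z = fderiv ℝ (f : EE → ℝ) z v := rfl

theorem D_mul (v : EE) (f g : SP) : D v (f * g) = f * D v g + D v f * g := SP.ext' fun z => by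
  change fderiv ℝ (fun z => f z * g z) z v = _
  rw [fderiv_fun_mul (df f z) (df g z)]
  simp [D_apply]; ring

theorem D_comm (v w : EE) (f : SP) : D v (D w f) = D w (D v f) := SP.ext' fun z => by
  have hs : IsSymmSndFDerivAt ℝ (f : EE → ℝ) z := by
    apply ((sm f).contDiffAt).isSymmSndFDerivAt
    simp
    change ((2 : ℕ∞) : WithTop ℕ∞) ≤ ((⊤ : ℕ∞) : WithTop ℕ∞)
    exact WithTop.coe_le_coe.2 le_top
  have hd : DifferentiableAt ℝ (fderiv ℝ (f : EE → ℝ)) z :=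
    (((sm f).fderiv_right (m := 1) (by norm_cast)).differentiable (by simp)) z
  have key : ∀ a b : EE, D a (D b f) z = fderiv ℝ (fderiv ℝ (f : EE → ℝ)) z a b := by
    intro a b
    change fderiv ℝ (fun z => fderiv ℝ (f : EE → ℝ) z b) z a = _
    rw [fderiv_clm_apply hd (differentiableAt_const _)]
    simp
  rw [key, key]
  exact hs.eq v w

@[simp] theorem D_algebraMap (v : EE) (c : ℝ) : D v (algebraMap ℝ SP c) = 0 := SP.ext' fun z => by
  change fderiv ℝ (fun _ => c) z v = _
  simp

def e0 : EE := (1, 0)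
def ee (j : Fin 3) : EE := (0, Pi.single j 1)

theorem pd_eq (f : SP) (j : Fin 3) (t : ℝ) (x : Fin 3 → ℝ) :
    pd j (fun y => f (t, y)) x = D (ee j) f (t, x) := by
  unfold pd
  have h : HasFDerivAt (fun y : Fin 3 → ℝ => ((t, y) : EE)) (ContinuousLinearMap.inr ℝ ℝ (Fin 3 → ℝ)) x :=
    hasFDerivAt_prodMk_right t x
  have := ((df f (t, x)).hasFDerivAt.comp x h).fderiv
  change fderiv ℝ ((f : EE → ℝ) ∘ fun y => (t, y)) x _ = _
  rw [this]
  simp [D_apply, ee]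

theorem derivt_eq (f : SP) (t : ℝ) (x : Fin 3 → ℝ) :
    deriv (fun s => f (s, x)) t = D e0 f (t, x) := by
  have h : HasDerivAt (fun s : ℝ => ((s, x) : EE)) (1, 0) t :=
    (hasDerivAt_id t).prodMk (hasDerivAt_const t x)
  have := ((df f (t, x)).hasFDerivAt.comp_hasDerivAt t h).deriv
  exact this

theorem norm_e0 : ‖e0‖ ≤ 1 := by simp [e0, Prod.norm_def]
theorem norm_ee (j : Fin 3) : ‖ee j‖ ≤ 1 := by
  simp [ee, Prod.norm_def, Pi.norm_single]

end

noncomputable section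
open MeasureTheory Real Matrix

def Zs : Set EE := {z | z.1 ∈ Set.Icc (0 : ℝ) 1}

theorem Zs_ne : ((0, 0) : EE) ∈ Zs := by simp [Zs]

def Bd : ℕ → SP → ℝ → Prop
  | 0, f, X => ∀ z ∈ Zs, |f z| ≤ X
  | n + 1, f, X => (∀ z ∈ Zs, |f z| ≤ X) ∧ ∀ v : EE, ‖v‖ ≤ 1 → Bd n (D v f) X

theorem Bd.zero {n : ℕ} {f : SP} {X : ℝ} (h : Bd n f X) : ∀ z ∈ Zs, |f z| ≤ X := by
  cases n with
  | zero => exact h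
  | succ n => exact h.1

theorem Bd.nonneg {n : ℕ} {f : SP} {X : ℝ} (h : Bd n f X) : 0 ≤ X :=
  (abs_nonneg _).trans (h.zero _ Zs_ne)

theorem Bd.mono {n : ℕ} {f : SP} {X Y : ℝ} (h : Bd n f X) (hXY : X ≤ Y) : Bd n f Y := by
  induction n generalizing f with
  | zero => exact fun z hz => (h z hz).trans hXY
  | succ n ih => exact ⟨fun z hz => (h.1 z hz).trans hXY, fun v hv => ih (h.2 v hv)⟩

theorem Bd.pred {n : ℕ} {f : SP} {X : ℝ} (h : Bd (n + 1) f X) : Bd n f X := by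
  induction n generalizing f with
  | zero => exact h.1
  | succ n ih => exact ⟨h.1, fun v hv => ih (h.2 v hv)⟩

theorem Bd.of_le {n m : ℕ} {f : SP} {X : ℝ} (h : Bd n f X) (hm : m ≤ n) : Bd m f X := by
  induction n with
  | zero => obtain rfl : m = 0 := by omega
            exact h
  | succ n ih =>
    rcases Nat.lt_or_ge m (n + 1) with h1 | h1
    · exact ih h.pred (by omega)
    · obtain rfl : m = n + 1 := by omega
      exact h

theorem Bd.add {n : ℕ} {f g : SP} {X Y : ℝ} (h : Bd n f X) (h' : Bd n g Y) :
    Bd n (f + g) (X + Y) := by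
  induction n generalizing f g with
  | zero => exact fun z hz => (abs_add_le _ _).trans (add_le_add (h z hz) (h' z hz))
  | succ n ih =>
    refine ⟨fun z hz => (abs_add_le _ _).trans (add_le_add (h.1 z hz) (h'.1 z hz)), fun v hv => ?_⟩
    rw [map_add]; exact ih (h.2 v hv) (h'.2 v hv)

theorem Bd.smul {n : ℕ} {f : SP} {X : ℝ} (c : ℝ) (h : Bd n f X) : Bd n (c • f) (|c| * X) := by
  induction n generalizing f with
  | zero =>
    intro z hz
    rw [SP.smul_apply, abs_mul]
    exact mul_le_mul_of_nonneg_left (h z hz) (abs_nonneg _)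
  | succ n ih =>
    refine ⟨?_, fun v hv => ?_⟩
    · intro z hz
      rw [SP.smul_apply, abs_mul]
      exact mul_le_mul_of_nonneg_left (h.1 z hz) (abs_nonneg _)
    · rw [map_smul]; exact ih (h.2 v hv)

theorem Bd.neg {n : ℕ} {f : SP} {X : ℝ} (h : Bd n f X) : Bd n (-f) X := by
  have := h.smul (-1)
  simpa using this

theorem Bd.mul {n : ℕ} {f g : SP} {X Y : ℝ} (h : Bd n f X) (h' : Bd n g Y) :
    Bd n (f * g) (2 ^ n * (X * Y)) := by
  induction n generalizing f g with
  | zero =>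
    intro z hz
    rw [SP.mul_apply, abs_mul, pow_zero, one_mul]
    exact mul_le_mul (h z hz) (h' z hz) (abs_nonneg _) h.nonneg
  | succ n ih =>
    have hXY : 0 ≤ X * Y := mul_nonneg h.nonneg h'.nonneg
    refine ⟨?_, fun v hv => ?_⟩
    · intro z hz
      rw [SP.mul_apply, abs_mul]
      have h1 : |f z| * |g z| ≤ X * Y := mul_le_mul (h.1 z hz) (h'.1 z hz) (abs_nonneg _) h.nonneg
      have h2 : (1 : ℝ) ≤ 2 ^ (n + 1) := one_le_pow₀ (by norm_num)
      nlinarith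
    · rw [D_mul]
      have := (ih h.pred (h'.2 v hv)).add (ih (h.2 v hv) h'.pred)
      refine this.mono (le_of_eq ?_)
      ring

theorem Bd.const (n : ℕ) (c : ℝ) : Bd n (algebraMap ℝ SP c) |c| := by
  have h0 : ∀ n, Bd n (0 : SP) |c| := by
    intro n
    induction n with
    | zero => intro z _; simp
    | succ n ih => exact ⟨fun z _ => by simp, fun v _ => by rw [map_zero]; exact ih⟩
  cases n with
  | zero => intro z _; simp
  | succ n => exact ⟨fun z _ => by simp, fun v _ => by rw [D_algebraMap]; exact h0 n⟩

/-- real power of a function bounded below by one -/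
def rpw (p : ℝ) (f : SP) (hf : ∀ z, 1 ≤ f z) : SP :=
  ⟨fun z => f z ^ p, by
    refine ⟨(sm f).rpow_const_of_ne (fun z => (lt_of_lt_of_le one_pos (hf z)).ne'), ?_⟩
    intro t x i
    simp only [pe f t x i]⟩

@[simp] theorem rpw_apply (p : ℝ) (f : SP) (hf : ∀ z, 1 ≤ f z) (z : EE) :
    rpw p f hf z = f z ^ p := rfl

theorem D_rpw (p : ℝ) (f : SP) (hf : ∀ z, 1 ≤ f z) (v : EE) :
    D v (rpw p f hf) = p • (rpw (p - 1) f hf * D v f) := SP.ext' fun z => by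
  have := ((df f z).hasFDerivAt.rpow_const (p := p) (Or.inl (lt_of_lt_of_le one_pos (hf z)).ne')).fderiv
  change fderiv ℝ (fun z => f z ^ p) z v = _
  rw [this]
  simp [D_apply]; ring

theorem Bd.rpw (n : ℕ) : ∀ p : ℝ, p ≤ 1 → ∃ C : ℝ, 0 ≤ C ∧ ∃ K : ℕ, ∀ (f : SP) (hf : ∀ z, 1 ≤ f z) (X : ℝ),
    1 ≤ X → Bd n f X → Bd n (rpw p f hf) (C * X ^ K) := by
  have h0 : ∀ p : ℝ, p ≤ 1 → ∀ (f : SP) (hf : ∀ z, 1 ≤ f z) (X : ℝ), Bd n f X →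
      ∀ z ∈ Zs, |(_root_.rpw p f hf) z| ≤ X := by
    intro p hp f hf X hB z hz
    rw [rpw_apply, abs_of_nonneg (rpow_nonneg (zero_le_one.trans (hf z)) _)]
    calc f z ^ p ≤ f z ^ (1 : ℝ) := rpow_le_rpow_of_exponent_le (hf z) hp
      _ = f z := rpow_one _
      _ ≤ |f z| := le_abs_self _
      _ ≤ X := hB.zero z hz
  induction n with
  | zero =>
    intro p hp
    refine ⟨1, zero_le_one, 1, fun f hf X hX hB => ?_⟩
    rw [one_mul, pow_one]
    exact h0 p hp f hf X hB
  | succ n ih =>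
    intro p hp
    obtain ⟨C, hC, K, h⟩ := ih (fun p hp f hf X hB z hz => by
      rw [rpw_apply, abs_of_nonneg (rpow_nonneg (zero_le_one.trans (hf z)) _)]
      calc f z ^ p ≤ f z ^ (1 : ℝ) := rpow_le_rpow_of_exponent_le (hf z) hp
        _ = f z := rpow_one _
        _ ≤ |f z| := le_abs_self _
        _ ≤ X := hB.zero z hz) (p - 1) (by linarith)
    refine ⟨1 + |p| * 2 ^ n * C, by positivity, K + 1, fun f hf X hX hB => ⟨?_, fun v hv => ?_⟩⟩
    · intro z hz
      refine (h0 p hp f hf X hB z hz).trans ?_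
      have h1 : X ≤ X ^ (K + 1) := le_self_pow₀ hX (by omega)
      have h2 : 0 ≤ |p| * 2 ^ n * C := by positivity
      nlinarith
    · rw [D_rpw]
      have h1 := ((h f hf X hX hB.pred).mul (hB.2 v hv)).smul p
      refine h1.mono ?_
      have : 0 ≤ X ^ (K + 1) := by positivity
      calc |p| * (2 ^ n * (C * X ^ K * X)) = (|p| * 2 ^ n * C) * X ^ (K + 1) := by ring
        _ ≤ _ := by nlinarith

end

noncomputable section
open MeasureTheory Real Matrix

theorem dom_compact : IsCompact dom := isCompact_Icc
theorem dom_meas : MeasurableSet dom := measurableSet_Icc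

theorem contIntOn {f : (Fin 3 → ℝ) → ℝ} (hf : Continuous f) : IntegrableOn f dom :=
  hf.continuousOn.integrableOn_compact dom_compact

theorem neg_pi_le_pi : -π ≤ π := by linarith [pi_pos]

theorem dom_split (i : Fin 3) {f : (Fin 3 → ℝ) → ℝ} (hf : Continuous f) :
    ∫ x in dom, f x = ∫ y in (Set.Icc (fun _ => -π) (fun _ => π) : Set (Fin 2 → ℝ)),
      ∫ s in (-π)..π, f (i.insertNth s y) := by
  have hmp := volume_preserving_piFinSuccAbove (fun _ : Fin 3 => ℝ) i
  set e := MeasurableEquiv.piFinSuccAbove (fun _ : Fin 3 => ℝ) i with he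
  have hpre : dom = e ⁻¹' (Set.Icc (-π) π ×ˢ (Set.Icc (fun _ => -π) (fun _ => π) : Set (Fin 2 → ℝ))) := by
    ext x
    simp only [dom, he, Set.mem_Icc, Set.mem_preimage, Set.mem_prod, Pi.le_def,
      MeasurableEquiv.piFinSuccAbove_apply]
    constructor
    · rintro ⟨h1, h2⟩
      exact ⟨⟨h1 i, h2 i⟩, fun j => h1 _, fun j => h2 _⟩
    · rintro ⟨⟨h1, h2⟩, h3, h4⟩
      constructor
      · intro j
        rcases Fin.eq_self_or_eq_succAbove i j with h | ⟨k, h⟩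
        · rw [h]; exact h1
        · rw [h]; exact h3 k
      · intro j
        rcases Fin.eq_self_or_eq_succAbove i j with h | ⟨k, h⟩
        · rw [h]; exact h2
        · rw [h]; exact h4 k
  have hfe : ∀ x, f x = (fun w : ℝ × (Fin 2 → ℝ) => f (i.insertNth w.1 w.2)) (e x) := by
    intro x
    simp only [he, MeasurableEquiv.piFinSuccAbove_apply]
    congr 1
    exact (Fin.insertNth_self_removeNth i x).symm
  have hc : Continuous (fun w : ℝ × (Fin 2 → ℝ) => f (i.insertNth w.1 w.2)) := by
    apply hf.comp
    exact Continuous.finInsertNth i continuous_fst continuous_snd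
  calc ∫ x in dom, f x = ∫ x in dom, (fun w : ℝ × (Fin 2 → ℝ) => f (i.insertNth w.1 w.2)) (e x) := by
        congr 1; funext x; exact hfe x
    _ = ∫ w in (Set.Icc (-π) π ×ˢ (Set.Icc (fun _ => -π) (fun _ => π) : Set (Fin 2 → ℝ))),
          f (i.insertNth w.1 w.2) := by
        rw [hpre]
        exact hmp.setIntegral_preimage_emb e.measurableEmbedding
          (fun w : ℝ × (Fin 2 → ℝ) => f (i.insertNth w.1 w.2)) _
    _ = _ := by
        rw [Measure.volume_eq_prod, ← setIntegral_prod_swap _ _ (fun w : ℝ × (Fin 2 → ℝ) => f (i.insertNth w.1 w.2)), setIntegral_prod]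
        · apply integral_congr_ae
          filter_upwards with y
          rw [intervalIntegral.integral_of_le neg_pi_le_pi, integral_Icc_eq_integral_Ioc]
          rfl
        · exact ((hc.comp continuous_swap).continuousOn).integrableOn_compact
            (isCompact_Icc.prod isCompact_Icc)

def Per (f : (Fin 3 → ℝ) → ℝ) : Prop :=
  ∀ (x : Fin 3 → ℝ) (i : Fin 3), f (x + (2 * π) • (Pi.single i 1 : Fin 3 → ℝ)) = f x

theorem insert_add (i : Fin 3) (s c : ℝ) (y : Fin 2 → ℝ) :
    (i.insertNth s y : Fin 3 → ℝ) + c • (Pi.single i 1 : Fin 3 → ℝ) = i.insertNth (s + c) y := by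
  funext j
  rcases Fin.eq_self_or_eq_succAbove i j with h | ⟨k, h⟩
  · subst h; simp
  · subst h; simp

theorem dom_shift1 {f : (Fin 3 → ℝ) → ℝ} (hf : Continuous f) (hp : Per f) (i : Fin 3) (c : ℝ) :
    ∫ x in dom, f (x + c • (Pi.single i 1 : Fin 3 → ℝ)) = ∫ x in dom, f x := by
  rw [dom_split i hf, dom_split i (f := fun x => f (x + c • (Pi.single i 1 : Fin 3 → ℝ))) (by fun_prop)]
  congr 1
  funext y
  simp only [insert_add]
  rw [intervalIntegral.integral_comp_add_right (fun s => f (i.insertNth s y))]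
  have hper : Function.Periodic (fun s => f (i.insertNth s y : Fin 3 → ℝ)) (2 * π) := by
    intro s
    simp only [← insert_add]
    exact hp _ i
  have := hper.intervalIntegral_add_eq (-π + c) (-π)
  rw [show -π + c + 2 * π = π + c by ring, show -π + 2 * π = π by ring] at this
  exact this

theorem Per.shift {f : (Fin 3 → ℝ) → ℝ} (hp : Per f) (c : Fin 3 → ℝ) : Per (fun x => f (x + c)) := by
  intro x i
  have := hp (x + c) i
  change f _ = f _
  rw [← this]
  congr 1
  abel

theorem dom_shift {f : (Fin 3 → ℝ) → ℝ} (hf : Continuous f) (hp : Per f) (c : Fin 3 → ℝ) :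
    ∫ x in dom, f (x + c) = ∫ x in dom, f x := by
  have hc : c = c 0 • (Pi.single 0 1 : Fin 3 → ℝ) + (c 1 • (Pi.single 1 1 : Fin 3 → ℝ)
      + c 2 • (Pi.single 2 1 : Fin 3 → ℝ)) := by
    funext j
    fin_cases j <;> simp
  have h2 := dom_shift1 hf hp 2 (c 2)
  have h1 := dom_shift1 (f := fun x => f (x + c 2 • (Pi.single 2 1 : Fin 3 → ℝ))) (by fun_prop)
    (hp.shift _) 1 (c 1)
  have h0 := dom_shift1 (f := fun x => f (x + (c 1 • (Pi.single 1 1 : Fin 3 → ℝ)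
      + c 2 • (Pi.single 2 1 : Fin 3 → ℝ)))) (by fun_prop) (hp.shift _) 0 (c 0)
  simp only [add_assoc] at h0 h1
  rw [← hc] at h0
  rw [h0, h1, h2]

theorem SPper (f : SP) (t : ℝ) : Per (fun x => f (t, x)) := fun x i => pe f t x i

theorem SPcont (f : SP) (t : ℝ) : Continuous (fun x => f (t, x)) :=
  (ct f).comp (by fun_prop)

theorem int_D (f : SP) (j : Fin 3) (t : ℝ) : ∫ x in dom, D (ee j) f (t, x) = 0 := by
  rw [dom_split j (SPcont _ t)]
  have : ∀ y : Fin 2 → ℝ, ∫ s in (-π)..π, D (ee j) f (t, j.insertNth s y) = 0 := by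
    intro y
    have hd : ∀ s, HasDerivAt (fun s : ℝ => f (t, (j.insertNth s y : Fin 3 → ℝ)))
        (D (ee j) f (t, j.insertNth s y)) s := by
      intro s
      have h1 : HasDerivAt (fun s : ℝ => ((t, (j.insertNth s y : Fin 3 → ℝ)) : EE)) (ee j) s := by
        have h2 : (fun s : ℝ => ((t, (j.insertNth s y : Fin 3 → ℝ)) : EE))
            = fun s : ℝ => (t, (j.insertNth 0 y : Fin 3 → ℝ)) + s • ee j := by
          funext s
          have := insert_add j 0 s y
          rw [zero_add] at this
          simp only [ee, Prod.smul_mk, Prod.mk_add_mk, smul_zero, add_zero, this]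
        rw [h2]
        simpa using ((hasDerivAt_id s).smul_const (ee j)).const_add (t, (j.insertNth 0 y : Fin 3 → ℝ))
      exact (df f _).hasFDerivAt.comp_hasDerivAt s h1
    rw [intervalIntegral.integral_eq_sub_of_hasDerivAt (fun s _ => hd s)]
    · have := pe f t (j.insertNth (-π) y) j
      rw [insert_add, show -π + 2 * π = π by ring] at this
      rw [this, sub_self]
    · apply Continuous.intervalIntegrable
      apply (ct _).comp
      exact continuous_const.prodMk (Continuous.finInsertNth j continuous_id continuous_const)
  simp [this]

theorem dom_prod (g : Fin 3 → ℝ → ℝ) :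
    ∫ x in dom, ∏ i, g i (x i) = ∏ i, ∫ s in (-π)..π, g i s := by
  have h1 : (volume.restrict dom : Measure (Fin 3 → ℝ)) =
      Measure.pi (fun _ => (volume : Measure ℝ).restrict (Set.Icc (-π) π)) := by
    rw [dom, ← Set.pi_univ_Icc, volume_pi, Measure.restrict_pi_pi]
  rw [h1, integral_fintype_prod_eq_prod]
  congr 1
  funext i
  rw [intervalIntegral.integral_of_le neg_pi_le_pi, integral_Icc_eq_integral_Ioc]

theorem int_pi_one : ∫ _ in (-π)..π, (1 : ℝ) = 2 * π := by
  simp; ring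

theorem dom_one (k : Fin 3) (g : ℝ → ℝ) :
    ∫ x in dom, g (x k) = (2 * π) ^ 2 * ∫ s in (-π)..π, g s := by
  have := dom_prod (fun i => if i = k then g else fun _ => 1)
  have e1 : ∀ x : Fin 3 → ℝ, ∏ i, (if i = k then g else fun _ => 1) (x i) = g (x k) := by
    intro x; fin_cases k <;> simp [Fin.prod_univ_three]
  simp only [e1] at this
  rw [this]
  fin_cases k <;> simp [Fin.prod_univ_three] <;> ring_nf <;> simp

theorem dom_two (k l : Fin 3) (hkl : k ≠ l) (g h : ℝ → ℝ) :
    ∫ x in dom, g (x k) * h (x l) = (2 * π) * ((∫ s in (-π)..π, g s) * ∫ s in (-π)..π, h s) := by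
  have := dom_prod (fun i => if i = k then g else if i = l then h else fun _ => 1)
  have e1 : ∀ x : Fin 3 → ℝ, ∏ i, (if i = k then g else if i = l then h else fun _ => 1) (x i)
      = g (x k) * h (x l) := by
    intro x; fin_cases k <;> fin_cases l <;> simp [Fin.prod_univ_three] at hkl ⊢ <;> ring
  simp only [e1] at this
  rw [this]
  fin_cases k <;> fin_cases l <;> simp [Fin.prod_univ_three] at hkl ⊢ <;> ring

theorem dom_vol : ∫ _ in dom, (1 : ℝ) = (2 * π) ^ 3 := by
  have := dom_one 0 (fun _ => 1)
  rw [this, int_pi_one]; ring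

end

noncomputable section
open MeasureTheory Real Matrix

theorem smooth_of_deriv {F G : ℝ → ℝ} (h : ∀ x, HasDerivAt F (G x) x) (hG : ContDiff ℝ (⊤ : ℕ∞) G) :
    ContDiff ℝ (⊤ : ℕ∞) F := by
  rw [contDiff_infty_iff_deriv]
  refine ⟨fun x => (h x).differentiableAt, ?_⟩
  have : deriv F = G := funext fun x => (h x).deriv
  rw [this]; exact hG

theorem periodic_primitive {G : ℝ → ℝ} (hG : ContDiff ℝ (⊤ : ℕ∞) G) (hp : Function.Periodic G (2 * π))
    (h0 : ∫ s in (-π)..π, G s = 0) :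
    ∃ F : ℝ → ℝ, ContDiff ℝ (⊤ : ℕ∞) F ∧ Function.Periodic F (2 * π) ∧ (∀ x, HasDerivAt F (G x) x) ∧
      (∫ s in (-π)..π, F s = 0) ∧ ∀ x, |F x| ≤ 2 * ∫ s in (-π)..π, |G s| := by
  have hGc : Continuous G := hG.continuous
  set F0 : ℝ → ℝ := fun x => ∫ s in (-π)..x, G s with hF0
  have hd : ∀ x, HasDerivAt F0 (G x) x := fun x =>
    intervalIntegral.integral_hasDerivAt_right (hGc.intervalIntegrable _ _)
      (hGc.stronglyMeasurableAtFilter _ _) hGc.continuousAt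
  have hF0c : Continuous F0 := continuous_iff_continuousAt.2 fun x => (hd x).continuousAt
  have hper : Function.Periodic F0 (2 * π) := by
    intro x
    have h1 : F0 (x + 2 * π) = F0 x + ∫ s in x..(x + 2 * π), G s :=
      (intervalIntegral.integral_add_adjacent_intervals (hGc.intervalIntegrable _ _)
        (hGc.intervalIntegrable _ _)).symm
    have h2 := hp.intervalIntegral_add_eq x (-π)
    rw [show -π + 2 * π = π by ring, h0] at h2
    rw [h1, h2, add_zero]
  have hb0 : ∀ x ∈ Set.Icc (-π) π, |F0 x| ≤ ∫ s in (-π)..π, |G s| := by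
    intro x hx
    calc |F0 x| ≤ ∫ s in (-π)..x, |G s| := intervalIntegral.abs_integral_le_integral_abs hx.1
      _ ≤ ∫ s in (-π)..π, |G s| := by
        apply intervalIntegral.integral_mono_interval le_rfl hx.1 hx.2
        · exact Filter.Eventually.of_forall fun s => abs_nonneg _
        · exact hGc.abs.intervalIntegrable _ _
  have hb : ∀ x, |F0 x| ≤ ∫ s in (-π)..π, |G s| := by
    intro x
    obtain ⟨y, hy, hxy⟩ := hper.exists_mem_Ico (by positivity) x (-π)
    rw [hxy]
    exact hb0 y ⟨hy.1, by linarith [hy.2]⟩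
  set m := (∫ s in (-π)..π, F0 s) / (2 * π) with hm
  have hmb : |m| ≤ ∫ s in (-π)..π, |G s| := by
    rw [hm, abs_div, abs_of_pos (show (0 : ℝ) < 2 * π by positivity), div_le_iff₀ (by positivity)]
    have := intervalIntegral.norm_integral_le_of_norm_le_const (a := -π) (b := π) (f := F0)
      (C := ∫ s in (-π)..π, |G s|) (fun x _ => hb x)
    rw [show π - -π = 2 * π by ring, abs_of_pos (show (0 : ℝ) < 2 * π by positivity)] at this
    exact this
  have hd' : ∀ x, HasDerivAt (fun x => F0 x - m) (G x) x := fun x => (hd x).sub_const m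
  refine ⟨fun x => F0 x - m, smooth_of_deriv hd' hG, fun x => by simp only [hper x], hd', ?_, ?_⟩
  · rw [intervalIntegral.integral_sub (hF0c.intervalIntegrable _ _) (by simp)]
    simp only [intervalIntegral.integral_const, smul_eq_mul, hm]
    field_simp
    ring
  · intro x
    calc |F0 x - m| ≤ |F0 x| + |m| := abs_sub _ _
      _ ≤ _ := by linarith [hb x]

structure Prof (C : ℝ) (M : ℕ) where
  (f f1 f2 t1 t2 : ℝ → ℝ)
  sf : ContDiff ℝ (⊤ : ℕ∞) f
  sf1 : ContDiff ℝ (⊤ : ℕ∞) f1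
  sf2 : ContDiff ℝ (⊤ : ℕ∞) f2
  st1 : ContDiff ℝ (⊤ : ℕ∞) t1
  st2 : ContDiff ℝ (⊤ : ℕ∞) t2
  pf : Function.Periodic f (2 * π)
  pf1 : Function.Periodic f1 (2 * π)
  pf2 : Function.Periodic f2 (2 * π)
  pt1 : Function.Periodic t1 (2 * π)
  pt2 : Function.Periodic t2 (2 * π)
  d2 : ∀ x, HasDerivAt f2 (f1 x) x
  d1 : ∀ x, HasDerivAt f1 (f x) x
  dt1 : ∀ x, HasDerivAt t1 (f x ^ 2 - 1) x
  dt2 : ∀ x, HasDerivAt t2 (t1 x) x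
  bf : ∀ x, |f x| ≤ C * M
  bdf : ∀ x, |deriv f x| ≤ C * M ^ 3
  b1 : ∀ x, |f1 x| ≤ C
  b2 : ∀ x, |f2 x| ≤ C
  bt1 : ∀ x, |t1 x| ≤ C
  bt2 : ∀ x, |t2 x| ≤ C
  l1 : ∫ s in (-π)..π, |f s| ≤ C / M
  dis : ∀ x, f x * f (x + π) = 0

/-- the raw profile -/
theorem raw_profile : ∃ C : ℝ, 0 ≤ C ∧ ∀ M : ℕ, 2 ≤ M → ∃ P P1 P2 P3 : ℝ → ℝ,
    ContDiff ℝ (⊤ : ℕ∞) P ∧ (∀ x, HasDerivAt P (P1 x) x) ∧ (∀ x, HasDerivAt P1 (P2 x) x) ∧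
    (∀ x, HasDerivAt P2 (P3 x) x) ∧ Function.Periodic P (2 * π) ∧
    (∀ x, |P x| ≤ C) ∧ (∀ x, |P1 x| ≤ C) ∧ (∀ x, |P2 x| ≤ C * M) ∧ (∀ x, |P3 x| ≤ C * M ^ 3) ∧
    (∀ x, 1 < (M : ℝ) ^ 4 * ((1 - cos x) / 2) → P2 x = 0) ∧
    P 0 = 1 / (M : ℝ) ^ 3 ∧ P1 0 = 0 ∧ P (π / (M : ℝ) ^ 2) = 0 := by
  set h : ℝ → ℝ := fun s => Real.smoothTransition (1 - s) with hh
  have hs : ContDiff ℝ (⊤ : ℕ∞) h := Real.smoothTransition.contDiff.comp (contDiff_const.sub contDiff_id)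
  have hD : ∀ {g : ℝ → ℝ}, ContDiff ℝ (⊤ : ℕ∞) g → ContDiff ℝ (⊤ : ℕ∞) (deriv g) ∧
      ∀ x, HasDerivAt g (deriv g x) x := by
    intro g hg
    have := contDiff_infty_iff_deriv.1 hg
    exact ⟨this.2, fun x => (this.1 x).hasDerivAt⟩
  obtain ⟨s1, d1⟩ := hD hs
  obtain ⟨s2, d2⟩ := hD s1
  obtain ⟨s3, d3⟩ := hD s2
  set h1 := deriv h with hh1
  set h2 := deriv h1 with hh2
  set h3 := deriv h2 with hh3
  have z0 : ∀ s, 1 < s → h s = 0 := fun s hs => Real.smoothTransition.zero_of_nonpos (by linarith)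
  have hz : ∀ g : ℝ → ℝ, (∀ s, 1 < s → g s = 0) → ∀ s, 1 < s → deriv g s = 0 := by
    intro g hg s hs
    have : g =ᶠ[nhds s] fun _ => 0 := by
      filter_upwards [lt_mem_nhds hs] with y hy using hg y hy
    rw [this.deriv_eq]; simp
  have z1 : ∀ s, 1 < s → h1 s = 0 := hz h z0
  have z2 : ∀ s, 1 < s → h2 s = 0 := hz h1 z1
  have z3 : ∀ s, 1 < s → h3 s = 0 := hz h2 z2
  have hbd : ∀ g : ℝ → ℝ, Continuous g → ∃ C, 0 ≤ C ∧ ∀ s ∈ Set.Icc (0 : ℝ) 1, |g s| ≤ C := by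
    intro g hg
    obtain ⟨C, hC⟩ := (isCompact_Icc (a := (0 : ℝ)) (b := 1)).exists_bound_of_continuousOn hg.continuousOn
    exact ⟨C, (abs_nonneg _).trans (hC 0 (by simp)), hC⟩
  obtain ⟨C0, hC0, b0⟩ := hbd h hs.continuous
  obtain ⟨C1, hC1, b1⟩ := hbd h1 s1.continuous
  obtain ⟨C2, hC2, b2⟩ := hbd h2 s2.continuous
  obtain ⟨C3, hC3, b3⟩ := hbd h3 s3.continuous
  refine ⟨C0 + 3 * C1 + 3 * C2 + C3, by positivity, fun M hM => ?_⟩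
  have hM1 : (1 : ℝ) ≤ M := by exact_mod_cast (by omega : 1 ≤ M)
  have hM0 : (0 : ℝ) < M := by linarith
  set w : ℝ → ℝ := fun x => (M : ℝ) ^ 4 * ((1 - cos x) / 2) with hw
  set w1 : ℝ → ℝ := fun x => (M : ℝ) ^ 4 * (sin x / 2) with hw1
  set w2 : ℝ → ℝ := fun x => (M : ℝ) ^ 4 * (cos x / 2) with hw2
  have dw : ∀ x, HasDerivAt w (w1 x) x := by
    intro x
    have := (((hasDerivAt_cos x).const_sub 1).div_const 2).const_mul ((M : ℝ) ^ 4)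
    simpa [hw1] using this
  have dw1 : ∀ x, HasDerivAt w1 (w2 x) x := fun x =>
    ((hasDerivAt_sin x).div_const 2).const_mul ((M : ℝ) ^ 4)
  have dw2 : ∀ x, HasDerivAt w2 (- w1 x) x := by
    intro x
    have := ((hasDerivAt_cos x).div_const 2).const_mul ((M : ℝ) ^ 4)
    have e : - w1 x = (M : ℝ) ^ 4 * (-sin x / 2) := by
      show -((M : ℝ) ^ 4 * (sin x / 2)) = _
      ring
    rw [e]; exact this
  have w0 : ∀ x, 0 ≤ w x := fun x => by
    have := cos_le_one x
    simp only [hw]; exact mul_nonneg (by positivity) (by linarith)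
  have bw1 : ∀ x, w x ≤ 1 → |w1 x| ≤ (M : ℝ) ^ 2 := by
    intro x hx
    apply abs_le_of_sq_le_sq _ (by positivity)
    have e1 : w1 x ^ 2 = (M : ℝ) ^ 4 * (w x * ((1 + cos x) / 2)) := by
      simp only [hw1, hw]
      have := sin_sq_add_cos_sq x
      have h5 : sin x ^ 2 = 1 - cos x ^ 2 := by linarith
      calc _ = (M : ℝ) ^ 8 * (sin x ^ 2) / 4 := by ring
        _ = _ := by rw [h5]; ring
    rw [e1]
    have h6 : w x * ((1 + cos x) / 2) ≤ 1 := by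
      have := cos_le_one x
      have := neg_one_le_cos x
      have := w0 x
      nlinarith
    calc (M : ℝ) ^ 4 * (w x * ((1 + cos x) / 2)) ≤ (M : ℝ) ^ 4 * 1 :=
          mul_le_mul_of_nonneg_left h6 (by positivity)
      _ = _ := by ring
  have bw2 : ∀ x, |w2 x| ≤ (M : ℝ) ^ 4 := by
    intro x
    simp only [hw2]
    rw [abs_mul, abs_of_nonneg (by positivity : (0 : ℝ) ≤ (M : ℝ) ^ 4)]
    have : |cos x / 2| ≤ 1 := by
      rw [abs_div]; have := abs_cos_le_one x; rw [abs_two]; linarith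
    nlinarith [pow_pos hM0 4]
  set c := 1 / (M : ℝ) ^ 3 with hc
  have c0 : 0 ≤ c := by positivity
  have cle : c ≤ 1 := by
    rw [hc, div_le_one (by positivity)]; exact one_le_pow₀ hM1
  have cM : c * (M : ℝ) ^ 3 = 1 := by rw [hc]; field_simp
  refine ⟨fun x => c * h (w x), fun x => c * (h1 (w x) * w1 x),
    fun x => c * (h2 (w x) * w1 x * w1 x + h1 (w x) * w2 x),
    fun x => c * ((h3 (w x) * w1 x * w1 x + h2 (w x) * w2 x) * w1 x + h2 (w x) * w1 x * w2 x +
      (h2 (w x) * w1 x * w2 x + h1 (w x) * (- w1 x))), ?_, ?_, ?_, ?_, ?_, ?_, ?_, ?_, ?_, ?_, ?_, ?_, ?_⟩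
  · apply contDiff_const.mul
    apply hs.comp
    simp only [hw]
    exact contDiff_const.mul ((contDiff_const.sub contDiff_cos).div_const 2)
  · intro x
    exact ((d1 (w x)).comp x (dw x)).const_mul c
  · intro x
    exact ((((d2 (w x)).comp x (dw x)).mul (dw1 x))).const_mul c
  · intro x
    have a := ((d3 (w x)).comp x (dw x)).mul (dw1 x)
    have b := a.mul (dw1 x)
    have b' := ((d2 (w x)).comp x (dw x)).mul (dw2 x)
    exact (b.add b').const_mul c
  · intro x
    simp only [hw, cos_add_two_pi]
  · intro x
    rcases le_or_gt (w x) 1 with hx | hx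
    · rw [abs_mul, abs_of_nonneg c0]
      have := b0 (w x) ⟨w0 x, hx⟩
      nlinarith [abs_nonneg (h (w x))]
    · show |c * h (w x)| ≤ _
      rw [z0 _ hx]; simp; positivity
  · intro x
    rcases le_or_gt (w x) 1 with hx | hx
    · rw [abs_mul, abs_of_nonneg c0, abs_mul]
      have e1 := b1 (w x) ⟨w0 x, hx⟩
      have e2 := bw1 x hx
      have e3 : |h1 (w x)| * |w1 x| ≤ C1 * (M : ℝ) ^ 3 := by
        apply mul_le_mul e1 (e2.trans _) (abs_nonneg _) hC1
        exact pow_le_pow_right₀ hM1 (by norm_num)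
      calc _ ≤ c * (C1 * (M : ℝ) ^ 3) := mul_le_mul_of_nonneg_left e3 c0
        _ = C1 * (c * (M : ℝ) ^ 3) := by ring
        _ = C1 := by rw [cM, mul_one]
        _ ≤ _ := by linarith
    · simp only [z1 _ hx]; simp; positivity
  · intro x
    rcases le_or_gt (w x) 1 with hx | hx
    · rw [abs_mul, abs_of_nonneg c0]
      have e1 := b1 (w x) ⟨w0 x, hx⟩
      have e2 := bw1 x hx
      have e4 := b2 (w x) ⟨w0 x, hx⟩
      have e5 := bw2 x
      have e6 : |h2 (w x) * w1 x * w1 x + h1 (w x) * w2 x| ≤ C2 * (M : ℝ) ^ 2 * (M : ℝ) ^ 2 + C1 * (M : ℝ) ^ 4 := by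
        refine (abs_add_le _ _).trans ?_
        simp only [abs_mul]
        gcongr
      calc _ ≤ c * (C2 * (M : ℝ) ^ 2 * (M : ℝ) ^ 2 + C1 * (M : ℝ) ^ 4) := mul_le_mul_of_nonneg_left e6 c0
        _ = (C2 + C1) * (c * (M : ℝ) ^ 3) * M := by ring
        _ = (C2 + C1) * M := by rw [cM, mul_one]
        _ ≤ _ := mul_le_mul_of_nonneg_right (by linarith) (by positivity)
    · simp only [z1 _ hx, z2 _ hx]; simp; positivity
  · intro x
    rcases le_or_gt (w x) 1 with hx | hx
    · rw [abs_mul, abs_of_nonneg c0]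
      have e1 := b1 (w x) ⟨w0 x, hx⟩
      have e2 := bw1 x hx
      have e4 := b2 (w x) ⟨w0 x, hx⟩
      have e5 := bw2 x
      have e7 := b3 (w x) ⟨w0 x, hx⟩
      have e8 : (M : ℝ) ^ 2 ≤ (M : ℝ) ^ 6 := pow_le_pow_right₀ hM1 (by norm_num)
      have e6 : |(h3 (w x) * w1 x * w1 x + h2 (w x) * w2 x) * w1 x + h2 (w x) * w1 x * w2 x +
      (h2 (w x) * w1 x * w2 x + h1 (w x) * (- w1 x))| ≤
        (C3 * (M : ℝ) ^ 2 * (M : ℝ) ^ 2 + C2 * (M : ℝ) ^ 4) * (M : ℝ) ^ 2 + C2 * (M : ℝ) ^ 2 * (M : ℝ) ^ 4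
          + (C2 * (M : ℝ) ^ 2 * (M : ℝ) ^ 4 + C1 * (M : ℝ) ^ 6) := by
        refine (abs_add_le _ _).trans (add_le_add ((abs_add_le _ _).trans (add_le_add ?_ ?_))
          ((abs_add_le _ _).trans (add_le_add ?_ ?_)))
        · rw [abs_mul]
          apply mul_le_mul _ e2 (abs_nonneg _) (by positivity)
          refine (abs_add_le _ _).trans ?_
          simp only [abs_mul]
          gcongr
        · simp only [abs_mul]; gcongr
        · simp only [abs_mul]; gcongr
        · simp only [abs_mul, abs_neg]
          exact mul_le_mul e1 (e2.trans e8) (abs_nonneg _) hC1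
      refine (mul_le_mul_of_nonneg_left e6 c0).trans ?_
      calc _ = (C3 + 3 * C2 + C1) * (c * (M : ℝ) ^ 3) * M ^ 3 := by ring
        _ = (C3 + 3 * C2 + C1) * M ^ 3 := by rw [cM, mul_one]
        _ ≤ _ := mul_le_mul_of_nonneg_right (by linarith) (by positivity)
    · simp only [z1 _ hx, z2 _ hx, z3 _ hx]; simp; positivity
  · intro x hx
    have : 1 < w x := hx
    simp only [z1 _ this, z2 _ this]; simp
  · simp [hw, hh, hc, Real.smoothTransition.one]
  · simp [hw1]
  · have h3 : 1 ≤ w (π / (M : ℝ) ^ 2) := by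
      have hle : |π / (M : ℝ) ^ 2| ≤ π := by
        rw [abs_of_nonneg (by positivity)]
        exact div_le_self pi_pos.le (one_le_pow₀ hM1)
      have := cos_le_one_sub_mul_cos_sq hle
      have e : 2 / π ^ 2 * (π / (M : ℝ) ^ 2) ^ 2 = 2 / (M : ℝ) ^ 4 := by
        field_simp
      rw [e] at this
      simp only [hw]
      calc (1 : ℝ) = (M : ℝ) ^ 4 * ((2 / (M : ℝ) ^ 4) / 2) := by field_simp
        _ ≤ _ := by gcongr; linarith
    have : h (w (π / (M : ℝ) ^ 2)) = 0 := Real.smoothTransition.zero_of_nonpos (by linarith)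
    simp only [this, mul_zero]

end

noncomputable section
open MeasureTheory Real Matrix

theorem smooth_deriv {F G : ℝ → ℝ} (h : ∀ x, HasDerivAt F (G x) x) (hF : ContDiff ℝ (⊤ : ℕ∞) F) :
    ContDiff ℝ (⊤ : ℕ∞) G := by
  have := (contDiff_infty_iff_deriv.1 hF).2
  have e : deriv F = G := funext fun x => (h x).deriv
  rwa [e] at this

theorem periodic_deriv {F G : ℝ → ℝ} (h : ∀ x, HasDerivAt F (G x) x) {T : ℝ} (hF : Function.Periodic F T) :
    Function.Periodic G T := by
  intro x
  have h1 := (h (x + T)).comp_add_const x T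
  have e : (fun y => F (y + T)) = F := funext hF
  rw [e] at h1
  exact h1.unique (h x)

theorem mean_lower {P P1 φ : ℝ → ℝ} {M : ℕ} (hM : 2 ≤ M) (hφ : Continuous φ)
    (d0 : ∀ x, HasDerivAt P (P1 x) x) (d1 : ∀ x, HasDerivAt P1 (φ x) x)
    (hP : P 0 = 1 / (M : ℝ) ^ 3) (hP1 : P1 0 = 0) (hx : P (π / (M : ℝ) ^ 2) = 0) :
    1 / π ^ 3 ≤ ∫ s in (-π)..π, φ s ^ 2 := by
  have hM1 : (1 : ℝ) ≤ M := by exact_mod_cast (by omega : 1 ≤ M)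
  have hM0 : (0 : ℝ) < M := by linarith
  set x1 : ℝ := π / (M : ℝ) ^ 2 with hx1
  have x10 : 0 < x1 := by positivity
  have x1le : x1 ≤ π := div_le_self pi_pos.le (one_le_pow₀ hM1)
  have key : ∫ s in (0 : ℝ)..x1, (x1 - s) * φ s = - (1 / (M : ℝ) ^ 3) := by
    have hd : ∀ s ∈ Set.uIcc 0 x1, HasDerivAt (fun s => (x1 - s) * P1 s + P s) ((x1 - s) * φ s) s := by
      intro s _
      have := (((hasDerivAt_id s).const_sub x1).mul (d1 s)).add (d0 s)
      have e : -1 * P1 s + (x1 - id s) * φ s + P1 s = (x1 - s) * φ s := by simp only [id]; ring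
      rw [e] at this
      exact this
    rw [intervalIntegral.integral_eq_sub_of_hasDerivAt hd
      (((continuous_const.sub continuous_id).mul hφ).intervalIntegrable _ _)]
    simp only [hP, hP1, hx]
    ring
  set α : ℝ := (M : ℝ) ^ 3 / π ^ 3 with hα
  have α0 : 0 < α := by positivity
  have h1 : 1 / (M : ℝ) ^ 3 ≤ ∫ s in (0 : ℝ)..x1, (1 / (2 * α) * φ s ^ 2 + α / 2 * x1 ^ 2) := by
    have : 1 / (M : ℝ) ^ 3 = ∫ s in (0 : ℝ)..x1, - ((x1 - s) * φ s) := by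
      rw [intervalIntegral.integral_neg, key, neg_neg]
    rw [this]
    apply intervalIntegral.integral_mono_on x10.le
    · exact (((continuous_const.sub continuous_id).mul hφ).neg).intervalIntegrable _ _
    · exact (by fun_prop : Continuous fun s => 1 / (2 * α) * φ s ^ 2 + α / 2 * x1 ^ 2).intervalIntegrable _ _
    · intro s hs
      have e1 : (x1 - s) ^ 2 ≤ x1 ^ 2 := by nlinarith [hs.1, hs.2]
      have e2 : 0 ≤ 1 / (2 * α) * (φ s + α * (x1 - s)) ^ 2 := by positivity
      have e3 : 1 / (2 * α) * (φ s + α * (x1 - s)) ^ 2 = 1 / (2 * α) * φ s ^ 2 + φ s * (x1 - s)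
          + α / 2 * (x1 - s) ^ 2 := by field_simp; ring
      nlinarith
  rw [intervalIntegral.integral_add ((by fun_prop : Continuous fun s => 1 / (2 * α) * φ s ^ 2).intervalIntegrable _ _)
    (by simp), intervalIntegral.integral_const_mul, intervalIntegral.integral_const, smul_eq_mul] at h1
  have e4 : (x1 - 0) * (α / 2 * x1 ^ 2) = 1 / 2 * (1 / (M : ℝ) ^ 3) := by
    rw [hα, hx1]; field_simp; ring
  have e5 : 1 / (2 * α) = π ^ 3 / 2 * (1 / (M : ℝ) ^ 3) := by rw [hα]; field_simp
  rw [e4, e5] at h1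
  have h2 : 1 / π ^ 3 ≤ ∫ s in (0 : ℝ)..x1, φ s ^ 2 := by
    rw [div_le_iff₀ (by positivity)]
    have : 0 < 1 / (M : ℝ) ^ 3 := by positivity
    nlinarith
  refine h2.trans ?_
  apply intervalIntegral.integral_mono_interval (by linarith [pi_pos]) x10.le x1le
  · exact Filter.Eventually.of_forall fun s => sq_nonneg _
  · exact (hφ.pow 2).intervalIntegrable _ _

theorem l1_bound {φ : ℝ → ℝ} {M : ℕ} {C : ℝ} (hM : 2 ≤ M) (hφ : Continuous φ)
    (hb : ∀ x, |φ x| ≤ C * M) (hz : ∀ x, 1 < (M : ℝ) ^ 4 * ((1 - cos x) / 2) → φ x = 0) :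
    ∫ s in (-π)..π, |φ s| ≤ 8 * C / M := by
  have hM1 : (2 : ℝ) ≤ M := by exact_mod_cast hM
  have hM0 : (0 : ℝ) < M := by linarith
  set y : ℝ := 4 / (M : ℝ) ^ 2 with hy
  have y0 : 0 < y := by positivity
  have y1 : y ≤ π := by
    rw [hy, div_le_iff₀ (by positivity)]
    nlinarith [pi_gt_three]
  have z : ∀ x, |x| ≤ π → y ≤ |x| → |φ x| = 0 := by
    intro x h1 h2
    rw [abs_eq_zero]
    apply hz
    have h3 := cos_le_one_sub_mul_cos_sq h1
    have h4 : y ^ 2 ≤ x ^ 2 := by rw [← sq_abs x]; gcongr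
    have h5 : 2 / π ^ 2 * y ^ 2 ≤ 1 - cos x := by
      have : 2 / π ^ 2 * y ^ 2 ≤ 2 / π ^ 2 * x ^ 2 := by gcongr
      linarith
    calc (1 : ℝ) < 16 / π ^ 2 := by
          rw [lt_div_iff₀ (by positivity)]; nlinarith [pi_lt_four, pi_pos]
      _ = (M : ℝ) ^ 4 * (2 / π ^ 2 * y ^ 2 / 2) := by rw [hy]; field_simp; norm_num
      _ ≤ _ := by gcongr
  have hc := hφ.abs
  rw [← intervalIntegral.integral_add_adjacent_intervals (b := y) (hc.intervalIntegrable _ _) (hc.intervalIntegrable _ _),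
    ← intervalIntegral.integral_add_adjacent_intervals (b := -y) (hc.intervalIntegrable _ _) (hc.intervalIntegrable _ _)]
  have a1 : ∫ s in (-π)..(-y), |φ s| = 0 := by
    rw [← intervalIntegral.integral_zero (a := -π) (b := -y)]
    apply intervalIntegral.integral_congr
    intro s hs
    rw [Set.uIcc_of_le (by linarith)] at hs
    apply z
    · rw [abs_of_nonpos (by linarith [hs.2])]; linarith [hs.1]
    · rw [abs_of_nonpos (by linarith [hs.2])]; linarith [hs.2]
  have a2 : ∫ s in y..π, |φ s| = 0 := by
    rw [← intervalIntegral.integral_zero (a := y) (b := π)]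
    apply intervalIntegral.integral_congr
    intro s hs
    rw [Set.uIcc_of_le (by linarith)] at hs
    apply z
    · rw [abs_of_nonneg (by linarith [hs.1])]; linarith [hs.2]
    · rw [abs_of_nonneg (by linarith [hs.1])]; linarith [hs.1]
  rw [a1, a2]
  have := intervalIntegral.norm_integral_le_of_norm_le_const (a := -y) (b := y) (f := fun s => |φ s|)
      (C := C * M) (fun x _ => by simpa using hb x)
  have h6 := (le_abs_self _).trans this
  rw [show y - -y = 2 * y by ring, abs_of_pos (by positivity)] at h6
  have : C * M * (2 * y) = 8 * C / M := by rw [hy]; field_simp; ring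
  linarith

theorem exists_prof : ∃ C : ℝ, 0 ≤ C ∧ ∀ M : ℕ, 2 ≤ M → Nonempty (Prof C M) := by
  obtain ⟨C, hC, H⟩ := raw_profile
  set K : ℝ := √(2 * π ^ 4) with hK
  have hK0 : 0 ≤ K := Real.sqrt_nonneg _
  set CC : ℝ := 8 * (K * C) + 8 * π + 2 * (2 * π * (8 * π)) with hCC
  have hKC : 0 ≤ K * C := by positivity
  have hp := pi_pos
  have cc1 : K * C ≤ CC := by have := mul_pos hp hp; rw [hCC]; nlinarith
  have cc2 : 8 * (K * C) ≤ CC := by have := mul_pos hp hp; rw [hCC]; nlinarith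
  have cc3 : 8 * π ≤ CC := by have := mul_pos hp hp; rw [hCC]; nlinarith
  have cc4 : 2 * (2 * π * (8 * π)) ≤ CC := by have := mul_pos hp hp; rw [hCC]; nlinarith
  refine ⟨CC, by positivity, fun M hM => ?_⟩
  have hM0 : (0 : ℝ) < M := by exact_mod_cast (by omega : 0 < M)
  obtain ⟨P, P1, P2, P3, sP, d0, d1, d2, pP, b0, b1, b2, b3, hz, e0, e1, e2⟩ := H M hM
  have sP1 := smooth_deriv d0 sP
  have sP2 := smooth_deriv d1 sP1
  have pP1 := periodic_deriv d0 pP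
  have pP2 := periodic_deriv d1 pP1
  have hI := mean_lower hM sP2.continuous d0 d1 e0 e1 e2
  set I := ∫ s in (-π)..π, P2 s ^ 2 with hIdef
  have hI0 : 0 < I := lt_of_lt_of_le (by positivity) hI
  set c : ℝ := √(2 * π / I) with hc
  have c0 : 0 ≤ c := Real.sqrt_nonneg _
  have cK : c ≤ K := by
    apply Real.sqrt_le_sqrt
    rw [div_le_iff₀ hI0]
    calc 2 * π = 2 * π ^ 4 * (1 / π ^ 3) := by field_simp
      _ ≤ _ := by gcongr
  have csq : c ^ 2 = 2 * π / I := Real.sq_sqrt (by positivity)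
  have cf : ∀ {x B : ℝ}, |x| ≤ C * B → 0 ≤ B → |c * x| ≤ K * C * B := by
    intro x B h hB
    rw [abs_mul, abs_of_nonneg c0, mul_assoc]
    exact mul_le_mul cK h (abs_nonneg _) hK0
  have sf : ContDiff ℝ (⊤ : ℕ∞) (fun x => c * P2 x) := contDiff_const.mul sP2
  have sqc : Continuous (fun x => (c * P2 x) ^ 2) := sf.continuous.pow 2
  have hmean : ∫ s in (-π)..π, ((c * P2 s) ^ 2 - 1) = 0 := by
    rw [intervalIntegral.integral_sub (sqc.intervalIntegrable _ _) (by simp)]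
    simp only [mul_pow, intervalIntegral.integral_const_mul, intervalIntegral.integral_const, smul_eq_mul]
    rw [← hIdef, csq]; field_simp; ring
  have hL : ∫ s in (-π)..π, |(c * P2 s) ^ 2 - 1| ≤ 4 * π := by
    calc _ ≤ ∫ s in (-π)..π, ((c * P2 s) ^ 2 + 1) := by
          apply intervalIntegral.integral_mono_on (by linarith)
          · exact ((sf.continuous.pow 2).sub continuous_const).abs.intervalIntegrable _ _
          · exact ((sf.continuous.pow 2).add continuous_const).intervalIntegrable _ _
          · intro s _
            rw [abs_le]; constructor <;> nlinarith [sq_nonneg (c * P2 s)]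
      _ = 4 * π := by
          rw [intervalIntegral.integral_add (sqc.intervalIntegrable _ _) (by simp)]
          simp only [mul_pow, intervalIntegral.integral_const_mul, intervalIntegral.integral_const, smul_eq_mul]
          rw [← hIdef, csq]; field_simp; ring
  have sG : ContDiff ℝ (⊤ : ℕ∞) (fun x => (c * P2 x) ^ 2 - 1) := (sf.pow 2).sub contDiff_const
  obtain ⟨t1, st1, pt1, dt1, mt1, bt1⟩ := periodic_primitive sG (fun x => by simp only [pP2 x]) hmean
  obtain ⟨t2, st2, pt2, dt2, mt2, bt2⟩ := periodic_primitive st1 pt1 mt1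
  have bt1' : ∀ x, |t1 x| ≤ 8 * π := fun x => (bt1 x).trans (by linarith)
  have bt2' : ∀ x, |t2 x| ≤ 2 * (2 * π * (8 * π)) := by
    intro x
    refine (bt2 x).trans ?_
    have := intervalIntegral.norm_integral_le_of_norm_le_const (a := -π) (b := π) (f := fun s => |t1 s|)
      (C := 8 * π) (fun x _ => by simpa using bt1' x)
    have h6 := (le_abs_self _).trans this
    rw [show π - -π = 2 * π by ring, abs_of_pos (show (0 : ℝ) < 2 * π by positivity)] at h6
    linarith
  refine ⟨⟨fun x => c * P2 x, fun x => c * P1 x, fun x => c * P x, t1, t2, sf, contDiff_const.mul sP1,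
    contDiff_const.mul sP, st1, st2, fun x => by simp only [pP2 x], fun x => by simp only [pP1 x],
    fun x => by simp only [pP x], pt1, pt2, fun x => (d0 x).const_mul c, fun x => (d1 x).const_mul c,
    dt1, dt2, ?_, ?_, ?_, ?_, fun x => (bt1' x).trans cc3, fun x => (bt2' x).trans cc4, ?_, ?_⟩⟩
  · intro x
    exact (cf (b2 x) hM0.le).trans (by gcongr)
  · intro x
    rw [((d2 x).const_mul c).deriv]
    exact (cf (b3 x) (by positivity)).trans (by gcongr)
  · intro x
    have := cf (x := P1 x) (B := 1) (by simpa using b1 x) zero_le_one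
    linarith
  · intro x
    have := cf (x := P x) (B := 1) (by simpa using b0 x) zero_le_one
    linarith
  · have := l1_bound (φ := fun x => c * P2 x) (C := K * C) hM sf.continuous (fun x => cf (b2 x) hM0.le)
      (fun x hx => by rw [hz x hx, mul_zero])
    exact this.trans (by gcongr)
  · intro x
    rcases le_or_gt ((M : ℝ) ^ 4 * ((1 - cos x) / 2)) 1 with hx | hx
    · have : P2 (x + π) = 0 := by
        apply hz
        rw [cos_add_pi]
        have : (2 : ℝ) ^ 4 ≤ (M : ℝ) ^ 4 := by gcongr; exact_mod_cast hM
        nlinarith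
      simp only [this, mul_zero]
    · simp only [hz x hx, mul_zero, zero_mul]

end

noncomputable section
open MeasureTheory Real Matrix

/-- oscillating function of one coordinate -/
def wv (g : ℝ → ℝ) (hg : ContDiff ℝ (⊤ : ℕ∞) g) (hp : Function.Periodic g (2 * π)) (M : ℕ) (c : ℝ)
    (k : Fin 3) : SP :=
  ⟨fun z => g (M * z.2 k + c), by
    refine ⟨hg.comp (by fun_prop), fun t x i => ?_⟩
    by_cases h : i = k
    · subst h
      simp only [Pi.add_apply, Pi.smul_apply, Pi.single_eq_same, smul_eq_mul, mul_one]
      have := (hp.nat_mul M) (M * x i + c)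
      rw [← this]; congr 1; ring
    · simp [Pi.single_apply, Ne.symm h]⟩

@[simp] theorem wv_apply (g : ℝ → ℝ) (hg : ContDiff ℝ (⊤ : ℕ∞) g) (hp : Function.Periodic g (2 * π)) (M : ℕ)
    (c : ℝ) (k : Fin 3) (z : EE) : wv g hg hp M c k z = g (M * z.2 k + c) := rfl

theorem D_wv (g g' : ℝ → ℝ) (hg : ContDiff ℝ (⊤ : ℕ∞) g) (hp : Function.Periodic g (2 * π))
    (hg' : ContDiff ℝ (⊤ : ℕ∞) g') (hp' : Function.Periodic g' (2 * π)) (hd : ∀ x, HasDerivAt g (g' x) x)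
    (M : ℕ) (c : ℝ) (k : Fin 3) (v : EE) :
    D v (wv g hg hp M c k) = (M * v.2 k) • wv g' hg' hp' M c k := SP.ext' fun z => by
  have h1 : HasFDerivAt (fun z : EE => (M : ℝ) * z.2 k + c)
      ((M : ℝ) • ((ContinuousLinearMap.proj (R := ℝ) (φ := fun _ : Fin 3 => ℝ) k).comp
        (ContinuousLinearMap.snd ℝ ℝ (Fin 3 → ℝ)))) z := by
    exact (((ContinuousLinearMap.proj (R := ℝ) (φ := fun _ : Fin 3 => ℝ) k).comp
        (ContinuousLinearMap.snd ℝ ℝ (Fin 3 → ℝ))).hasFDerivAt.const_mul (M : ℝ)).add_const c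
  have h2 := ((hd (M * z.2 k + c)).comp_hasFDerivAt z h1).fderiv
  change fderiv ℝ (fun z : EE => g (M * z.2 k + c)) z v = _
  change fderiv ℝ (fun z : EE => g (M * z.2 k + c)) z = _ at h2
  rw [h2]
  simp
  ring

/-- second primitive of an oscillating function -/
structure Wave (Cp : ℝ) (M : ℕ) (k : Fin 3) (F2 F1 F0 : SP) : Prop where
  d2 : ∀ v : EE, D v F2 = (M * v.2 k) • F1
  d1 : ∀ v : EE, D v F1 = (M * v.2 k) • F0
  b2 : ∀ z, |F2 z| ≤ Cp
  b1 : ∀ z, |F1 z| ≤ Cp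

theorem comp_le {v : EE} (hv : ‖v‖ ≤ 1) (k : Fin 3) : |v.2 k| ≤ 1 :=
  (norm_le_pi_norm v.2 k).trans ((norm_snd_le v).trans hv)

theorem Bd.d1 {n : ℕ} {f : SP} {X : ℝ} (h : Bd (n + 1) f X) {v : EE} (hv : ‖v‖ ≤ 1) : Bd n (D v f) X :=
  h.2 v hv

section
variable {Cp : ℝ} {M : ℕ} {k : Fin 3} {F2 F1 F0 : SP}

theorem Wave.nonneg (W : Wave Cp M k F2 F1 F0) : 0 ≤ Cp := (abs_nonneg _).trans (W.b2 (0, 0))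

theorem Wave.dd (W : Wave Cp M k F2 F1 F0) (v w : EE) (a : SP) :
    D v (D w (F2 * a)) = ((M : ℝ) ^ 2 * v.2 k * w.2 k) • (F0 * a) + ((M * w.2 k) • (F1 * D v a) +
      (M * v.2 k) • (F1 * D w a) + F2 * D v (D w a)) := by
  rw [D_mul, map_add, D_mul, D_mul, W.d2, W.d2, map_smul, W.d1]
  apply SP.ext'; intro z
  simp only [SP.add_apply, SP.mul_apply, SP.smul_apply]
  ring

theorem Wave.est (W : Wave Cp M k F2 F1 F0) (hM : 1 ≤ M) {v w : EE} (hv : ‖v‖ ≤ 1) (hw : ‖w‖ ≤ 1) {a : SP}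
    {Y : ℝ} (ha : Bd 2 a Y) {z : EE} (hz : z ∈ Zs) :
    |D v (D w ((-(1 / (M : ℝ) ^ 2)) • (F2 * a))) z + v.2 k * w.2 k * (F0 z * a z)| ≤ 3 * Cp * Y / M := by
  have hM1 : (1 : ℝ) ≤ M := by exact_mod_cast hM
  have hM0 : (0 : ℝ) < M := by linarith
  have hC := W.nonneg
  have hY := ha.nonneg
  rw [map_smul, map_smul, W.dd]
  simp only [SP.add_apply, SP.mul_apply, SP.smul_apply]
  set q := v.2 k with hq
  set r := w.2 k with hr
  have e : -(1 / (M : ℝ) ^ 2) * ((M : ℝ) ^ 2 * q * r * (F0 z * a z) + (M * r * (F1 z * D v a z) +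
      M * q * (F1 z * D w a z) + F2 z * D v (D w a) z)) + q * r * (F0 z * a z)
      = -(1 / (M : ℝ) ^ 2) * (M * r * (F1 z * D v a z) + M * q * (F1 z * D w a z) + F2 z * D v (D w a) z) := by
    field_simp; ring
  rw [e, abs_mul, abs_neg, abs_of_pos (show 0 < 1 / (M : ℝ) ^ 2 by positivity)]
  have h1 : |D v a z| ≤ Y := (ha.d1 hv).zero z hz
  have h2 : |D w a z| ≤ Y := (ha.d1 hw).zero z hz
  have h3 : |D v (D w a) z| ≤ Y := ((ha.d1 hw).d1 hv).zero z hz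
  have hb1 := W.b1 z
  have hb2 := W.b2 z
  have hq1 : |q| ≤ 1 := comp_le hv k
  have hr1 : |r| ≤ 1 := comp_le hw k
  have g1 : |M * r * (F1 z * D v a z)| ≤ M * 1 * (Cp * Y) := by
    simp only [abs_mul, Nat.abs_cast]; gcongr
  have g2 : |M * q * (F1 z * D w a z)| ≤ M * 1 * (Cp * Y) := by
    simp only [abs_mul, Nat.abs_cast]; gcongr
  have g3 : |F2 z * D v (D w a) z| ≤ M * 1 * (Cp * Y) := by
    simp only [abs_mul]
    calc |F2 z| * |D v (D w a) z| ≤ Cp * Y := by gcongr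
      _ ≤ M * 1 * (Cp * Y) := by nlinarith [mul_nonneg hC hY]
  calc _ ≤ 1 / (M : ℝ) ^ 2 * (3 * (M * 1 * (Cp * Y))) := by
        gcongr
        refine (abs_add_le _ _).trans ?_
        have := abs_add_le (M * r * (F1 z * D v a z)) (M * q * (F1 z * D w a z))
        linarith
    _ = _ := by field_simp

theorem ee_snd (i k : Fin 3) : (ee i).2 k = if i = k then 1 else 0 := by
  simp [ee, Pi.single_apply, eq_comm]

/-- the curl-curl of a vector potential -/
def cc (H : Fin 3 → SP) (i : Fin 3) : SP := ∑ j, (D (ee i) (D (ee j) (H j)) - D (ee j) (D (ee j) (H i)))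

/-- the double-divergence corrector -/
def TT (Q : Fin 3 → Fin 3 → SP) (i j : Fin 3) : SP :=
  ∑ l, (D (ee i) (D (ee l) (Q l j)) + D (ee j) (D (ee l) (Q i l)) - D (ee l) (D (ee l) (Q i j)))

theorem Wave.cc_est (W : Wave Cp M k F2 F1 F0) (hM : 1 ≤ M) {a : Fin 3 → SP} {Y : ℝ} (ha : ∀ i, Bd 2 (a i) Y)
    (hk : a k = 0) {z : EE} (hz : z ∈ Zs) (i : Fin 3) :
    |cc (fun j => (-(1 / (M : ℝ) ^ 2)) • (F2 * a j)) i z - F0 z * a i z| ≤ 18 * (Cp * Y / M) := by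
  have key : cc (fun j => (-(1 / (M : ℝ) ^ 2)) • (F2 * a j)) i z - F0 z * a i z =
      ∑ j, ((D (ee i) (D (ee j) ((-(1 / (M : ℝ) ^ 2)) • (F2 * a j))) z + (ee i).2 k * (ee j).2 k * (F0 z * a j z))
        - (D (ee j) (D (ee j) ((-(1 / (M : ℝ) ^ 2)) • (F2 * a i))) z + (ee j).2 k * (ee j).2 k * (F0 z * a i z))) := by
    have h1 : ∑ j, (ee i).2 k * (ee j).2 k * (F0 z * a j z) = 0 := by
      apply Finset.sum_eq_zero
      intro j _
      rw [ee_snd j]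
      split_ifs with h
      · rw [h, hk]; simp
      · simp
    have h2 : ∑ j, (ee j).2 k * (ee j).2 k * (F0 z * a i z) = F0 z * a i z := by
      simp only [ee_snd]
      simp
    simp only [cc, SP.sum_apply, SP.sub_apply]
    simp only [Finset.sum_sub_distrib, Finset.sum_add_distrib, h1, h2]
    ring
  rw [key]
  refine (Finset.abs_sum_le_sum_abs _ _).trans ?_
  calc _ ≤ ∑ j : Fin 3, (3 * Cp * Y / M + 3 * Cp * Y / M) := by
        apply Finset.sum_le_sum
        intro j _
        refine (abs_sub _ _).trans (add_le_add (W.est hM (norm_ee i) (norm_ee j) (ha j) hz)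
          (W.est hM (norm_ee j) (norm_ee j) (ha i) hz))
    _ = _ := by simp; ring

theorem Wave.TT_est (W : Wave Cp M k F2 F1 F0) (hM : 1 ≤ M) {Q : Fin 3 → Fin 3 → SP} {Y : ℝ}
    (hQ : ∀ i j, Bd 2 (Q i j) Y)
    (hk : ∀ j, Q k j = 0) (hk' : ∀ i, Q i k = 0) {z : EE} (hz : z ∈ Zs) (i j : Fin 3) :
    |TT (fun i j => (-(1 / (M : ℝ) ^ 2)) • (F2 * Q i j)) i j z - F0 z * Q i j z| ≤ 27 * (Cp * Y / M) := by
  have key : TT (fun i j => (-(1 / (M : ℝ) ^ 2)) • (F2 * Q i j)) i j z - F0 z * Q i j z =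
      ∑ l, ((D (ee i) (D (ee l) ((-(1 / (M : ℝ) ^ 2)) • (F2 * Q l j))) z + (ee i).2 k * (ee l).2 k * (F0 z * Q l j z))
        + (D (ee j) (D (ee l) ((-(1 / (M : ℝ) ^ 2)) • (F2 * Q i l))) z + (ee j).2 k * (ee l).2 k * (F0 z * Q i l z))
        - (D (ee l) (D (ee l) ((-(1 / (M : ℝ) ^ 2)) • (F2 * Q i j))) z + (ee l).2 k * (ee l).2 k * (F0 z * Q i j z))) := by
    have h1 : ∑ l, (ee i).2 k * (ee l).2 k * (F0 z * Q l j z) = 0 := by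
      apply Finset.sum_eq_zero
      intro l _
      rw [ee_snd l]
      split_ifs with h
      · rw [h, hk]; simp
      · simp
    have h3 : ∑ l, (ee j).2 k * (ee l).2 k * (F0 z * Q i l z) = 0 := by
      apply Finset.sum_eq_zero
      intro l _
      rw [ee_snd l]
      split_ifs with h
      · rw [h, hk']; simp
      · simp
    have h2 : ∑ l, (ee l).2 k * (ee l).2 k * (F0 z * Q i j z) = F0 z * Q i j z := by
      simp only [ee_snd]
      simp
    simp only [TT, SP.sum_apply, SP.sub_apply, SP.add_apply]
    simp only [Finset.sum_sub_distrib, Finset.sum_add_distrib, h1, h2, h3]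
    ring
  rw [key]
  refine (Finset.abs_sum_le_sum_abs _ _).trans ?_
  calc _ ≤ ∑ j : Fin 3, (3 * Cp * Y / M + 3 * Cp * Y / M + 3 * Cp * Y / M) := by
        apply Finset.sum_le_sum
        intro l _
        refine (abs_sub _ _).trans (add_le_add ((abs_add_le _ _).trans
          (add_le_add (W.est hM (norm_ee i) (norm_ee l) (hQ l j) hz) (W.est hM (norm_ee j) (norm_ee l) (hQ i l) hz)))
          (W.est hM (norm_ee l) (norm_ee l) (hQ i j) hz))
    _ = _ := by simp; ring

theorem Wave.tH_est (W : Wave Cp M k F2 F1 F0) (hM : 1 ≤ M) {a : SP} {Y : ℝ} (ha : Bd 2 a Y)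
    {z : EE} (hz : z ∈ Zs) (j : Fin 3) :
    |D (ee j) (D e0 ((-(1 / (M : ℝ) ^ 2)) • (F2 * a))) z| ≤ 3 * (Cp * Y / M) := by
  have := W.est hM (norm_ee j) norm_e0 ha hz
  simp only [e0, Pi.zero_apply, mul_zero, zero_mul, add_zero] at this
  calc _ ≤ _ := this
    _ = _ := by ring

end

theorem SP.abs_smul_le {n : ℕ} {f : SP} {X Y c : ℝ} (h : Bd n f X) (hc : |c| * X ≤ Y) : Bd n (c • f) Y :=
  (h.smul c).mono hc

theorem Wave.bd3 {Cp : ℝ} {M : ℕ} {k : Fin 3} {F2 F1 F0 F' : SP} (W : Wave Cp M k F2 F1 F0) (hM : 1 ≤ M)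
    (hd : ∀ v : EE, D v F0 = (M * v.2 k) • F') (h0 : ∀ z, |F0 z| ≤ Cp * M) (h' : ∀ z, |F' z| ≤ Cp * M ^ 3) :
    Bd 3 F2 (Cp * M ^ 6) := by
  have hM1 : (1 : ℝ) ≤ M := by exact_mod_cast hM
  have hC := W.nonneg
  have pw : ∀ {m n : ℕ}, m ≤ n → Cp * (M : ℝ) ^ m ≤ Cp * (M : ℝ) ^ n := fun h =>
    mul_le_mul_of_nonneg_left (pow_le_pow_right₀ hM1 h) hC
  have sc : ∀ {n : ℕ} {f : SP} {e : ℕ} {v : EE}, ‖v‖ ≤ 1 → Bd n f (Cp * M ^ e) → Bd n ((M * v.2 k) • f) (Cp * M ^ (e + 1)) := by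
    intro n f e v hv hb
    apply SP.abs_smul_le hb
    rw [abs_mul, Nat.abs_cast]
    have := comp_le hv k
    calc (M : ℝ) * |v.2 k| * (Cp * M ^ e) ≤ (M : ℝ) * 1 * (Cp * M ^ e) := by gcongr
      _ = _ := by ring
  have a0 : Bd 0 F' (Cp * M ^ 3) := fun z _ => h' z
  have a1 : Bd 1 F0 (Cp * M ^ 4) := by
    refine ⟨fun z _ => (h0 z).trans (by simpa using pw (show 1 ≤ 4 by norm_num)), fun v hv => ?_⟩
    rw [hd]; exact sc hv a0
  have a2 : Bd 2 F1 (Cp * M ^ 5) := by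
    refine ⟨fun z _ => (W.b1 z).trans (by simpa using pw (show 0 ≤ 5 by norm_num)), fun v hv => ?_⟩
    rw [W.d1]; exact sc hv a1
  refine ⟨fun z _ => (W.b2 z).trans (by simpa using pw (show 0 ≤ 6 by norm_num)), fun v hv => ?_⟩
  rw [W.d2]; exact sc hv a2

end

noncomputable section
open MeasureTheory Real Matrix

/-- stress data -/
structure AD where
  X : ℝ
  hX : 1 ≤ X
  S : Fin 3 → Fin 3 → SP
  G : Fin 3 → Fin 3 → SP
  hS : ∀ i j, S i j = S j i
  hG : ∀ i j, G i j = - G j i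
  bS : ∀ i j, Bd 3 (S i j) X
  bG : ∀ i j, Bd 3 (G i j) X

def PB (f : AD → SP) : Prop := ∃ C : ℝ, 0 ≤ C ∧ ∃ K : ℕ, ∀ d : AD, Bd 3 (f d) (C * d.X ^ K)

theorem PB.add {f g : AD → SP} (hf : PB f) (hg : PB g) : PB (fun d => f d + g d) := by
  obtain ⟨C, hC, K, h⟩ := hf
  obtain ⟨C', hC', K', h'⟩ := hg
  refine ⟨C + C', by positivity, K + K', fun d => ((h d).add (h' d)).mono ?_⟩
  have e1 : d.X ^ K ≤ d.X ^ (K + K') := pow_le_pow_right₀ d.hX (by omega)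
  have e2 : d.X ^ K' ≤ d.X ^ (K + K') := pow_le_pow_right₀ d.hX (by omega)
  rw [add_mul]; gcongr

theorem PB.mul {f g : AD → SP} (hf : PB f) (hg : PB g) : PB (fun d => f d * g d) := by
  obtain ⟨C, hC, K, h⟩ := hf
  obtain ⟨C', hC', K', h'⟩ := hg
  refine ⟨2 ^ 3 * (C * C'), by positivity, K + K', fun d => ((h d).mul (h' d)).mono (le_of_eq ?_)⟩
  rw [pow_add]; ring

theorem PB.smul {f : AD → SP} (hf : PB f) (m : ℕ) : PB (fun d => (d.X ^ m) • f d) := by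
  obtain ⟨C, hC, K, h⟩ := hf
  refine ⟨C, hC, m + K, fun d => ((h d).smul _).mono (le_of_eq ?_)⟩
  have := d.hX
  rw [abs_of_nonneg (by positivity), pow_add]; ring

theorem PB.smulc {f : AD → SP} (hf : PB f) (c : AD → ℝ) (hc : ∀ d, |c d| ≤ 1) : PB (fun d => c d • f d) := by
  obtain ⟨C, hC, K, h⟩ := hf
  refine ⟨C, hC, K, fun d => ((h d).smul _).mono ?_⟩
  exact mul_le_of_le_one_left (h d).nonneg (hc d)

theorem PB.neg {f : AD → SP} (hf : PB f) : PB (fun d => - f d) := by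
  obtain ⟨C, hC, K, h⟩ := hf
  exact ⟨C, hC, K, fun d => (h d).neg⟩

theorem PB.const (c : ℝ) : PB (fun _ => algebraMap ℝ SP c) :=
  ⟨|c|, abs_nonneg _, 0, fun d => (Bd.const 3 c).mono (by simp)⟩

theorem PB.zero : PB (fun _ => 0) := by
  have := PB.const 0
  simpa using this

theorem PB.one : PB (fun _ => 1) := by
  have := PB.const 1
  simpa using this

theorem PB.sum {ι : Type*} (s : Finset ι) {f : ι → AD → SP} (hf : ∀ i, PB (f i)) :
    PB (fun d => ∑ i ∈ s, f i d) := by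
  classical
  induction s using Finset.induction_on with
  | empty => simpa using PB.zero
  | insert a s ha ih =>
    simp only [Finset.sum_insert ha]
    exact (hf a).add ih

theorem PB.rpw {f : AD → SP} (hf : PB f) (h1 : ∀ d z, 1 ≤ f d z) (p : ℝ) (hp : p ≤ 1) :
    PB (fun d => rpw p (f d) (h1 d)) := by
  obtain ⟨C, hC, K, h⟩ := hf
  obtain ⟨C', hC', K', h'⟩ := Bd.rpw 3 p hp
  refine ⟨C' * (1 + C) ^ K', by positivity, K * K', fun d => ?_⟩
  have hX := d.hX
  have e1 : (1 : ℝ) ≤ d.X ^ K := one_le_pow₀ hX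
  refine (h' (f d) (h1 d) ((1 + C) * d.X ^ K) ?_ ((h d).mono ?_)).mono (le_of_eq ?_)
  · nlinarith
  · nlinarith
  · rw [mul_pow, pow_mul]; ring

theorem PB.unif {ι : Type*} [Fintype ι] {f : ι → AD → SP} (hf : ∀ i, PB (f i)) :
    ∃ C : ℝ, 1 ≤ C ∧ ∃ K : ℕ, ∀ i d, Bd 3 (f i d) (C * d.X ^ K) := by
  choose C hC K h using hf
  refine ⟨1 + ∑ i, C i, le_add_of_nonneg_right (Finset.sum_nonneg fun i _ => hC i), ∑ i, K i, fun i d => (h i d).mono ?_⟩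
  have e1 : C i ≤ 1 + ∑ i, C i := by
    have := Finset.single_le_sum (fun i _ => hC i) (Finset.mem_univ i)
    linarith
  have e2 : K i ≤ ∑ i, K i := Finset.single_le_sum (fun i _ => Nat.zero_le _) (Finset.mem_univ i)
  have := hC i
  have hX := d.hX
  have e3 : d.X ^ K i ≤ d.X ^ (∑ i, K i) := pow_le_pow_right₀ hX e2
  exact mul_le_mul e1 e3 (by positivity) (by linarith)

namespace AD
variable (d : AD)

def s (i j : Fin 3) : SP := (d.X ^ 2) • d.S i j
def g (i j : Fin 3) : SP := (d.X ^ 2) • d.G i j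

def Y : SP := 1 + ((∑ i, ∑ j, d.s i j * d.s i j) + ∑ i, ∑ j, d.g i j * d.g i j)

theorem Y_apply (z : EE) : d.Y z = 1 + ((∑ i, ∑ j, d.s i j z ^ 2) + ∑ i, ∑ j, d.g i j z ^ 2) := by
  simp [Y, sq]

theorem Y1 (z : EE) : 1 ≤ d.Y z := by
  rw [Y_apply]
  have h1 : 0 ≤ ∑ i, ∑ j, d.s i j z ^ 2 := by positivity
  have h2 : 0 ≤ ∑ i, ∑ j, d.g i j z ^ 2 := by positivity
  linarith

theorem s_le (i j : Fin 3) (z : EE) : d.s i j z ^ 2 ≤ d.Y z := by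
  rw [Y_apply]
  have h1 : d.s i j z ^ 2 ≤ ∑ i, ∑ j, d.s i j z ^ 2 :=
    (Finset.single_le_sum (f := fun j => d.s i j z ^ 2) (fun j _ => sq_nonneg _) (Finset.mem_univ j)).trans
     (Finset.single_le_sum (f := fun i => ∑ j, d.s i j z ^ 2)
      (fun i _ => Finset.sum_nonneg fun j _ => sq_nonneg _) (Finset.mem_univ i))
  have h2 : 0 ≤ ∑ i, ∑ j, d.g i j z ^ 2 := by positivity
  linarith

theorem g_le (i j : Fin 3) (z : EE) : d.g i j z ^ 2 ≤ d.Y z := by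
  rw [Y_apply]
  have h1 : d.g i j z ^ 2 ≤ ∑ i, ∑ j, d.g i j z ^ 2 :=
    (Finset.single_le_sum (f := fun j => d.g i j z ^ 2) (fun j _ => sq_nonneg _) (Finset.mem_univ j)).trans
     (Finset.single_le_sum (f := fun i => ∑ j, d.g i j z ^ 2)
      (fun i _ => Finset.sum_nonneg fun j _ => sq_nonneg _) (Finset.mem_univ i))
  have h2 : 0 ≤ ∑ i, ∑ j, d.s i j z ^ 2 := by positivity
  linarith

def y : SP := rpw (1 / 4) d.Y d.Y1
def yi : SP := rpw (-(1 / 4)) d.Y d.Y1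

theorem y_pos (z : EE) : 0 < d.y z := rpow_pos_of_pos (lt_of_lt_of_le one_pos (d.Y1 z)) _

theorem y_yi (z : EE) : d.y z * d.yi z = 1 := by
  have h := lt_of_lt_of_le one_pos (d.Y1 z)
  show d.Y z ^ (1 / 4 : ℝ) * d.Y z ^ (-(1 / 4) : ℝ) = 1
  rw [← rpow_add h]; norm_num

theorem y4 (z : EE) : d.y z ^ 4 = d.Y z := by
  have h := (lt_of_lt_of_le one_pos (d.Y1 z)).le
  show (d.Y z ^ (1 / 4 : ℝ)) ^ 4 = d.Y z
  rw [← rpow_natCast, ← rpow_mul h]; norm_num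

theorem y1 (z : EE) : 1 ≤ d.y z := one_le_rpow (d.Y1 z) (by norm_num)

theorem abs_le_of {x y : ℝ} (hy : 0 ≤ y) (h : x ^ 2 ≤ y ^ 4) : |x| ≤ y ^ 2 := by
  apply abs_le_of_sq_le_sq _ (by positivity)
  calc x ^ 2 ≤ y ^ 4 := h
    _ = _ := by ring

theorem mul_le_of {x y i : ℝ} (hi : y * i = 1) (h : x ^ 2 ≤ y ^ 4) : (x * i) ^ 2 ≤ y ^ 2 := by
  calc (x * i) ^ 2 = x ^ 2 * i ^ 2 := by ring
    _ ≤ y ^ 4 * i ^ 2 := by gcongr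
    _ = y ^ 2 * (y * i) ^ 2 := by ring
    _ = y ^ 2 := by rw [hi]; ring

theorem s_abs (i j : Fin 3) (z : EE) : |d.s i j z| ≤ d.y z ^ 2 :=
  abs_le_of (d.y_pos z).le ((d.s_le i j z).trans (d.y4 z).ge)

theorem s_mul (i j : Fin 3) (z : EE) : (d.s i j z * d.yi z) ^ 2 ≤ d.y z ^ 2 :=
  mul_le_of (d.y_yi z) ((d.s_le i j z).trans (d.y4 z).ge)

theorem g_mul (i j : Fin 3) (z : EE) : (d.g i j z * d.yi z) ^ 2 ≤ d.y z ^ 2 :=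
  mul_le_of (d.y_yi z) ((d.g_le i j z).trans (d.y4 z).ge)

/-- diagonal amplitude squared -/
def ZZ (l : Fin 3) : SP := (3 : ℝ) • (d.y * d.y) + - d.s l l +
  - ((d.s (l + 2) l * d.yi) * (d.s (l + 2) l * d.yi)) + (d.g (l + 2) l * d.yi) * (d.g (l + 2) l * d.yi)

theorem ZZ_apply (l : Fin 3) (z : EE) : d.ZZ l z = 3 * d.y z ^ 2 - d.s l l z - (d.s (l + 2) l z * d.yi z) ^ 2
    + (d.g (l + 2) l z * d.yi z) ^ 2 := by
  simp [ZZ]; ring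

theorem ZZ1 (l : Fin 3) (z : EE) : 1 ≤ d.ZZ l z := by
  rw [ZZ_apply]
  have h1 := (abs_le.1 (d.s_abs l l z)).2
  have h2 := d.s_mul (l + 2) l z
  have h3 := d.y1 z
  nlinarith [sq_nonneg (d.g (l + 2) l z * d.yi z)]

theorem ZZ_le (l : Fin 3) (z : EE) : d.ZZ l z ≤ 5 * d.y z ^ 2 := by
  rw [ZZ_apply]
  have h1 := (abs_le.1 (d.s_abs l l z)).1
  have h2 := d.g_mul (l + 2) l z
  nlinarith [sq_nonneg (d.s (l + 2) l z * d.yi z)]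

def al (l : Fin 3) : SP := rpw (1 / 2) (d.ZZ l) (d.ZZ1 l)

theorem al_sq (l : Fin 3) (z : EE) : d.al l z * d.al l z = d.ZZ l z := by
  have h := lt_of_lt_of_le one_pos (d.ZZ1 l z)
  show d.ZZ l z ^ (1 / 2 : ℝ) * d.ZZ l z ^ (1 / 2 : ℝ) = _
  rw [← rpow_add h]; norm_num

/-- normalised velocity amplitudes -/
def a (n : Fin 3 × Bool) (i : Fin 3) : SP :=
  if n.2 then (if i = n.1 + 1 then d.al i else 0)
  else (if i = n.1 + 1 then d.y else if i = n.1 + 2 then - d.s (n.1 + 1) (n.1 + 2) * d.yi else 0)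

/-- normalised magnetic amplitudes -/
def c (n : Fin 3 × Bool) (i : Fin 3) : SP :=
  if n.2 then 0 else (if i = n.1 + 2 then - d.g (n.1 + 1) (n.1 + 2) * d.yi else 0)

theorem sum_block (f : Fin 3 × Bool → ℝ) : ∑ n, f n = f (0, true) + f (0, false) + (f (1, true) + f (1, false))
    + (f (2, true) + f (2, false)) := by
  rw [Fintype.sum_prod_type]
  simp [Fin.sum_univ_three]

theorem s_symm (i j : Fin 3) : d.s i j = d.s j i := by simp only [s, d.hS i j]
theorem g_skew (i j : Fin 3) : d.g i j = - d.g j i := by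
  simp only [g]; rw [d.hG i j, smul_neg]

theorem g_diag (i : Fin 3) (z : EE) : d.g i i z = 0 := by
  have := congrArg (fun f : SP => f z) (d.g_skew i i)
  simp only [SP.neg_apply] at this
  linarith

theorem sum_a (i j : Fin 3) (z : EE) : ∑ n, (d.a n i z * d.a n j z - d.c n i z * d.c n j z) =
    (if i = j then 4 * d.y z ^ 2 else 0) - d.s i j z := by
  rw [sum_block]
  have hy := d.y_yi z
  have z0 := d.al_sq 0 z
  have z1 := d.al_sq 1 z
  have z2 := d.al_sq 2 z
  rw [ZZ_apply] at z0 z1 z2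
  have q1 := d.s_symm 1 0
  have q2 := d.s_symm 2 0
  have q3 := d.s_symm 2 1
  have q4 := congrArg (fun f : SP => f z) (d.g_skew 1 0)
  have q5 := congrArg (fun f : SP => f z) (d.g_skew 2 0)
  have q6 := congrArg (fun f : SP => f z) (d.g_skew 2 1)
  simp only [SP.neg_apply] at q4 q5 q6
  fin_cases i <;> fin_cases j <;>
    simp [a, c, Fin.ext_iff, Fin.val_add, SP.neg_apply, q1, q2, q3, q4, q5, q6] at z0 z1 z2 ⊢ <;>
    grind

theorem sum_c (i j : Fin 3) (z : EE) : ∑ n, (d.a n i z * d.c n j z - d.c n i z * d.a n j z) =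
    - d.g i j z := by
  rw [sum_block]
  have hy := d.y_yi z
  have q1 := d.s_symm 1 0
  have q2 := d.s_symm 2 0
  have q3 := d.s_symm 2 1
  have q4 := congrArg (fun f : SP => f z) (d.g_skew 1 0)
  have q5 := congrArg (fun f : SP => f z) (d.g_skew 2 0)
  have q6 := congrArg (fun f : SP => f z) (d.g_skew 2 1)
  have q7 := fun i => d.g_diag i z
  simp only [SP.neg_apply] at q4 q5 q6
  fin_cases i <;> fin_cases j <;>
    simp [a, c, Fin.ext_iff, Fin.val_add, SP.neg_apply, q1, q2, q3, q4, q5, q6, q7] <;>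
    grind

theorem a_sq (n : Fin 3 × Bool) (i : Fin 3) (z : EE) : d.a n i z ^ 2 ≤ 5 * d.y z ^ 2 := by
  unfold a
  have h0 : 0 ≤ d.y z ^ 2 := sq_nonneg _
  split_ifs
  · rw [sq, al_sq]; exact d.ZZ_le i z
  · simpa using h0
  · linarith
  · have := d.s_mul (n.1 + 1) (n.1 + 2) z
    rw [SP.mul_apply, SP.neg_apply, neg_mul, neg_sq]; linarith
  · simpa using h0

theorem c_sq (n : Fin 3 × Bool) (i : Fin 3) (z : EE) : d.c n i z ^ 2 ≤ 5 * d.y z ^ 2 := by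
  unfold c
  have h0 : 0 ≤ d.y z ^ 2 := sq_nonneg _
  split_ifs
  · simpa using h0
  · have := d.g_mul (n.1 + 1) (n.1 + 2) z
    rw [SP.mul_apply, SP.neg_apply, neg_mul, neg_sq]; linarith
  · simpa using h0

theorem y_sq_le (z : EE) : d.y z ^ 2 ≤ 1 + d.X ^ 2 * ((∑ i, ∑ j, |d.S i j z|) + ∑ i, ∑ j, |d.G i j z|) := by
  have hX := d.hX
  have e1 : ∀ i j, |d.s i j z| = d.X ^ 2 * |d.S i j z| := by
    intro i j
    rw [s, SP.smul_apply, abs_mul, abs_of_nonneg (by positivity)]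
  have e2 : ∀ i j, |d.g i j z| = d.X ^ 2 * |d.G i j z| := by
    intro i j
    rw [g, SP.smul_apply, abs_mul, abs_of_nonneg (by positivity)]
  have key : d.Y z ≤ (1 + ((∑ i, ∑ j, |d.s i j z|) + ∑ i, ∑ j, |d.g i j z|)) ^ 2 := by
    rw [Y_apply]
    have q1 : ∑ i, ∑ j, d.s i j z ^ 2 ≤ (∑ i, ∑ j, |d.s i j z|) ^ 2 := by
      rw [← Fintype.sum_prod_type', ← Fintype.sum_prod_type']
      calc _ = ∑ x : Fin 3 × Fin 3, |d.s x.1 x.2 z| ^ 2 := by simp only [sq_abs]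
        _ ≤ _ := Finset.sum_sq_le_sq_sum_of_nonneg (fun i _ => abs_nonneg _)
    have q2 : ∑ i, ∑ j, d.g i j z ^ 2 ≤ (∑ i, ∑ j, |d.g i j z|) ^ 2 := by
      rw [← Fintype.sum_prod_type', ← Fintype.sum_prod_type']
      calc _ = ∑ x : Fin 3 × Fin 3, |d.g x.1 x.2 z| ^ 2 := by simp only [sq_abs]
        _ ≤ _ := Finset.sum_sq_le_sq_sum_of_nonneg (fun i _ => abs_nonneg _)
    have p1 : 0 ≤ ∑ i, ∑ j, |d.s i j z| := by positivity
    have p2 : 0 ≤ ∑ i, ∑ j, |d.g i j z| := by positivity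
    nlinarith [mul_nonneg p1 p2]
  rw [← d.y4 z] at key
  have h3 : (d.y z ^ 2) ^ 2 ≤ (1 + ((∑ i, ∑ j, |d.s i j z|) + ∑ i, ∑ j, |d.g i j z|)) ^ 2 := by
    calc _ = d.y z ^ 4 := by ring
      _ ≤ _ := key
  have h4 := abs_le_of_sq_le_sq h3 (by positivity)
  rw [abs_of_nonneg (sq_nonneg _)] at h4
  simp only [e1, e2, ← Finset.mul_sum] at h4
  linarith

end AD

theorem PB.S (i j : Fin 3) : PB (fun d => d.S i j) :=
  ⟨1, zero_le_one, 1, fun d => (d.bS i j).mono (by simp)⟩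
theorem PB.G (i j : Fin 3) : PB (fun d => d.G i j) :=
  ⟨1, zero_le_one, 1, fun d => (d.bG i j).mono (by simp)⟩
theorem PB.s (i j : Fin 3) : PB (fun d => d.s i j) := (PB.S i j).smul 2
theorem PB.g (i j : Fin 3) : PB (fun d => d.g i j) := (PB.G i j).smul 2
theorem PB.Y : PB (fun d => d.Y) :=
  PB.one.add ((PB.sum _ fun i => PB.sum _ fun j => (PB.s i j).mul (PB.s i j)).add
    (PB.sum _ fun i => PB.sum _ fun j => (PB.g i j).mul (PB.g i j)))
theorem PB.y : PB (fun d => d.y) := PB.Y.rpw (fun d => d.Y1) _ (by norm_num)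
theorem PB.yi : PB (fun d => d.yi) := PB.Y.rpw (fun d => d.Y1) _ (by norm_num)
theorem PB.ZZ (l : Fin 3) : PB (fun d => d.ZZ l) := by
  have h3 : PB (fun d => (3 : ℝ) • (d.y * d.y)) := by
    obtain ⟨C, hC, K, h⟩ := PB.y.mul PB.y
    refine ⟨|3| * C, by positivity, K, fun d => ((h d).smul 3).mono (le_of_eq (by ring))⟩
  exact ((h3.add (PB.s l l).neg).add (((PB.s (l + 2) l).mul PB.yi).mul ((PB.s (l + 2) l).mul PB.yi)).neg).add
    (((PB.g (l + 2) l).mul PB.yi).mul ((PB.g (l + 2) l).mul PB.yi))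
theorem PB.al (l : Fin 3) : PB (fun d => d.al l) := (PB.ZZ l).rpw (fun d => d.ZZ1 l) _ (by norm_num)

theorem PB.a (n : Fin 3 × Bool) (i : Fin 3) : PB (fun d => d.a n i) := by
  unfold AD.a
  split_ifs
  · exact PB.al i
  · exact PB.zero
  · exact PB.y
  · exact (PB.s _ _).neg.mul PB.yi
  · exact PB.zero

theorem PB.c (n : Fin 3 × Bool) (i : Fin 3) : PB (fun d => d.c n i) := by
  unfold AD.c
  split_ifs
  · exact PB.zero
  · exact (PB.g _ _).neg.mul PB.yi
  · exact PB.zero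

theorem amp : ∃ C : ℝ, 1 ≤ C ∧ ∃ K : ℕ, ∀ d : AD, ∃ (A B : Fin 3 × Bool → Fin 3 → SP) (ρ : SP),
    (∀ n, A n n.1 = 0) ∧ (∀ n, B n n.1 = 0) ∧ (∀ n i, Bd 3 (A n i) (C * d.X ^ K)) ∧
    (∀ n i, Bd 3 (B n i) (C * d.X ^ K)) ∧
    (∀ i j, ∑ n, (A n i * A n j - B n i * B n j) = (if i = j then ρ else 0) - d.S i j) ∧
    (∀ i j, ∑ n, (A n i * B n j - B n i * A n j) = - d.G i j) ∧
    (∀ n i z, A n i z ^ 2 ≤ 5 * (1 / d.X ^ 2 + ((∑ i, ∑ j, |d.S i j z|) + ∑ i, ∑ j, |d.G i j z|))) ∧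
    (∀ n i z, B n i z ^ 2 ≤ 5 * (1 / d.X ^ 2 + ((∑ i, ∑ j, |d.S i j z|) + ∑ i, ∑ j, |d.G i j z|))) := by
  have hc : ∀ d : AD, |1 / d.X| ≤ 1 := fun d => by
    have := d.hX
    rw [abs_of_nonneg (by positivity), div_le_one (by positivity)]; exact this
  obtain ⟨C, hC, K, h⟩ := PB.unif (ι := (Fin 3 × Bool) × Fin 3) (f := fun p d => (1 / d.X) • d.a p.1 p.2)
    (fun p => (PB.a p.1 p.2).smulc _ hc)
  obtain ⟨C', hC', K', h'⟩ := PB.unif (ι := (Fin 3 × Bool) × Fin 3) (f := fun p d => (1 / d.X) • d.c p.1 p.2)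
    (fun p => (PB.c p.1 p.2).smulc _ hc)
  refine ⟨C + C', by linarith, K + K', fun d => ⟨fun n i => (1 / d.X) • d.a n i, fun n i => (1 / d.X) • d.c n i,
    (4 / d.X ^ 2) • (d.y * d.y), ?_, ?_, ?_, ?_, ?_, ?_, ?_, ?_⟩⟩
  · rintro ⟨k, b⟩
    fin_cases k <;> cases b <;> simp [AD.a, Fin.ext_iff, Fin.val_add]
  · rintro ⟨k, b⟩
    fin_cases k <;> cases b <;> simp [AD.c, Fin.ext_iff, Fin.val_add]
  · intro n i
    refine (h (n, i) d).mono ?_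
    have hX := d.hX
    have e1 : d.X ^ K ≤ d.X ^ (K + K') := pow_le_pow_right₀ hX (by omega)
    gcongr
    linarith
  · intro n i
    refine (h' (n, i) d).mono ?_
    have hX := d.hX
    have e1 : d.X ^ K' ≤ d.X ^ (K + K') := pow_le_pow_right₀ hX (by omega)
    gcongr
    linarith
  · intro i j
    apply SP.ext'; intro z
    have hX := d.hX
    have hX0 : d.X ≠ 0 := by positivity
    have := d.sum_a i j z
    have e2 : ∀ x y : ℝ, (1 / d.X * x) * (1 / d.X * y) = 1 / d.X ^ 2 * (x * y) := by
      intro x y; field_simp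
    simp only [SP.sum_apply, SP.sub_apply, SP.mul_apply, SP.smul_apply, e2, ← mul_sub, ← Finset.mul_sum, this]
    have e3 : d.s i j z = d.X ^ 2 * d.S i j z := rfl
    rw [e3]
    split_ifs
    · simp; field_simp
    · simp; field_simp
  · intro i j
    apply SP.ext'; intro z
    have hX := d.hX
    have hX0 : d.X ≠ 0 := by positivity
    have := d.sum_c i j z
    have e2 : ∀ x y : ℝ, (1 / d.X * x) * (1 / d.X * y) = 1 / d.X ^ 2 * (x * y) := by
      intro x y; field_simp
    simp only [SP.sum_apply, SP.sub_apply, SP.mul_apply, SP.smul_apply, SP.neg_apply, e2, ← mul_sub, ← Finset.mul_sum, this]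
    have e3 : d.g i j z = d.X ^ 2 * d.G i j z := rfl
    rw [e3]
    field_simp
  · intro n i z
    have hX := d.hX
    have h1 := d.a_sq n i z
    have h2 := d.y_sq_le z
    rw [SP.smul_apply, mul_pow]
    calc _ ≤ (1 / d.X) ^ 2 * (5 * (1 + d.X ^ 2 * ((∑ i, ∑ j, |d.S i j z|) + ∑ i, ∑ j, |d.G i j z|))) := by
          gcongr; linarith
      _ = _ := by field_simp
  · intro n i z
    have hX := d.hX
    have h1 := d.c_sq n i z
    have h2 := d.y_sq_le z
    rw [SP.smul_apply, mul_pow]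
    calc _ ≤ (1 / d.X) ^ 2 * (5 * (1 + d.X ^ 2 * ((∑ i, ∑ j, |d.S i j z|) + ∑ i, ∑ j, |d.G i j z|))) := by
          gcongr; linarith
      _ = _ := by field_simp

end

noncomputable section
open MeasureTheory Real Matrix

/-- relaxed MHD system in the algebra of smooth periodic functions -/
structure SPsol (u B : Fin 3 → SP) (p : SP) (R Q : Fin 3 → Fin 3 → SP) : Prop where
  du : ∑ i, D (ee i) (u i) = 0
  dB : ∑ i, D (ee i) (B i) = 0
  mu : ∀ t i, ∫ x in dom, u i (t, x) = 0
  mB : ∀ t i, ∫ x in dom, B i (t, x) = 0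
  sR : ∀ i j, R i j = R j i
  sQ : ∀ i j, Q i j = - Q j i
  mom : ∀ i, D e0 (u i) + (∑ j, D (ee j) (u i * u j - B i * B j)) + D (ee i) p = ∑ j, D (ee j) (R i j)
  ind : ∀ i, D e0 (B i) + (∑ j, D (ee j) (u i * B j - B i * u j)) = ∑ j, D (ee j) (Q i j)

theorem cc_eq (H : Fin 3 → SP) (i : Fin 3) :
    cc H i = ∑ j, D (ee i) (D (ee j) (H j)) - ∑ j, D (ee j) (D (ee j) (H i)) := by
  rw [cc, Finset.sum_sub_distrib]

theorem div_cc (H : Fin 3 → SP) : ∑ i, D (ee i) (cc H i) = 0 := by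
  simp only [cc_eq, map_sub, map_sum, Finset.sum_sub_distrib]
  rw [sub_eq_zero]
  conv_rhs => rw [Finset.sum_comm]
  refine Finset.sum_congr rfl fun i _ => Finset.sum_congr rfl fun j _ => ?_
  rw [D_comm (ee i) (ee j), D_comm (ee i) (ee j)]

theorem SPint (f : SP) (t : ℝ) : IntegrableOn (fun x => f (t, x)) dom := contIntOn (SPcont f t)

theorem mean_cc (H : Fin 3 → SP) (t : ℝ) (i : Fin 3) : ∫ x in dom, cc H i (t, x) = 0 := by
  simp only [cc, SP.sum_apply]
  rw [integral_finsetSum _ (fun j _ => SPint _ t)]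
  apply Finset.sum_eq_zero
  intro j _
  simp only [SP.sub_apply]
  rw [integral_sub (SPint _ t) (SPint _ t), int_D, int_D, sub_zero]

theorem cc_sum {ι : Type*} (s : Finset ι) (H : ι → Fin 3 → SP) (i : Fin 3) :
    cc (fun j => ∑ n ∈ s, H n j) i = ∑ n ∈ s, cc (H n) i := by
  simp only [cc, map_sum, ← Finset.sum_sub_distrib]
  rw [Finset.sum_comm]

theorem TT_sum {ι : Type*} (s : Finset ι) (Q : ι → Fin 3 → Fin 3 → SP) (i j : Fin 3) :
    TT (fun i j => ∑ n ∈ s, Q n i j) i j = ∑ n ∈ s, TT (Q n) i j := by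
  simp only [TT, map_sum, ← Finset.sum_add_distrib, ← Finset.sum_sub_distrib]
  rw [Finset.sum_comm]

/-- double divergence -/
def dd (Q : Fin 3 → Fin 3 → SP) : SP := ∑ l, ∑ j, D (ee l) (D (ee j) (Q l j))

theorem div_TT (Q : Fin 3 → Fin 3 → SP) (i : Fin 3) : ∑ j, D (ee j) (TT Q i j) = D (ee i) (dd Q) := by
  simp only [TT, dd, map_sub, map_add, map_sum, Finset.sum_sub_distrib, Finset.sum_add_distrib]
  have h1 : ∑ j, ∑ l, D (ee j) (D (ee j) (D (ee l) (Q i l))) = ∑ j, ∑ l, D (ee j) (D (ee l) (D (ee l) (Q i j))) := by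
    conv_rhs => rw [Finset.sum_comm]
    refine Finset.sum_congr rfl fun j _ => Finset.sum_congr rfl fun l _ => ?_
    rw [D_comm (ee l) (ee j), D_comm (ee l) (ee j)]
  have h2 : ∑ j, ∑ l, D (ee j) (D (ee i) (D (ee l) (Q l j))) = ∑ l, ∑ j, D (ee i) (D (ee l) (D (ee j) (Q l j))) := by
    conv_rhs => rw [Finset.sum_comm]
    refine Finset.sum_congr rfl fun j _ => Finset.sum_congr rfl fun l _ => ?_
    rw [D_comm (ee j) (ee i), D_comm (ee j) (ee l)]
  rw [h1, h2, add_sub_cancel_right]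

theorem dd_skew (Q : Fin 3 → Fin 3 → SP) (h : ∀ i j, Q i j = - Q j i) : dd Q = 0 := by
  have h1 : dd Q = - dd Q := by
    conv_lhs => rw [dd, Finset.sum_comm]
    rw [dd, ← Finset.sum_neg_distrib]
    refine Finset.sum_congr rfl fun j _ => ?_
    rw [← Finset.sum_neg_distrib]
    refine Finset.sum_congr rfl fun l _ => ?_
    rw [h l j, map_neg, map_neg, D_comm]
  apply SP.ext'; intro z
  have := congrArg (fun f : SP => f z) h1
  simp only [SP.neg_apply] at this
  rw [SP.zero_apply]; linarith

theorem TT_symm (Q : Fin 3 → Fin 3 → SP) (h : ∀ i j, Q i j = Q j i) (i j : Fin 3) : TT Q i j = TT Q j i := by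
  simp only [TT]
  refine Finset.sum_congr rfl fun l _ => ?_
  rw [h l j, h i l, h i j]; ring

theorem TT_skew (Q : Fin 3 → Fin 3 → SP) (h : ∀ i j, Q i j = - Q j i) (i j : Fin 3) : TT Q i j = - TT Q j i := by
  simp only [TT]
  rw [← Finset.sum_neg_distrib]
  refine Finset.sum_congr rfl fun l _ => ?_
  rw [h l j, h i l, h i j]
  simp only [map_neg]; ring

section
variable (u B : Fin 3 → SP) (p : SP) (R R' : Fin 3 → Fin 3 → SP) (H K : Fin 3 → SP)
  (Q Q' : Fin 3 → Fin 3 → SP) (ρ : SP)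

def Tu (i j : Fin 3) : SP :=
  ((u i + cc H i) * (u j + cc H j) - (B i + cc K i) * (B j + cc K j)) - (u i * u j - B i * B j) + R i j
    - (D (ee j) (D e0 (H i)) + D (ee i) (D e0 (H j))) - (if i = j then ρ else 0) - TT Q i j

def TB (i j : Fin 3) : SP :=
  ((u i + cc H i) * (B j + cc K j) - (B i + cc K i) * (u j + cc H j)) - (u i * B j - B i * u j) + R' i j
    - (D (ee j) (D e0 (K i)) - D (ee i) (D e0 (K j))) - TT Q' i j

def tru : SP := (1 / 3 : ℝ) • ∑ i, Tu u B R H K Q ρ i i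

def Rnew (i j : Fin 3) : SP := Tu u B R H K Q ρ i j - (if i = j then tru u B R H K Q ρ else 0)

def pnew : SP := p - (2 : ℝ) • (∑ j, D (ee j) (D e0 (H j))) - ρ - dd Q - tru u B R H K Q ρ

theorem D_ite (i : Fin 3) (f : SP) : ∑ j, D (ee j) (if i = j then f else 0) = D (ee i) f := by
  simp only [apply_ite, map_zero, Finset.sum_ite_eq, Finset.mem_univ, if_true]

theorem trace_new : ∑ i, Rnew u B R H K Q ρ i i = 0 := by
  simp only [Rnew, if_true, Finset.sum_sub_distrib]
  rw [tru]
  apply SP.ext'; intro z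
  simp only [Fin.sum_univ_three, SP.sub_apply, SP.add_apply, SP.smul_apply, SP.zero_apply]
  ring

theorem step_sol (h : SPsol u B p R R') (hQ : ∀ i j, Q i j = Q j i) (hQ' : ∀ i j, Q' i j = - Q' j i) :
    SPsol (fun i => u i + cc H i) (fun i => B i + cc K i) (pnew u B p R H K Q ρ) (Rnew u B R H K Q ρ)
      (TB u B R' H K Q') := by
  refine ⟨?_, ?_, ?_, ?_, ?_, ?_, ?_, ?_⟩
  · simp only [map_add, Finset.sum_add_distrib, h.du, div_cc, add_zero]
  · simp only [map_add, Finset.sum_add_distrib, h.dB, div_cc, add_zero]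
  · intro t i
    simp only [SP.add_apply]
    rw [integral_add (SPint _ t) (SPint _ t), h.mu, mean_cc, add_zero]
  · intro t i
    simp only [SP.add_apply]
    rw [integral_add (SPint _ t) (SPint _ t), h.mB, mean_cc, add_zero]
  · intro i j
    simp only [Rnew, Tu, h.sR i j, TT_symm Q hQ i j, eq_comm (a := i) (b := j)]
    ring
  · intro i j
    simp only [TB, TT_skew Q' hQ' i j]
    rw [h.sQ i j]
    ring
  · intro i
    have hm := h.mom i
    simp only [Rnew, Tu, pnew, map_sub, map_add, Finset.sum_sub_distrib, Finset.sum_add_distrib, D_ite, div_TT,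
      map_smul] at hm ⊢
    rw [← hm]
    have e1 : D e0 (cc H i) = ∑ j, D (ee i) (D (ee j) (D e0 (H j))) - ∑ j, D (ee j) (D (ee j) (D e0 (H i))) := by
      rw [cc_eq, map_sub, map_sum, map_sum]
      congr 1
      · refine Finset.sum_congr rfl fun j _ => ?_
        rw [D_comm e0, D_comm e0]
      · refine Finset.sum_congr rfl fun j _ => ?_
        rw [D_comm e0, D_comm e0]
    have e2 : ∑ j, D (ee j) (D (ee i) (D e0 (H j))) = ∑ j, D (ee i) (D (ee j) (D e0 (H j))) :=
      Finset.sum_congr rfl fun j _ => D_comm _ _ _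
    rw [e1, e2, map_sum]
    module
  · intro i
    have hm := h.ind i
    simp only [TB, map_sub, map_add, Finset.sum_sub_distrib, Finset.sum_add_distrib, div_TT, dd_skew Q' hQ',
      map_zero] at hm ⊢
    rw [← hm]
    have e1 : D e0 (cc K i) = ∑ j, D (ee i) (D (ee j) (D e0 (K j))) - ∑ j, D (ee j) (D (ee j) (D e0 (K i))) := by
      rw [cc_eq, map_sub, map_sum, map_sum]
      congr 1
      · refine Finset.sum_congr rfl fun j _ => ?_
        rw [D_comm e0, D_comm e0]
      · refine Finset.sum_congr rfl fun j _ => ?_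
        rw [D_comm e0, D_comm e0]
    have e2 : ∑ j, D (ee j) (D (ee i) (D e0 (K j))) = ∑ j, D (ee i) (D (ee j) (D e0 (K j))) :=
      Finset.sum_congr rfl fun j _ => D_comm _ _ _
    rw [e1, e2]
    module

end

end

noncomputable section
open MeasureTheory Real Matrix

abbrev NN := Fin 3 × Bool

def ph (n : NN) : ℝ := if n.2 then π else 0

namespace Prof
variable {Cp : ℝ} {M : ℕ} (P : Prof Cp M)

def F (n : NN) : SP := wv P.f P.sf P.pf M (ph n) n.1
def F1 (n : NN) : SP := wv P.f1 P.sf1 P.pf1 M (ph n) n.1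
def F2 (n : NN) : SP := wv P.f2 P.sf2 P.pf2 M (ph n) n.1
def T1 (n : NN) : SP := wv P.t1 P.st1 P.pt1 M (ph n) n.1
def T2 (n : NN) : SP := wv P.t2 P.st2 P.pt2 M (ph n) n.1

theorem sT0 : ContDiff ℝ (⊤ : ℕ∞) (fun x => P.f x ^ 2 - 1) := (P.sf.pow 2).sub contDiff_const
theorem pT0 : Function.Periodic (fun x => P.f x ^ 2 - 1) (2 * π) := fun x => by simp only [P.pf x]
def T0 (n : NN) : SP := wv (fun x => P.f x ^ 2 - 1) P.sT0 P.pT0 M (ph n) n.1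

theorem T0_apply (n : NN) (z : EE) : P.T0 n z = P.F n z ^ 2 - 1 := rfl

theorem waveF (n : NN) : Wave Cp M n.1 (P.F2 n) (P.F1 n) (P.F n) :=
  ⟨fun v => D_wv _ _ _ _ _ _ P.d2 _ _ _ _, fun v => D_wv _ _ _ _ _ _ P.d1 _ _ _ _,
    fun _ => P.b2 _, fun _ => P.b1 _⟩

theorem waveT (n : NN) : Wave Cp M n.1 (P.T2 n) (P.T1 n) (P.T0 n) :=
  ⟨fun v => D_wv _ _ _ _ _ _ P.dt2 _ _ _ _, fun v => D_wv _ _ _ _ _ _ P.dt1 _ _ _ _,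
    fun _ => P.bt2 _, fun _ => P.bt1 _⟩

theorem bd3 (hM : 1 ≤ M) (n : NN) : Bd 3 (P.F2 n) (Cp * M ^ 6) := by
  have hd : ∀ x, HasDerivAt P.f (deriv P.f x) x := fun x =>
    ((contDiff_infty_iff_deriv.1 P.sf).1 x).hasDerivAt
  exact (P.waveF n).bd3 (F' := wv (deriv P.f) (smooth_deriv hd P.sf) (periodic_deriv hd P.pf) M (ph n) n.1) hM
    (fun v => D_wv _ _ _ _ _ _ hd _ _ _ _) (fun _ => P.bf _) (fun _ => P.bdf _)

/-- vector potential -/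
def H (A : NN → Fin 3 → SP) (i : Fin 3) : SP := ∑ n, (-(1 / (M : ℝ) ^ 2)) • (P.F2 n * A n i)

/-- matrix potential -/
def Q (q : NN → Fin 3 → Fin 3 → SP) (i j : Fin 3) : SP := ∑ n, (-(1 / (M : ℝ) ^ 2)) • (P.T2 n * q n i j)

def ww (A : NN → Fin 3 → SP) (i : Fin 3) (z : EE) : ℝ := ∑ n, P.F n z * A n i z

theorem card_NN : (Finset.univ : Finset NN).card = 6 := by decide

theorem sum_le_six {f : NN → ℝ} {c : ℝ} (h : ∀ n, |f n| ≤ c) : |∑ n, f n| ≤ 6 * c := by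
  refine (Finset.abs_sum_le_sum_abs _ _).trans ?_
  refine (Finset.sum_le_card_nsmul _ _ c (fun n _ => h n)).trans (le_of_eq ?_)
  rw [card_NN]; simp

theorem v_est (hM : 1 ≤ M) {A : NN → Fin 3 → SP} {Y : ℝ} (hA : ∀ n i, Bd 2 (A n i) Y) (hk : ∀ n, A n n.1 = 0)
    {z : EE} (hz : z ∈ Zs) (i : Fin 3) : |cc (P.H A) i z - P.ww A i z| ≤ 108 * (Cp * Y / M) := by
  have e : cc (P.H A) i z - P.ww A i z =
      ∑ n, (cc (fun j => (-(1 / (M : ℝ) ^ 2)) • (P.F2 n * A n j)) i z - P.F n z * A n i z) := by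
    have : P.H A = fun j => ∑ n, (-(1 / (M : ℝ) ^ 2)) • (P.F2 n * A n j) := rfl
    rw [this, cc_sum, SP.sum_apply, ww, Finset.sum_sub_distrib]
  rw [e]
  refine (sum_le_six (fun n => (P.waveF n).cc_est hM (hA n) (hk n) hz i)).trans (le_of_eq ?_)
  ring

theorem Q_est (hM : 1 ≤ M) {q : NN → Fin 3 → Fin 3 → SP} {Y : ℝ} (hq : ∀ n i j, Bd 2 (q n i j) Y)
    (hk : ∀ n j, q n n.1 j = 0) (hk' : ∀ n i, q n i n.1 = 0)
    {z : EE} (hz : z ∈ Zs) (i j : Fin 3) : |TT (P.Q q) i j z - ∑ n, P.T0 n z * q n i j z| ≤ 162 * (Cp * Y / M) := by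
  have e : TT (P.Q q) i j z - ∑ n, P.T0 n z * q n i j z =
      ∑ n, (TT (fun i j => (-(1 / (M : ℝ) ^ 2)) • (P.T2 n * q n i j)) i j z - P.T0 n z * q n i j z) := by
    have : P.Q q = fun i j => ∑ n, (-(1 / (M : ℝ) ^ 2)) • (P.T2 n * q n i j) := rfl
    rw [this, TT_sum, SP.sum_apply, Finset.sum_sub_distrib]
  rw [e]
  refine (sum_le_six (fun n => (P.waveT n).TT_est hM (hq n) (hk n) (hk' n) hz i j)).trans (le_of_eq ?_)
  ring

theorem H_est (hM : 1 ≤ M) {A : NN → Fin 3 → SP} {Y : ℝ} (hA : ∀ n i, Bd 2 (A n i) Y)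
    {z : EE} (hz : z ∈ Zs) (i j : Fin 3) : |D (ee j) (D e0 (P.H A i)) z| ≤ 18 * (Cp * Y / M) := by
  rw [H, map_sum, map_sum, SP.sum_apply]
  refine (sum_le_six (fun n => (P.waveF n).tH_est hM (hA n i) hz j)).trans (le_of_eq ?_)
  ring

def Ph (z : EE) : ℝ := ∑ n, |P.F n z|
def Cr (z : EE) : ℝ := ∑ n, ∑ m, if n = m then 0 else |P.F n z * P.F m z|
def Env (z : EE) : ℝ := P.Ph z + P.Cr z + 1 / M

theorem Ph_nonneg (z : EE) : 0 ≤ P.Ph z := Finset.sum_nonneg fun _ _ => abs_nonneg _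
theorem Cr_nonneg (z : EE) : 0 ≤ P.Cr z := Finset.sum_nonneg fun _ _ => Finset.sum_nonneg fun _ _ => by
  split_ifs
  · exact le_rfl
  · exact abs_nonneg _

theorem ww_le {A : NN → Fin 3 → SP} {Y : ℝ} {i : Fin 3} {z : EE} (hA : ∀ n, |A n i z| ≤ Y) :
    |P.ww A i z| ≤ Y * P.Ph z := by
  refine (Finset.abs_sum_le_sum_abs _ _).trans ?_
  rw [Ph, Finset.mul_sum]
  refine Finset.sum_le_sum fun n _ => ?_
  rw [abs_mul, mul_comm]
  exact mul_le_mul_of_nonneg_right (hA n) (abs_nonneg _)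

theorem ww_mul {A B : NN → Fin 3 → SP} {Y : ℝ} {i j : Fin 3} {z : EE} (hA : ∀ n, |A n i z| ≤ Y)
    (hB : ∀ n, |B n j z| ≤ Y) :
    |P.ww A i z * P.ww B j z - ∑ n, P.F n z ^ 2 * (A n i z * B n j z)| ≤ Y ^ 2 * P.Cr z := by
  have e : P.ww A i z * P.ww B j z - ∑ n, P.F n z ^ 2 * (A n i z * B n j z) =
      ∑ n, ∑ m, if n = m then 0 else P.F n z * P.F m z * (A n i z * B m j z) := by
    have e1 : ∀ n, P.F n z ^ 2 * (A n i z * B n j z) =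
        ∑ m, if n = m then P.F n z * P.F m z * (A n i z * B m j z) else 0 := by
      intro n; rw [Finset.sum_ite_eq]; simp only [Finset.mem_univ, if_true]; ring
    simp only [ww, Finset.sum_mul_sum, e1]
    rw [← Finset.sum_sub_distrib]
    refine Finset.sum_congr rfl fun n _ => ?_
    rw [← Finset.sum_sub_distrib]
    refine Finset.sum_congr rfl fun m _ => ?_
    split_ifs <;> ring
  have hY : 0 ≤ Y := (abs_nonneg _).trans (hA (0, true))
  rw [e]
  refine (Finset.abs_sum_le_sum_abs _ _).trans ?_
  rw [Cr, Finset.mul_sum]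
  refine Finset.sum_le_sum fun n _ => ?_
  refine (Finset.abs_sum_le_sum_abs _ _).trans ?_
  rw [Finset.mul_sum]
  refine Finset.sum_le_sum fun m _ => ?_
  split_ifs
  · simp
  · rw [abs_mul, mul_comm]
    apply mul_le_mul_of_nonneg_right _ (abs_nonneg _)
    rw [abs_mul, sq]
    exact mul_le_mul (hA n) (hB m) (abs_nonneg _) hY

theorem vv_mul {v w a b Y φ ε : ℝ} (hε : 0 ≤ ε) (hφ : 0 ≤ φ) (hY : 0 ≤ Y) (hv : |v - a| ≤ Y * ε) (hw : |w - b| ≤ Y * ε)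
    (ha : |a| ≤ Y * φ) (hb : |b| ≤ Y * φ) : |v * w - a * b| ≤ Y ^ 2 * (ε * (2 * φ + ε)) := by
  have e : v * w - a * b = a * (w - b) + (v - a) * b + (v - a) * (w - b) := by ring
  rw [e]
  have h1 : |a * (w - b)| ≤ (Y * φ) * (Y * ε) := by rw [abs_mul]; gcongr
  have h2 : |(v - a) * b| ≤ (Y * ε) * (Y * φ) := by rw [abs_mul]; gcongr
  have h3 : |(v - a) * (w - b)| ≤ (Y * ε) * (Y * ε) := by rw [abs_mul]; gcongr
  have := abs_add_le (a * (w - b) + (v - a) * b) ((v - a) * (w - b))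
  have := abs_add_le (a * (w - b)) ((v - a) * b)
  nlinarith

theorem combine {Cp Y φ X m : ℝ} (hC : 0 ≤ Cp) (hφ : 0 ≤ φ) (hX : 0 ≤ X) (hm : 0 < m) (hm1 : m ≤ 1) (hY : 1 ≤ Y)
    {t : ℝ} (ht : |t| ≤ 4 * (Y * (Y * (φ + 108 * Cp * m))) + 2 * (Y ^ 2 * (108 * Cp * m * (2 * φ + 108 * Cp * m)) + Y ^ 2 * X)
      + 162 * (Cp * (8 * Y ^ 2) * m) + 36 * (Cp * Y * m)) :
    |t| ≤ (4 + 2000 * Cp + 30000 * Cp ^ 2) * Y ^ 2 * (φ + X + m) := by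
  refine ht.trans ?_
  have hY2 : Y ≤ Y ^ 2 := by nlinarith
  have h1 : Cp * m * Y ≤ Cp * m * Y ^ 2 := by gcongr
  have h2 : Cp * m * φ * Y ^ 2 ≤ Cp * 1 * φ * Y ^ 2 := by gcongr
  have h3 : Cp ^ 2 * m * m * Y ^ 2 ≤ Cp ^ 2 * 1 * m * Y ^ 2 := by gcongr
  have p1 : 0 ≤ Cp * φ * Y ^ 2 := by positivity
  have p2 : 0 ≤ Cp * X * Y ^ 2 := by positivity
  have p3 : 0 ≤ Cp ^ 2 * X * Y ^ 2 := by positivity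
  have p4 : 0 ≤ Cp ^ 2 * φ * Y ^ 2 := by positivity
  have p5 : 0 ≤ Cp * m * Y ^ 2 := by positivity
  have p6 : 0 ≤ Cp ^ 2 * m * Y ^ 2 := by positivity
  have p7 : 0 ≤ m * Y ^ 2 := by positivity
  have p8 : 0 ≤ X * Y ^ 2 := by positivity
  nlinarith

theorem Bd.mul2 {f g h k : SP} {Y : ℝ} (hf : Bd 3 f Y) (hg : Bd 3 g Y) (hh : Bd 3 h Y) (hk : Bd 3 k Y) :
    Bd 2 (f * g - h * k) (8 * Y ^ 2) := by
  have h1 := (hf.pred.mul hg.pred).add (hh.pred.mul hk.pred).neg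
  rw [← sub_eq_add_neg] at h1
  exact h1.mono (le_of_eq (by ring))

section main
variable (hM : 1 ≤ M) {A B : NN → Fin 3 → SP} {Y : ℝ} (hY : 1 ≤ Y)
  (hA : ∀ n i, Bd 3 (A n i) Y) (hB : ∀ n i, Bd 3 (B n i) Y)
  (kA : ∀ n, A n n.1 = 0) (kB : ∀ n, B n n.1 = 0)
  (ρ : SP) (S G : Fin 3 → Fin 3 → SP)
  (hS : ∀ i j, ∑ n, (A n i * A n j - B n i * B n j) = (if i = j then ρ else 0) - S i j)
  (hG : ∀ i j, ∑ n, (A n i * B n j - B n i * A n j) = - G i j)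
  {u b : Fin 3 → SP} (hu : ∀ i, Bd 0 (u i) Y) (hb : ∀ i, Bd 0 (b i) Y)
include hM hY hA hB kA kB hu hb

include hS in
theorem Tu_est (Cu : Fin 3 → Fin 3 → SP) {z : EE} (hz : z ∈ Zs) (i j : Fin 3) :
    |Tu u b (fun i j => S i j + Cu i j) (P.H A) (P.H B)
      (P.Q (fun n i j => A n i * A n j - B n i * B n j)) ρ i j z - Cu i j z| ≤
      (4 + 2000 * Cp + 30000 * Cp ^ 2) * Y ^ 2 * P.Env z := by
  have hM1 : (1 : ℝ) ≤ M := by exact_mod_cast hM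
  have hC : 0 ≤ Cp := (P.waveF (0, true)).nonneg
  have hY0 : 0 ≤ Y := by linarith
  have hm : 0 < 1 / (M : ℝ) := by positivity
  have hm1 : 1 / (M : ℝ) ≤ 1 := by rw [div_le_one (by positivity)]; exact hM1
  have hφ := P.Ph_nonneg z
  set m := 1 / (M : ℝ) with hmdef
  set ε := 108 * Cp * m with hε
  have hε0 : 0 ≤ ε := by positivity
  have vA : ∀ i, |cc (P.H A) i z - P.ww A i z| ≤ Y * ε := fun i =>
    (P.v_est hM (fun n i => (hA n i).pred) kA hz i).trans (le_of_eq (by rw [hε, hmdef]; ring))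
  have vB : ∀ i, |cc (P.H B) i z - P.ww B i z| ≤ Y * ε := fun i =>
    (P.v_est hM (fun n i => (hB n i).pred) kB hz i).trans (le_of_eq (by rw [hε, hmdef]; ring))
  have wA : ∀ i, |P.ww A i z| ≤ Y * P.Ph z := fun i => P.ww_le (fun n => (hA n i).zero z hz)
  have wB : ∀ i, |P.ww B i z| ≤ Y * P.Ph z := fun i => P.ww_le (fun n => (hB n i).zero z hz)
  have cA : ∀ i, |cc (P.H A) i z| ≤ Y * (P.Ph z + ε) := fun i => by
    have := abs_add_le (cc (P.H A) i z - P.ww A i z) (P.ww A i z)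
    rw [sub_add_cancel] at this
    linarith [vA i, wA i]
  have cB : ∀ i, |cc (P.H B) i z| ≤ Y * (P.Ph z + ε) := fun i => by
    have := abs_add_le (cc (P.H B) i z - P.ww B i z) (P.ww B i z)
    rw [sub_add_cancel] at this
    linarith [vB i, wB i]
  have a1 := vv_mul hε0 hφ hY0 (vA i) (vA j) (wA i) (wA j)
  have a2 := P.ww_mul (i := i) (j := j) (fun n => (hA n i).zero z hz) (fun n => (hA n j).zero z hz)
  have a3 := vv_mul hε0 hφ hY0 (vB i) (vB j) (wB i) (wB j)
  have a4 := P.ww_mul (i := i) (j := j) (fun n => (hB n i).zero z hz) (fun n => (hB n j).zero z hz)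
  have a5 := P.Q_est hM (q := fun n i j => A n i * A n j - B n i * B n j)
    (fun n i j => Bd.mul2 (hA n i) (hA n j) (hB n i) (hB n j))
    (fun n j => by simp [kA n, kB n]) (fun n j => by simp [kA n, kB n]) hz i j
  have a6 := P.H_est hM (fun n i => (hA n i).pred) hz i j
  have a7 := P.H_est hM (fun n i => (hA n i).pred) hz j i
  have b1 : |u i z * cc (P.H A) j z| ≤ Y * (Y * (P.Ph z + ε)) := by
    rw [abs_mul]; exact mul_le_mul (hu i z hz) (cA j) (abs_nonneg _) hY0
  have b2 : |u j z * cc (P.H A) i z| ≤ Y * (Y * (P.Ph z + ε)) := by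
    rw [abs_mul]; exact mul_le_mul (hu j z hz) (cA i) (abs_nonneg _) hY0
  have b3 : |b i z * cc (P.H B) j z| ≤ Y * (Y * (P.Ph z + ε)) := by
    rw [abs_mul]; exact mul_le_mul (hb i z hz) (cB j) (abs_nonneg _) hY0
  have b4 : |b j z * cc (P.H B) i z| ≤ Y * (Y * (P.Ph z + ε)) := by
    rw [abs_mul]; exact mul_le_mul (hb j z hz) (cB i) (abs_nonneg _) hY0
  have hSz := congrArg (fun f : SP => f z) (hS i j)
  simp only [SP.sum_apply, SP.sub_apply, SP.mul_apply] at hSz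
  have hT : ∑ n, P.T0 n z * (A n i * A n j - B n i * B n j) z = ∑ n, P.F n z ^ 2 * (A n i z * A n j z)
      - ∑ n, P.F n z ^ 2 * (B n i z * B n j z) - ((if i = j then ρ else 0 : SP) z - S i j z) := by
    rw [← hSz, ← Finset.sum_sub_distrib, ← Finset.sum_sub_distrib]
    refine Finset.sum_congr rfl fun n _ => ?_
    rw [T0_apply, SP.sub_apply, SP.mul_apply, SP.mul_apply]; ring
  rw [hT] at a5
  apply combine hC hφ (P.Cr_nonneg z) hm hm1 hY
  have e8 : Cp * (8 * Y ^ 2) / M = Cp * (8 * Y ^ 2) * m := by rw [hmdef]; ring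
  have e9 : Cp * Y / M = Cp * Y * m := by rw [hmdef]; ring
  rw [e8] at a5
  rw [e9] at a6 a7
  rw [← hε]
  simp only [Tu, SP.sub_apply, SP.add_apply, SP.mul_apply]
  rw [abs_le] at *
  constructor <;> linarith [a1.1, a1.2, a2.1, a2.2, a3.1, a3.2, a4.1, a4.2, a5.1, a5.2, a6.1, a6.2, a7.1, a7.2, b1.1, b1.2, b2.1, b2.2, b3.1, b3.2, b4.1, b4.2]

include hG in
theorem TB_est (CB : Fin 3 → Fin 3 → SP) {z : EE} (hz : z ∈ Zs) (i j : Fin 3) :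
    |TB u b (fun i j => G i j + CB i j) (P.H A) (P.H B)
      (P.Q (fun n i j => A n i * B n j - B n i * A n j)) i j z - CB i j z| ≤
      (4 + 2000 * Cp + 30000 * Cp ^ 2) * Y ^ 2 * P.Env z := by
  have hM1 : (1 : ℝ) ≤ M := by exact_mod_cast hM
  have hC : 0 ≤ Cp := (P.waveF (0, true)).nonneg
  have hY0 : 0 ≤ Y := by linarith
  have hm : 0 < 1 / (M : ℝ) := by positivity
  have hm1 : 1 / (M : ℝ) ≤ 1 := by rw [div_le_one (by positivity)]; exact hM1
  have hφ := P.Ph_nonneg z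
  set m := 1 / (M : ℝ) with hmdef
  set ε := 108 * Cp * m with hε
  have hε0 : 0 ≤ ε := by positivity
  have vA : ∀ i, |cc (P.H A) i z - P.ww A i z| ≤ Y * ε := fun i =>
    (P.v_est hM (fun n i => (hA n i).pred) kA hz i).trans (le_of_eq (by rw [hε, hmdef]; ring))
  have vB : ∀ i, |cc (P.H B) i z - P.ww B i z| ≤ Y * ε := fun i =>
    (P.v_est hM (fun n i => (hB n i).pred) kB hz i).trans (le_of_eq (by rw [hε, hmdef]; ring))
  have wA : ∀ i, |P.ww A i z| ≤ Y * P.Ph z := fun i => P.ww_le (fun n => (hA n i).zero z hz)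
  have wB : ∀ i, |P.ww B i z| ≤ Y * P.Ph z := fun i => P.ww_le (fun n => (hB n i).zero z hz)
  have cA : ∀ i, |cc (P.H A) i z| ≤ Y * (P.Ph z + ε) := fun i => by
    have := abs_add_le (cc (P.H A) i z - P.ww A i z) (P.ww A i z)
    rw [sub_add_cancel] at this
    linarith [vA i, wA i]
  have cB : ∀ i, |cc (P.H B) i z| ≤ Y * (P.Ph z + ε) := fun i => by
    have := abs_add_le (cc (P.H B) i z - P.ww B i z) (P.ww B i z)
    rw [sub_add_cancel] at this
    linarith [vB i, wB i]
  have a1 := vv_mul hε0 hφ hY0 (vA i) (vB j) (wA i) (wB j)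
  have a2 := P.ww_mul (i := i) (j := j) (fun n => (hA n i).zero z hz) (fun n => (hB n j).zero z hz)
  have a3 := vv_mul hε0 hφ hY0 (vB i) (vA j) (wB i) (wA j)
  have a4 := P.ww_mul (i := i) (j := j) (fun n => (hB n i).zero z hz) (fun n => (hA n j).zero z hz)
  have a5 := P.Q_est hM (q := fun n i j => A n i * B n j - B n i * A n j)
    (fun n i j => Bd.mul2 (hA n i) (hB n j) (hB n i) (hA n j))
    (fun n j => by simp [kA n, kB n]) (fun n j => by simp [kA n, kB n]) hz i j
  have a6 := P.H_est hM (fun n i => (hB n i).pred) hz i j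
  have a7 := P.H_est hM (fun n i => (hB n i).pred) hz j i
  have b1 : |u i z * cc (P.H B) j z| ≤ Y * (Y * (P.Ph z + ε)) := by
    rw [abs_mul]; exact mul_le_mul (hu i z hz) (cB j) (abs_nonneg _) hY0
  have b2 : |u j z * cc (P.H B) i z| ≤ Y * (Y * (P.Ph z + ε)) := by
    rw [abs_mul]; exact mul_le_mul (hu j z hz) (cB i) (abs_nonneg _) hY0
  have b3 : |b i z * cc (P.H A) j z| ≤ Y * (Y * (P.Ph z + ε)) := by
    rw [abs_mul]; exact mul_le_mul (hb i z hz) (cA j) (abs_nonneg _) hY0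
  have b4 : |b j z * cc (P.H A) i z| ≤ Y * (Y * (P.Ph z + ε)) := by
    rw [abs_mul]; exact mul_le_mul (hb j z hz) (cA i) (abs_nonneg _) hY0
  have hSz := congrArg (fun f : SP => f z) (hG i j)
  simp only [SP.sum_apply, SP.sub_apply, SP.mul_apply, SP.neg_apply] at hSz
  have hT : ∑ n, P.T0 n z * (A n i * B n j - B n i * A n j) z = ∑ n, P.F n z ^ 2 * (A n i z * B n j z)
      - ∑ n, P.F n z ^ 2 * (B n i z * A n j z) - (- G i j z) := by
    rw [← hSz, ← Finset.sum_sub_distrib, ← Finset.sum_sub_distrib]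
    refine Finset.sum_congr rfl fun n _ => ?_
    rw [T0_apply, SP.sub_apply, SP.mul_apply, SP.mul_apply]; ring
  rw [hT] at a5
  apply combine hC hφ (P.Cr_nonneg z) hm hm1 hY
  have e8 : Cp * (8 * Y ^ 2) / M = Cp * (8 * Y ^ 2) * m := by rw [hmdef]; ring
  have e9 : Cp * Y / M = Cp * Y * m := by rw [hmdef]; ring
  rw [e8] at a5
  rw [e9] at a6 a7
  rw [← hε]
  simp only [TB, SP.sub_apply, SP.add_apply, SP.mul_apply]
  rw [abs_le] at *
  constructor <;> linarith [a1.1, a1.2, a2.1, a2.2, a3.1, a3.2, a4.1, a4.2, a5.1, a5.2, a6.1, a6.2, a7.1, a7.2, b1.1, b1.2, b2.1, b2.2, b3.1, b3.2, b4.1, b4.2]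

end main

end Prof

end

noncomputable section
open MeasureTheory Real Matrix

theorem Bd.sub {n : ℕ} {f g : SP} {X Y : ℝ} (h : Bd n f X) (h' : Bd n g Y) :
    Bd n (f - g) (X + Y) := by
  rw [sub_eq_add_neg]; exact h.add h'.neg

theorem Bd.sum {ι : Type*} {s : Finset ι} {n : ℕ} {f : ι → SP} {X : ℝ} (h : ∀ i, Bd n (f i) X) :
    Bd n (∑ i ∈ s, f i) (s.card * X) := by
  classical
  induction s using Finset.induction_on with
  | empty =>
    have := (Bd.const n 0)
    simpa using this
  | insert a s ha ih =>
    rw [Finset.sum_insert ha, Finset.card_insert_of_notMem ha]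
    refine ((h a).add ih).mono (le_of_eq ?_)
    push_cast; ring

theorem per_int {g : ℝ → ℝ} (hg : Continuous g) (hp : Function.Periodic g (2 * π)) {M : ℕ} (hM : 1 ≤ M) (c : ℝ) :
    ∫ s in (-π)..π, g (M * s + c) = ∫ s in (-π)..π, g s := by
  have hM0 : (M : ℝ) ≠ 0 := by positivity
  rw [intervalIntegral.integral_comp_mul_add g hM0 c]
  have e : (M : ℝ) * π + c = (M * (-π) + c) + (M : ℤ) • (2 * π) := by simp; ring
  rw [e, hp.intervalIntegral_add_zsmul_eq _ _ (fun a b => hg.intervalIntegrable a b),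
    hp.intervalIntegral_add_eq _ (-π)]
  have e2 : -π + 2 * π = π := by ring
  rw [e2]
  simp
  field_simp

namespace Prof
variable {Cp : ℝ} {M : ℕ} (P : Prof Cp M)

include P in
theorem C0 : 0 ≤ Cp := (P.waveF (0, true)).nonneg

theorem intAbs (hM : 1 ≤ M) (c : ℝ) : ∫ s in (-π)..π, |P.f (M * s + c)| ≤ Cp / M := by
  rw [per_int (g := fun s => |P.f s|) P.sf.continuous.abs (fun x => by simp only [P.pf x]) hM c]
  exact P.l1

theorem int_F (hM : 1 ≤ M) (n : NN) (t : ℝ) : ∫ x in dom, |P.F n (t, x)| ≤ (2 * π) ^ 2 * (Cp / M) := by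
  have := dom_one n.1 (fun s => |P.f (M * s + ph n)|)
  calc _ = _ := this
    _ ≤ _ := by gcongr; exact P.intAbs hM _

theorem int_FF (hM : 1 ≤ M) {n m : NN} (h : n ≠ m) (t : ℝ) :
    ∫ x in dom, |P.F n (t, x) * P.F m (t, x)| ≤ (2 * π) * (Cp ^ 2 / M) := by
  have hC := P.C0
  by_cases h1 : n.1 = m.1
  · have h2 : n.2 ≠ m.2 := fun h2 => h (Prod.ext h1 h2)
    have : ∀ x, P.F n (t, x) * P.F m (t, x) = 0 := by
      intro x
      obtain ⟨k, a⟩ := n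
      obtain ⟨l, b⟩ := m
      simp only at h1 h2
      subst h1
      have := P.dis (M * x k)
      cases a <;> cases b <;> simp [F, ph] at h2 ⊢ <;> simpa [or_comm] using this
    simp only [this, abs_zero, integral_zero]
    positivity
  · have := dom_two n.1 m.1 h1 (fun s => |P.f (M * s + ph n)|) (fun s => |P.f (M * s + ph m)|)
    have hM1 : (1 : ℝ) ≤ M := by exact_mod_cast hM
    calc ∫ x in dom, |P.F n (t, x) * P.F m (t, x)| = ∫ x in dom, |P.f (M * x n.1 + ph n)| * |P.f (M * x m.1 + ph m)| := by
          simp only [abs_mul]; rfl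
      _ = _ := this
      _ ≤ 2 * π * (Cp / M * (Cp / M)) := by
          gcongr
          · exact intervalIntegral.integral_nonneg neg_pi_le_pi (fun _ _ => abs_nonneg _)
          · exact P.intAbs hM _
          · exact P.intAbs hM _
      _ ≤ 2 * π * (Cp ^ 2 / M) := by
          gcongr
          rw [div_mul_div_comm, ← sq]
          gcongr
          nlinarith

theorem Ph_cont (t : ℝ) : Continuous fun x => P.Ph (t, x) :=
  continuous_finsetSum _ fun n _ => (SPcont _ t).abs

theorem Cr_cont (t : ℝ) : Continuous fun x => P.Cr (t, x) :=
  continuous_finsetSum _ fun n _ => continuous_finsetSum _ fun m _ => by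
    split_ifs
    · exact continuous_const
    · exact ((SPcont _ t).mul (SPcont _ t)).abs

theorem Env_cont (t : ℝ) : Continuous fun x => P.Env (t, x) :=
  ((P.Ph_cont t).add (P.Cr_cont t)).add continuous_const

theorem int_Env (hM : 1 ≤ M) (t : ℝ) : ∫ x in dom, P.Env (t, x) ≤
    (6 * (2 * π) ^ 2 * Cp + 36 * (2 * π) * Cp ^ 2 + (2 * π) ^ 3) / M := by
  have hC := P.C0
  have h1 : ∫ x in dom, P.Ph (t, x) ≤ 6 * ((2 * π) ^ 2 * (Cp / M)) := by
    unfold Ph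
    rw [integral_finsetSum _ fun n _ => contIntOn (SPcont _ t).abs]
    refine (Finset.sum_le_card_nsmul _ _ _ (fun n _ => P.int_F hM n t)).trans (le_of_eq ?_)
    rw [card_NN]; simp
  have h2 : ∫ x in dom, P.Cr (t, x) ≤ 36 * ((2 * π) * (Cp ^ 2 / M)) := by
    have hc : ∀ n m : NN, Continuous fun x => if n = m then (0 : ℝ) else |P.F n (t, x) * P.F m (t, x)| := fun n m => by
      split_ifs
      · exact continuous_const
      · exact ((SPcont _ t).mul (SPcont _ t)).abs
    unfold Cr
    rw [integral_finsetSum _ fun n _ => contIntOn (continuous_finsetSum _ fun m _ => hc n m)]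
    have : ∀ n : NN, ∫ x in dom, ∑ m, (if n = m then (0 : ℝ) else |P.F n (t, x) * P.F m (t, x)|) ≤
        6 * ((2 * π) * (Cp ^ 2 / M)) := by
      intro n
      rw [integral_finsetSum _ fun m _ => contIntOn (hc n m)]
      refine (Finset.sum_le_card_nsmul _ _ ((2 * π) * (Cp ^ 2 / M)) (fun m _ => ?_)).trans (le_of_eq ?_)
      · split_ifs with h
        · simp; positivity
        · exact P.int_FF hM h t
      · rw [card_NN]; simp
    refine (Finset.sum_le_card_nsmul _ _ _ (fun n _ => this n)).trans (le_of_eq ?_)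
    rw [card_NN]; simp; ring
  have h3 : ∫ _ in dom, 1 / (M : ℝ) = (2 * π) ^ 3 * (1 / M) := by
    rw [← dom_vol, ← integral_mul_const]; simp
  unfold Env
  have hPC : Continuous fun x => P.Ph (t, x) + P.Cr (t, x) := (P.Ph_cont t).add (P.Cr_cont t)
  rw [integral_add (contIntOn hPC) (contIntOn continuous_const),
    integral_add (contIntOn (P.Ph_cont t)) (contIntOn (P.Cr_cont t)), h3]
  have e : (6 * (2 * π) ^ 2 * Cp + 36 * (2 * π) * Cp ^ 2 + (2 * π) ^ 3) / M =
    6 * ((2 * π) ^ 2 * (Cp / M)) + 36 * ((2 * π) * (Cp ^ 2 / M)) + (2 * π) ^ 3 * (1 / M) := by ring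
  rw [e]
  linarith

theorem C1_est (hM : 1 ≤ M) {A : NN → Fin 3 → SP} {Y : ℝ} (hA : ∀ n i, Bd 3 (A n i) Y) (i : Fin 3) :
    Bd 1 (cc (P.H A) i) (288 * (Cp * Y * M ^ 4)) := by
  have hM0 : (M : ℝ) ≠ 0 := by positivity
  have h1 : ∀ i, Bd 3 (P.H A i) (6 * (8 * (Cp * Y * M ^ 4))) := fun i => by
    have : ∀ n, Bd 3 ((-(1 / (M : ℝ) ^ 2)) • (P.F2 n * A n i)) (8 * (Cp * Y * M ^ 4)) := fun n => by
      have := ((P.bd3 hM n).mul (hA n i)).smul (-(1 / (M : ℝ) ^ 2))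
      refine this.mono (le_of_eq ?_)
      rw [abs_neg, abs_of_nonneg (by positivity)]
      field_simp
      ring
    have := Bd.sum (s := Finset.univ) this
    rw [card_NN] at this
    exact this
  unfold cc
  have h2 : ∀ j, Bd 1 (D (ee i) (D (ee j) (P.H A j)) - D (ee j) (D (ee j) (P.H A i)))
      (96 * (Cp * Y * M ^ 4)) := fun j => by
    refine (((h1 j).d1 (norm_ee j)).d1 (norm_ee i)).sub (((h1 i).d1 (norm_ee j)).d1 (norm_ee j)) |>.mono (le_of_eq ?_)
    ring
  refine (Bd.sum (s := Finset.univ) h2).mono (le_of_eq ?_)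
  simp; ring

theorem T0A_est (hM : 1 ≤ M) {a : SP} {Y : ℝ} (ha : Bd 1 a Y) (n : NN) {t : ℝ} (ht : t ∈ Set.Icc (0 : ℝ) 1) :
    ∫ x in dom, P.T0 n (t, x) * a (t, x) ≤ (2 * π) ^ 3 * (Cp * Y) / M := by
  have hM0 : (M : ℝ) ≠ 0 := by positivity
  have h := int_D (P.T1 n * a) n.1 t
  have e : D (ee n.1) (P.T1 n * a) = P.T1 n * D (ee n.1) a + (M : ℝ) • (P.T0 n * a) := by
    rw [D_mul, (P.waveT n).d1]
    simp [ee]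
  rw [e] at h
  simp only [SP.add_apply, SP.smul_apply, SP.mul_apply] at h
  have c1 : Continuous fun x => P.T1 n (t, x) * D (ee n.1) a (t, x) := (SPcont _ t).mul (SPcont _ t)
  have c2 : Continuous fun x => P.T0 n (t, x) * a (t, x) := (SPcont _ t).mul (SPcont _ t)
  have c3 : Continuous fun x => (M : ℝ) * (P.T0 n (t, x) * a (t, x)) := continuous_const.mul c2
  rw [integral_add (contIntOn c1) (contIntOn c3), integral_const_mul] at h
  have h2 : -(∫ x in dom, P.T1 n (t, x) * D (ee n.1) a (t, x)) ≤ (2 * π) ^ 3 * (Cp * Y) := by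
    rw [← integral_neg, ← dom_vol, ← integral_mul_const]
    apply setIntegral_mono (contIntOn c1.neg) (contIntOn continuous_const)
    intro x
    simp only [one_mul]
    refine (neg_le_abs _).trans ?_
    rw [abs_mul]
    exact mul_le_mul ((P.waveT n).b1 _) ((ha.d1 (norm_ee _)) (t, x) ht) (abs_nonneg _) P.C0
  rw [le_div_iff₀ (by positivity)]
  linarith

theorem L2_est (hM : 1 ≤ M) {A : NN → Fin 3 → SP} {Y : ℝ} (hY : 1 ≤ Y) (hA : ∀ n i, Bd 3 (A n i) Y)
    (kA : ∀ n, A n n.1 = 0) {E : (Fin 3 → ℝ) → ℝ} {t : ℝ} (hE : Continuous E)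
    (hAE : ∀ n i x, A n i (t, x) ^ 2 ≤ E x) (ht : t ∈ Set.Icc (0 : ℝ) 1) (i : Fin 3) :
    ∫ x in dom, cc (P.H A) i (t, x) ^ 2 ≤ 72 * (∫ x in dom, E x) +
      (144 * (2 * π) ^ 3 * Cp + 2 * (2 * π) ^ 3 * (108 * Cp) ^ 2) * Y ^ 2 / M := by
  have hM1 : (1 : ℝ) ≤ M := by exact_mod_cast hM
  have hC := P.C0
  set ε := 108 * (Cp * Y / M) with hε
  have hε0 : 0 ≤ ε := by positivity
  have hp : ∀ x, cc (P.H A) i (t, x) ^ 2 ≤ 12 * (∑ n, (A n i (t, x) ^ 2 + P.T0 n (t, x) * (A n i * A n i) (t, x))) + 2 * ε ^ 2 := by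
    intro x
    have h1 := P.v_est hM (fun n i => (hA n i).pred) kA (z := (t, x)) ht i
    have h2 : P.ww A i (t, x) ^ 2 ≤ 6 * ∑ n, (P.F n (t, x) * A n i (t, x)) ^ 2 := by
      have := sq_sum_le_card_mul_sum_sq (s := (Finset.univ : Finset NN)) (f := fun n => P.F n (t, x) * A n i (t, x))
      rw [card_NN] at this
      exact_mod_cast this
    have h3 : ∑ n, (P.F n (t, x) * A n i (t, x)) ^ 2 =
      ∑ n, (A n i (t, x) ^ 2 + P.T0 n (t, x) * (A n i * A n i) (t, x)) :=
      Finset.sum_congr rfl fun n _ => by rw [T0_apply, SP.mul_apply]; ring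
    rw [h3] at h2
    have h4 : (cc (P.H A) i (t, x) - P.ww A i (t, x)) ^ 2 ≤ ε ^ 2 := sq_le_sq' (by linarith [(abs_le.1 h1).1]) (abs_le.1 h1).2
    nlinarith [sq_nonneg (cc (P.H A) i (t, x) - 2 * P.ww A i (t, x))]
  have hc1 : ∀ n, Continuous fun x => A n i (t, x) ^ 2 := fun n => (SPcont _ t).pow 2
  have hc2 : ∀ n, Continuous fun x => P.T0 n (t, x) * (A n i * A n i) (t, x) := fun n => (SPcont _ t).mul (SPcont _ t)
  have hc0 : ∀ n, Continuous fun x => A n i (t, x) ^ 2 + P.T0 n (t, x) * (A n i * A n i) (t, x) := fun n => (hc1 n).add (hc2 n)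
  have hc3 : Continuous fun x => ∑ n, (A n i (t, x) ^ 2 + P.T0 n (t, x) * (A n i * A n i) (t, x)) :=
    continuous_finsetSum _ fun n _ => (hc1 n).add (hc2 n)
  have hc4 : Continuous fun x => 12 * ∑ n, (A n i (t, x) ^ 2 + P.T0 n (t, x) * (A n i * A n i) (t, x)) :=
    continuous_const.mul hc3
  have hI := setIntegral_mono (μ := volume) (s := dom) (contIntOn ((SPcont (cc (P.H A) i) t).pow 2))
    (contIntOn (hc4.add continuous_const)) hp
  refine hI.trans ?_
  simp only [Pi.add_apply]
  rw [integral_add (contIntOn hc4) (contIntOn continuous_const), integral_const_mul,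
    integral_finsetSum _ fun n _ => contIntOn (hc0 n)]
  have h5 : ∀ n, ∫ x in dom, (A n i (t, x) ^ 2 + P.T0 n (t, x) * (A n i * A n i) (t, x)) ≤
      (∫ x in dom, E x) + (2 * π) ^ 3 * (Cp * (2 * (Y * Y))) / M := fun n => by
    rw [integral_add (contIntOn (hc1 n)) (contIntOn (hc2 n))]
    refine add_le_add (setIntegral_mono (contIntOn (hc1 n)) (contIntOn hE) (hAE n i)) ?_
    have := ((hA n i).of_le (m := 1) (by norm_num)).mul ((hA n i).of_le (m := 1) (by norm_num))
    rw [pow_one] at this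
    exact P.T0A_est hM this n ht
  have h6 := Finset.sum_le_card_nsmul (Finset.univ : Finset NN) _ _ (fun n _ => h5 n)
  rw [card_NN] at h6
  have h7 : ∫ _ in dom, 2 * ε ^ 2 = (2 * π) ^ 3 * (2 * ε ^ 2) := by
    rw [← dom_vol, ← integral_mul_const]; simp
  rw [h7]
  have h8 : ε ^ 2 ≤ (108 * Cp) ^ 2 * Y ^ 2 / M := by
    have : ε ^ 2 = (108 * Cp) ^ 2 * Y ^ 2 / (M ^ 2) := by rw [hε]; ring
    rw [this]
    gcongr
    nlinarith
  have h9 : (2 * π) ^ 3 * (2 * ε ^ 2) ≤ (2 * π) ^ 3 * (2 * ((108 * Cp) ^ 2 * Y ^ 2 / M)) := by gcongr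
  rw [nsmul_eq_mul] at h6
  rw [Nat.cast_ofNat] at h6
  have e : 72 * (∫ x in dom, E x) + (144 * (2 * π) ^ 3 * Cp + 2 * (2 * π) ^ 3 * (108 * Cp) ^ 2) * Y ^ 2 / M =
    12 * (6 * ((∫ x in dom, E x) + (2 * π) ^ 3 * (Cp * (2 * (Y * Y))) / M)) + (2 * π) ^ 3 * (2 * ((108 * Cp) ^ 2 * Y ^ 2 / M)) := by
    ring
  rw [e]
  linarith

end Prof

end

noncomputable section
open MeasureTheory Real Matrix

theorem int_le_env {f : SP} {P : ℝ} {E : (Fin 3 → ℝ) → ℝ} (hE : Continuous E) {t a b c : ℝ}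
    (h : ∀ x, |f (t, x)| ≤ a + b * E x) (hb : 0 ≤ b) (hI : ∫ x in dom, E x ≤ c) (ha : a * (2 * π) ^ 3 + b * c ≤ P) :
    ∫ x in dom, |f (t, x)| ≤ P := by
  have c1 : Continuous fun x => b * E x := continuous_const.mul hE
  have c2 : Continuous fun x => a + b * E x := continuous_const.add c1
  refine (setIntegral_mono (contIntOn (SPcont f t).abs) (contIntOn c2) h).trans ?_
  rw [integral_add (contIntOn continuous_const) (contIntOn c1), integral_const_mul]
  have h7 : ∫ _ in dom, a = (2 * π) ^ 3 * a := by
    rw [← dom_vol, ← integral_mul_const]; simp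
  rw [h7]
  nlinarith

theorem Rnew_est (u B : Fin 3 → SP) (R : Fin 3 → Fin 3 → SP) (H K : Fin 3 → SP) (Q : Fin 3 → Fin 3 → SP) (ρ : SP)
    {z : EE} {c : ℝ} (h : ∀ i j, |Tu u B R H K Q ρ i j z| ≤ c) (i j : Fin 3) :
    |Rnew u B R H K Q ρ i j z| ≤ 2 * c := by
  have h1 := h i j
  have h2 : |tru u B R H K Q ρ z| ≤ c := by
    have h0 := h 0 0
    have h1 := h 1 1
    have h2 := h 2 2
    rw [tru, SP.smul_apply, SP.sum_apply, Fin.sum_univ_three]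
    rw [abs_le] at *
    constructor <;> linarith
  rw [Rnew, SP.sub_apply]
  split_ifs
  · have := abs_sub (Tu u B R H K Q ρ i j z) (tru u B R H K Q ρ z)
    linarith
  · rw [SP.zero_apply, sub_zero]
    linarith [abs_nonneg (tru u B R H K Q ρ z)]

theorem perturb : ∃ C : ℝ, 1 ≤ C ∧ ∃ K : ℕ, ∀ M : ℕ, 2 ≤ M → ∀ (d : AD) (u B : Fin 3 → SP) (p : SP)
    (Cu CB : Fin 3 → Fin 3 → SP) (γ σ : ℝ),
    SPsol u B p (fun i j => d.S i j + Cu i j) (fun i j => d.G i j + CB i j) →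
    (∀ i, Bd 0 (u i) d.X) → (∀ i, Bd 0 (B i) d.X) →
    (∀ z ∈ Zs, ∀ i j, |Cu i j z| ≤ γ) → (∀ z ∈ Zs, ∀ i j, |CB i j z| ≤ γ) →
    (∀ t ∈ Set.Icc (0 : ℝ) 1, ∀ i j, ∫ x in dom, |d.S i j (t, x)| ≤ σ) →
    (∀ t ∈ Set.Icc (0 : ℝ) 1, ∀ i j, ∫ x in dom, |d.G i j (t, x)| ≤ σ) →
    ∃ (v h : Fin 3 → SP) (p' : SP) (R' Q' : Fin 3 → Fin 3 → SP),
      SPsol (fun i => u i + v i) (fun i => B i + h i) p' R' Q' ∧ ∑ i, R' i i = 0 ∧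
      (∀ i, Bd 1 (v i) (C * d.X ^ K * M ^ 4)) ∧ (∀ i, Bd 1 (h i) (C * d.X ^ K * M ^ 4)) ∧
      (∀ t ∈ Set.Icc (0 : ℝ) 1, ∀ i j, ∫ x in dom, |R' i j (t, x)| ≤ C * γ + C * d.X ^ K / M) ∧
      (∀ t ∈ Set.Icc (0 : ℝ) 1, ∀ i j, ∫ x in dom, |Q' i j (t, x)| ≤ C * γ + C * d.X ^ K / M) ∧
      (∀ t ∈ Set.Icc (0 : ℝ) 1, ∀ i, ∫ x in dom, v i (t, x) ^ 2 ≤ C * (σ + 1 / d.X ^ 2) + C * d.X ^ K / M) ∧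
      (∀ t ∈ Set.Icc (0 : ℝ) 1, ∀ i, ∫ x in dom, h i (t, x) ^ 2 ≤ C * (σ + 1 / d.X ^ 2) + C * d.X ^ K / M) := by
  obtain ⟨Cp, hCp, hP⟩ := exists_prof
  obtain ⟨Ca, hCa, Ka, hamp⟩ := amp
  set C1 := 4 + 2000 * Cp + 30000 * Cp ^ 2 with hC1
  set CE := 6 * (2 * π) ^ 2 * Cp + 36 * (2 * π) * Cp ^ 2 + (2 * π) ^ 3 with hCE
  set C2 := 144 * (2 * π) ^ 3 * Cp + 2 * (2 * π) ^ 3 * (108 * Cp) ^ 2 with hC2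
  have hC1p : 0 ≤ C1 := by positivity
  have hCEp : 0 ≤ CE := by positivity
  have hC2p : 0 ≤ C2 := by positivity
  have hpi := pi_pos
  set C := 1 + 2 * (2 * π) ^ 3 + 2 * C1 * CE * Ca ^ 2 + 72 * 5 * ((2 * π) ^ 3 + 18) + C2 * Ca ^ 2 + 288 * Cp * Ca with hC
  have q1 : 0 ≤ (2 * π) ^ 3 := by positivity
  have q2 : 0 ≤ 2 * C1 * CE * Ca ^ 2 := by positivity
  have q3 : 0 ≤ C2 * Ca ^ 2 := by positivity
  have q4 : 0 ≤ 288 * Cp * Ca := by positivity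
  refine ⟨C, by linarith, 2 * Ka + 2, ?_⟩
  intro M hM2 d u B p Cu CB γ σ hsol hu hB hCu hCB hS hG
  obtain ⟨P⟩ := hP M hM2
  obtain ⟨A, A', ρ, kA, kA', bA, bA', eS, eG, lA, lA'⟩ := hamp d
  have hX := d.hX
  have hM : 1 ≤ M := by omega
  have hM0 : (1 : ℝ) ≤ M := by exact_mod_cast hM
  set X := d.X with hXd
  set Y := Ca * X ^ (Ka + 1) with hY
  have hYa : Ca * X ^ Ka ≤ Y := by
    rw [hY]; gcongr <;> omega
  have hXY : X ≤ Y := by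
    rw [hY]
    have : X ^ 1 ≤ X ^ (Ka + 1) := pow_le_pow_right₀ hX (by omega)
    rw [pow_one] at this
    nlinarith
  have hY1 : 1 ≤ Y := hX.trans hXY
  have hY2 : Y ^ 2 = Ca ^ 2 * X ^ (2 * Ka + 2) := by rw [hY]; ring
  have hA := fun n i => (bA n i).mono hYa
  have hA' := fun n i => (bA' n i).mono hYa
  have hu' := fun i => (hu i).mono hXY
  have hB' := fun i => (hB i).mono hXY
  have hT := fun {z} (hz : z ∈ Zs) i j => P.Tu_est hM hY1 hA hA' kA kA' ρ d.S eS hu' hB' Cu hz i j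
  have hT' := fun {z} (hz : z ∈ Zs) i j => P.TB_est hM hY1 hA hA' kA kA' d.G eG hu' hB' CB hz i j
  have hE := fun t => P.int_Env hM t
  have hγ : 0 ≤ γ := (abs_nonneg _).trans (hCu _ Zs_ne 0 0)
  have hσ : 0 ≤ σ := (integral_nonneg fun _ => abs_nonneg _).trans (hS 0 (by simp) 0 0)
  have Xp : 0 ≤ X ^ (2 * Ka + 2) / M := by positivity
  have c1le : ∀ {A : NN → Fin 3 → SP}, (∀ n i, Bd 3 (A n i) Y) → ∀ i, Bd 1 (cc (P.H A) i) (C * X ^ (2 * Ka + 2) * M ^ 4) := by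
    intro A hA i
    refine (P.C1_est hM hA i).mono ?_
    have : Y ≤ Ca * X ^ (2 * Ka + 2) := by
      rw [hY]; gcongr <;> omega
    calc 288 * (Cp * Y * M ^ 4) ≤ 288 * (Cp * (Ca * X ^ (2 * Ka + 2)) * M ^ 4) := by gcongr
      _ = (288 * Cp * Ca) * (X ^ (2 * Ka + 2) * M ^ 4) := by ring
      _ ≤ C * (X ^ (2 * Ka + 2) * M ^ 4) := by
        apply mul_le_mul_of_nonneg_right _ (by positivity)
        linarith
      _ = _ := by ring
  have tail : ∀ {b : ℝ}, b ≤ 2 * (C1 * Y ^ 2) → 2 * γ * (2 * π) ^ 3 + b * (CE / M) ≤ C * γ + C * X ^ (2 * Ka + 2) / M := by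
    intro b hb
    have h1 : b * (CE / M) ≤ (2 * (C1 * Y ^ 2)) * (CE / M) := by gcongr
    have h2 : (2 * (C1 * Y ^ 2)) * (CE / M) = (2 * C1 * CE * Ca ^ 2) * (X ^ (2 * Ka + 2) / M) := by rw [hY2]; ring
    have h3 : (2 * C1 * CE * Ca ^ 2) * (X ^ (2 * Ka + 2) / M) ≤ C * (X ^ (2 * Ka + 2) / M) := by
      apply mul_le_mul_of_nonneg_right _ Xp; linarith
    have h4 : (2 * (2 * π) ^ 3) * γ ≤ C * γ := by
      apply mul_le_mul_of_nonneg_right _ hγ; linarith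
    have h5 : C * X ^ (2 * Ka + 2) / M = C * (X ^ (2 * Ka + 2) / M) := by ring
    rw [h5]
    linarith
  have l2 : ∀ {A : NN → Fin 3 → SP}, (∀ n i, Bd 3 (A n i) Y) → (∀ n, A n n.1 = 0) →
      (∀ n i z, A n i z ^ 2 ≤ 5 * (1 / X ^ 2 + ((∑ i, ∑ j, |d.S i j z|) + ∑ i, ∑ j, |d.G i j z|))) →
      ∀ t ∈ Set.Icc (0 : ℝ) 1, ∀ i, ∫ x in dom, cc (P.H A) i (t, x) ^ 2 ≤ C * (σ + 1 / X ^ 2) + C * X ^ (2 * Ka + 2) / M := by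
    intro A hA kA lA t ht i
    have k1 : ∀ R : Fin 3 → Fin 3 → SP, Continuous fun x => ∑ i, ∑ j, |R i j (t, x)| := fun R =>
      continuous_finsetSum _ fun i _ => continuous_finsetSum _ fun j _ => (SPcont _ t).abs
    have k2 : Continuous fun x => (∑ i, ∑ j, |d.S i j (t, x)|) + ∑ i, ∑ j, |d.G i j (t, x)| := (k1 _).add (k1 _)
    have k3 : Continuous fun x => 1 / X ^ 2 + ((∑ i, ∑ j, |d.S i j (t, x)|) + ∑ i, ∑ j, |d.G i j (t, x)|) :=
      continuous_const.add k2
    have k4 : Continuous fun x => 5 * (1 / X ^ 2 + ((∑ i, ∑ j, |d.S i j (t, x)|) + ∑ i, ∑ j, |d.G i j (t, x)|)) :=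
      continuous_const.mul k3
    refine (P.L2_est hM hY1 hA kA k4 (fun n i x => lA n i (t, x)) ht i).trans ?_
    have s1 : ∀ R : Fin 3 → Fin 3 → SP, (∀ i j, ∫ x in dom, |R i j (t, x)| ≤ σ) →
        ∫ x in dom, ∑ i, ∑ j, |R i j (t, x)| ≤ 9 * σ := by
      intro R hR
      rw [integral_finsetSum _ fun i _ => contIntOn (continuous_finsetSum _ fun j _ => (SPcont (R i j) t).abs)]
      have : ∀ i, ∫ x in dom, ∑ j, |R i j (t, x)| ≤ 3 * σ := by
        intro i
        rw [integral_finsetSum _ fun j _ => contIntOn (SPcont (R i j) t).abs]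
        refine (Finset.sum_le_card_nsmul _ _ _ (fun j _ => hR i j)).trans (le_of_eq (by simp))
      refine (Finset.sum_le_card_nsmul _ _ _ (fun j _ => this j)).trans (le_of_eq (by simp; ring))
    have s2 := s1 _ (hS t ht)
    have s3 := s1 _ (hG t ht)
    rw [integral_const_mul, integral_add (contIntOn continuous_const) (contIntOn k2),
      integral_add (contIntOn (k1 _)) (contIntOn (k1 _))]
    have h7 : ∫ _ in dom, 1 / X ^ 2 = (2 * π) ^ 3 * (1 / X ^ 2) := by
      rw [← dom_vol, ← integral_mul_const]; simp
    rw [h7]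
    have h8 : C2 * Y ^ 2 / M = (C2 * Ca ^ 2) * (X ^ (2 * Ka + 2) / M) := by rw [hY2]; ring
    rw [h8]
    have h9 : (C2 * Ca ^ 2) * (X ^ (2 * Ka + 2) / M) ≤ C * (X ^ (2 * Ka + 2) / M) := by
      apply mul_le_mul_of_nonneg_right _ Xp; linarith
    have h10 : (72 * 5 * (2 * π) ^ 3) * (1 / X ^ 2) ≤ C * (1 / X ^ 2) := by
      apply mul_le_mul_of_nonneg_right _ (by positivity); linarith
    have h11 : (72 * 5 * 18) * σ ≤ C * σ := by
      apply mul_le_mul_of_nonneg_right _ hσ; linarith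
    have h12 : C * X ^ (2 * Ka + 2) / M = C * (X ^ (2 * Ka + 2) / M) := by ring
    rw [h12]
    linarith
  have sQ : ∀ i j, P.Q (fun n i j => A n i * A n j - A' n i * A' n j) i j = P.Q (fun n i j => A n i * A n j - A' n i * A' n j) j i := by
    intro i j
    unfold Prof.Q
    refine Finset.sum_congr rfl fun n _ => ?_
    congr 2
    ring
  have sQ' : ∀ i j, P.Q (fun n i j => A n i * A' n j - A' n i * A n j) i j = - P.Q (fun n i j => A n i * A' n j - A' n i * A n j) j i := by
    intro i j
    unfold Prof.Q
    rw [← Finset.sum_neg_distrib]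
    refine Finset.sum_congr rfl fun n _ => ?_
    rw [← smul_neg]
    congr 1
    ring
  refine ⟨cc (P.H A), cc (P.H A'), _, _, _, step_sol _ _ p _ _ (P.H A) (P.H A') _ _ ρ hsol sQ sQ', trace_new _ _ _ _ _ _ _,
    c1le hA, c1le hA', ?_, ?_, l2 hA kA lA, l2 hA' kA' lA'⟩
  · intro t ht i j
    apply int_le_env (P.Env_cont t) (a := 2 * γ) (b := 2 * (C1 * Y ^ 2)) _ (by positivity) (hE t) (tail le_rfl)
    intro x
    have hz : (t, x) ∈ Zs := ht
    refine (Rnew_est _ _ _ _ _ _ _ (c := γ + C1 * Y ^ 2 * P.Env (t, x)) (fun i j => ?_) i j).trans (le_of_eq (by ring))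
    have h1 := hT hz i j
    have h2 := hCu _ hz i j
    rw [abs_le] at *
    constructor <;> linarith
  · intro t ht i j
    apply int_le_env (P.Env_cont t) (a := 2 * γ) (b := C1 * Y ^ 2) _ (by positivity) (hE t)
      (tail (by have : 0 ≤ C1 * Y ^ 2 := by positivity
                linarith))
    intro x
    have hz : (t, x) ∈ Zs := ht
    have h1 := hT' hz i j
    have h2 := hCB _ hz i j
    rw [abs_le] at *
    constructor <;> linarith

end

noncomputable section
open MeasureTheory Real Matrix

/-- smooth kernels supported in the unit ball -/
def KK : Submodule ℝ (EE → ℝ) where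
  carrier := {f | ContDiff ℝ (⊤ : ℕ∞) f ∧ ∀ w, 1 < ‖w‖ → f w = 0}
  add_mem' := by
    rintro f g ⟨hf, hf'⟩ ⟨hg, hg'⟩
    exact ⟨hf.add hg, fun w hw => by simp [hf' w hw, hg' w hw]⟩
  zero_mem' := ⟨contDiff_const, fun _ _ => rfl⟩
  smul_mem' := by
    rintro c f ⟨hf, hf'⟩
    exact ⟨contDiff_const.smul hf, fun w hw => by simp [hf' w hw]⟩

instance : CoeFun KK (fun _ => EE → ℝ) := ⟨fun f => f.1⟩

theorem Ksm (f : KK) : ContDiff ℝ (⊤ : ℕ∞) (f : EE → ℝ) := f.2.1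
theorem Kdf (f : KK) : Differentiable ℝ (f : EE → ℝ) := (Ksm f).differentiable (by simp)
theorem Kct (f : KK) : Continuous (f : EE → ℝ) := (Ksm f).continuous
theorem Kz (f : KK) {w : EE} (hw : 1 < ‖w‖) : f w = 0 := f.2.2 w hw
theorem Kcs (f : KK) : HasCompactSupport (f : EE → ℝ) :=
  HasCompactSupport.intro (isCompact_closedBall 0 1) fun w hw => Kz f (by simpa using hw)

@[simp] theorem KK.add_apply (f g : KK) (z : EE) : (f + g) z = f z + g z := rfl
@[simp] theorem KK.smul_apply (c : ℝ) (f : KK) (z : EE) : (c • f) z = c * f z := rfl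
theorem KK.ext' {f g : KK} (h : ∀ z, f z = g z) : f = g := Subtype.ext (funext h)

def dK (v : EE) (f : KK) : KK := ⟨fun z => fderiv ℝ (f : EE → ℝ) z v, fderiv_smooth (Ksm f) v, by
  intro w hw
  have : (f : EE → ℝ) =ᶠ[nhds w] fun _ => 0 := by
    filter_upwards [(isOpen_lt continuous_const continuous_norm).mem_nhds hw] with z hz
    exact Kz f hz
  simp only [this.fderiv_eq]
  simp⟩

theorem dK_apply (v : EE) (f : KK) (z : EE) : dK v f z = fderiv ℝ (f : EE → ℝ) z v := rfl
theorem dK_add (v : EE) (f g : KK) : dK v (f + g) = dK v f + dK v g := KK.ext' fun z => by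
  change fderiv ℝ (fun z => f z + g z) z v = _
  rw [fderiv_fun_add (Kdf f z) (Kdf g z)]; rfl
theorem dK_smul (v : EE) (c : ℝ) (f : KK) : dK v (c • f) = c • dK v f := KK.ext' fun z => by
  change fderiv ℝ (fun z => c • f z) z v = _
  rw [fderiv_fun_const_smul (Kdf f z)]; rfl

theorem EE_dec (v : EE) : v = v.1 • e0 + ∑ j, v.2 j • ee j := by
  ext i
  · simp [e0, ee, Prod.fst_sum]
  · simp [e0, ee, Prod.snd_sum, Finset.sum_apply, Pi.single_apply]

theorem dK_dec (v : EE) (f : KK) : dK v f = v.1 • dK e0 f + ∑ j, v.2 j • dK (ee j) f := KK.ext' fun z => by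
  rw [Fin.sum_univ_three]
  simp only [KK.add_apply, KK.smul_apply, dK_apply]
  conv_lhs => rw [EE_dec v]
  rw [Fin.sum_univ_three]
  simp only [map_add, map_smul, smul_eq_mul]

def KB : ℕ → KK → ℝ → Prop
  | 0, f, X => ∀ z, |f z| ≤ X
  | n + 1, f, X => (∀ z, |f z| ≤ X) ∧ ∀ v : EE, ‖v‖ ≤ 1 → KB n (dK v f) X

theorem KB.zero {n : ℕ} {f : KK} {X : ℝ} (h : KB n f X) : ∀ z, |f z| ≤ X := by
  cases n with
  | zero => exact h
  | succ n => exact h.1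

theorem KB.nonneg {n : ℕ} {f : KK} {X : ℝ} (h : KB n f X) : 0 ≤ X := (abs_nonneg _).trans (h.zero 0)

theorem KB.mono {n : ℕ} {f : KK} {X Y : ℝ} (h : KB n f X) (hXY : X ≤ Y) : KB n f Y := by
  induction n generalizing f with
  | zero => exact fun z => (h z).trans hXY
  | succ n ih => exact ⟨fun z => (h.1 z).trans hXY, fun v hv => ih (h.2 v hv)⟩

theorem KB.add {n : ℕ} {f g : KK} {X Y : ℝ} (h : KB n f X) (h' : KB n g Y) : KB n (f + g) (X + Y) := by
  induction n generalizing f g with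
  | zero => exact fun z => (abs_add_le _ _).trans (add_le_add (h z) (h' z))
  | succ n ih =>
    refine ⟨fun z => (abs_add_le _ _).trans (add_le_add (h.1 z) (h'.1 z)), fun v hv => ?_⟩
    rw [dK_add]
    exact ih (h.2 v hv) (h'.2 v hv)

theorem KB.smul {n : ℕ} {f : KK} {X c : ℝ} (h : KB n f X) (hc : |c| ≤ 1) : KB n (c • f) X := by
  have key : ∀ (f : KK), (∀ z, |f z| ≤ X) → ∀ z, |(c • f) z| ≤ X := fun f hf z => by
    rw [KK.smul_apply, abs_mul]
    calc |c| * |f z| ≤ 1 * |f z| := by gcongr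
      _ ≤ X := by linarith [hf z]
  induction n generalizing f with
  | zero => exact key f h
  | succ n ih =>
    refine ⟨key f h.1, fun v hv => ?_⟩
    rw [dK_smul]
    exact ih (h.2 v hv)

theorem exists_KB (n : ℕ) (f : KK) : ∃ X, KB n f X := by
  have key : ∀ f : KK, ∃ X, ∀ z, |f z| ≤ X := fun f => by
    obtain ⟨C, hC⟩ := (Kct f).bounded_above_of_compact_support (Kcs f)
    exact ⟨C, hC⟩
  induction n generalizing f with
  | zero => exact key f
  | succ n ih =>
    obtain ⟨X, hX⟩ := key f
    obtain ⟨X0, h0⟩ := ih (dK e0 f)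
    choose Y hY using fun j => ih (dK (ee j) f)
    have hY' := fun j => (hY j).nonneg
    have hX0 : 0 ≤ X := (abs_nonneg _).trans (hX 0)
    have hX00 := h0.nonneg
    refine ⟨X + (X0 + (Y 0 + Y 1 + Y 2)), fun z => (hX z).trans (by linarith [hY' 0, hY' 1, hY' 2]), fun v hv => ?_⟩
    rw [dK_dec, Fin.sum_univ_three]
    have hv1 : |v.1| ≤ 1 := (norm_fst_le v).trans hv
    refine KB.mono ((h0.smul hv1).add ((((hY 0).smul (comp_le hv 0)).add ((hY 1).smul (comp_le hv 1))).add
      ((hY 2).smul (comp_le hv 2)))) (by linarith)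

instance EE_haar : (volume : Measure EE).IsAddHaarMeasure := by
  rw [Measure.volume_eq_prod]; infer_instance

def Jm (l : ℝ) (φ : KK) (f : EE → ℝ) (y : EE) : ℝ := ∫ w, φ w * f (y - l • w)

theorem J_cont (l : ℝ) (φ : KK) {f : EE → ℝ} (hf : Continuous f) (y : EE) : Continuous fun w => φ w * f (y - l • w) :=
  (Kct φ).mul (hf.comp (by fun_prop))

theorem J_int (l : ℝ) (φ : KK) {f : EE → ℝ} (hf : Continuous f) (y : EE) : Integrable fun w => φ w * f (y - l • w) :=
  (J_cont l φ hf y).integrable_of_hasCompactSupport ((Kcs φ).mul_right)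

theorem J_conv {l : ℝ} (hl : l ≠ 0) (φ : KK) (f : EE → ℝ) :
    Jm l φ f = fun y => (convolution φ (fun x => f (l • x)) (ContinuousLinearMap.mul ℝ ℝ) volume) (l⁻¹ • y) := by
  funext y
  simp only [Jm, convolution, ContinuousLinearMap.mul_apply']
  refine integral_congr_ae (Filter.Eventually.of_forall ?_)
  intro w
  simp only
  rw [smul_sub, smul_inv_smul₀ hl]

theorem J_smooth {l : ℝ} (hl : l ≠ 0) (φ : KK) {f : EE → ℝ} (hf : Continuous f) : ContDiff ℝ (⊤ : ℕ∞) (Jm l φ f) := by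
  rw [J_conv hl]
  have hg : LocallyIntegrable (fun x => f (l • x)) (volume : Measure EE) :=
    (hf.comp (continuous_const_smul l)).locallyIntegrable
  exact ((Kcs φ).contDiff_convolution_left _ (Ksm φ) hg).comp (contDiff_const_smul _)

theorem J_fderiv {l : ℝ} (hl : l ≠ 0) (φ : KK) {f : EE → ℝ} (hf : Continuous f) (y v : EE) :
    fderiv ℝ (Jm l φ f) y v = l⁻¹ * Jm l (dK v φ) f y := by
  have hg : LocallyIntegrable (fun x => f (l • x)) (volume : Measure EE) :=
    (hf.comp (continuous_const_smul l)).locallyIntegrable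
  have h1 := (Kcs φ).hasFDerivAt_convolution_left (ContinuousLinearMap.mul ℝ ℝ) ((Ksm φ).of_le (by simp)) hg (l⁻¹ • y)
  have h2 : HasFDerivAt (fun y : EE => l⁻¹ • y) (l⁻¹ • ContinuousLinearMap.id ℝ EE) y :=
    (hasFDerivAt_id y).const_smul l⁻¹
  have h3 := (HasFDerivAt.comp y h1 h2).fderiv
  rw [J_conv hl φ f, J_conv hl (dK v φ) f]
  change fderiv ℝ ((convolution φ (fun x => f (l • x)) (ContinuousLinearMap.mul ℝ ℝ) volume) ∘ (fun y => l⁻¹ • y)) y v = _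
  rw [h3]
  simp only [ContinuousLinearMap.comp_apply, ContinuousLinearMap.smul_apply, ContinuousLinearMap.id_apply, map_smul, smul_eq_mul]
  congr 1
  rw [convolution, convolution, ContinuousLinearMap.integral_apply]
  · rfl
  · have c1 : Continuous (fderiv ℝ (φ : EE → ℝ)) := (Ksm φ).continuous_fderiv (by simp)
    have := ((Kcs φ).fderiv (𝕜 := ℝ)).convolutionExists_left ((ContinuousLinearMap.mul ℝ ℝ).precompL EE) c1 hg (l⁻¹ • y)
    exact this

theorem J_ibp {l : ℝ} (φ : KK) {f : EE → ℝ} (hf : ContDiff ℝ (⊤ : ℕ∞) f) (y v : EE) :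
    Jm l (dK v φ) f y = l * Jm l φ (fun z => fderiv ℝ f z v) y := by
  have hd := hf.differentiable (by simp)
  have hfd : ∀ w, HasFDerivAt (fun w => f (y - l • w)) ((fderiv ℝ f (y - l • w)).comp (-(l • ContinuousLinearMap.id ℝ EE))) w := by
    intro w
    have h2 : HasFDerivAt (fun w : EE => y - l • w) (-(l • ContinuousLinearMap.id ℝ EE)) w :=
      ((hasFDerivAt_id w).const_smul l).const_sub y
    exact (hd _).hasFDerivAt.comp w h2
  have e : ∀ w, fderiv ℝ (fun w => f (y - l • w)) w v = - (l * fderiv ℝ f (y - l • w) v) := by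
    intro w
    rw [(hfd w).fderiv]
    simp
  have c : Continuous fun z => fderiv ℝ f z v := (fderiv_smooth hf v).continuous
  have := integral_mul_fderiv_eq_neg_fderiv_mul_of_integrable (𝕜 := ℝ) (μ := (volume : Measure EE)) (f := φ) (g := fun w => f (y - l • w)) (v := v)
    (J_int l (dK v φ) hf.continuous y) (by
      simp only [e]
      have := (J_int l φ c y).const_mul (-l)
      refine this.congr (Filter.Eventually.of_forall fun w => ?_)
      simp only; ring) (J_int l φ hf.continuous y) (fun w _ => Kdf φ w) (fun w _ => (hfd w).differentiableAt)
  simp only [e] at this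
  have e2 : ∀ w, φ w * -(l * fderiv ℝ f (y - l • w) v) = - (l * (φ w * fderiv ℝ f (y - l • w) v)) := fun w => by ring
  simp only [e2, integral_neg, integral_const_mul] at this
  unfold Jm
  have := neg_injective this
  rw [this]
  rfl

end

noncomputable section
open MeasureTheory Real Matrix

theorem exists_ker : ∃ φ : KK, (∀ w, 0 ≤ φ w) ∧ ∫ w, φ w = 1 := by
  let b : ContDiffBump (0 : EE) := ⟨1 / 2, 1, by norm_num, by norm_num⟩
  refine ⟨⟨b.normed volume, b.contDiff_normed, fun w hw => ?_⟩, fun w => b.nonneg_normed w, b.integral_normed⟩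
  have : w ∉ Function.support (b.normed (volume : Measure EE)) := by
    rw [b.support_normed_eq]
    simp only [Metric.mem_ball, dist_zero_right, not_lt]
    exact hw.le
  simpa using this

def Tm (l : ℝ) (z : EE) : EE := (l + (1 - 2 * l) * z.1, z.2)
def Lm (l : ℝ) (v : EE) : EE := ((1 - 2 * l) * v.1, v.2)

theorem Tm_fderiv (l : ℝ) {f : EE → ℝ} (hf : Differentiable ℝ f) (z v : EE) :
    fderiv ℝ (fun z => f (Tm l z)) z v = fderiv ℝ f (Tm l z) (Lm l v) := by
  have h1 : HasFDerivAt (Tm l) (((1 - 2 * l) • ContinuousLinearMap.fst ℝ ℝ (Fin 3 → ℝ)).prod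
      (ContinuousLinearMap.snd ℝ ℝ (Fin 3 → ℝ))) z := by
    apply HasFDerivAt.prodMk
    · exact (hasFDerivAt_fst.const_mul (1 - 2 * l)).const_add l
    · exact hasFDerivAt_snd
  have := ((hf _).hasFDerivAt.comp z h1).fderiv
  change fderiv ℝ (f ∘ Tm l) z v = _
  rw [this]
  rfl

theorem Tm_smooth (l : ℝ) : ContDiff ℝ (⊤ : ℕ∞) (Tm l) := by
  unfold Tm; fun_prop

def mol (l : ℝ) (hl : l ≠ 0) (φ : KK) : SP →ₗ[ℝ] SP where
  toFun f := ⟨fun z => Jm l φ f (Tm l z), (J_smooth hl φ (ct f)).comp (Tm_smooth l), by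
    intro t x i
    unfold Jm
    refine integral_congr_ae (Filter.Eventually.of_forall ?_)
    intro w
    simp only
    have := pe f (l + (1 - 2 * l) * t - l * w.1) (x - l • w.2) i
    congr 1
    refine Eq.trans ?_ (this.trans ?_)
    · refine congrArg (f : EE → ℝ) (Prod.ext ?_ (funext fun j => ?_))
      · simp [Tm]
      · simp [Tm]; ring
    · rfl⟩
  map_add' f g := SP.ext' fun z => by
    change Jm l φ (fun z => f z + g z) (Tm l z) = Jm l φ f (Tm l z) + Jm l φ g (Tm l z)
    unfold Jm
    rw [← integral_add (J_int l φ (ct f) _) (J_int l φ (ct g) _)]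
    simp only [mul_add]
  map_smul' c f := SP.ext' fun z => by
    change Jm l φ (fun z => c * f z) (Tm l z) = c * Jm l φ f (Tm l z)
    unfold Jm
    rw [← integral_const_mul]
    refine integral_congr_ae (Filter.Eventually.of_forall ?_)
    intro w
    simp only; ring

theorem mol_apply (l : ℝ) (hl : l ≠ 0) (φ : KK) (f : SP) (z : EE) : mol l hl φ f z = Jm l φ f (Tm l z) := rfl

theorem D_mol1 (l : ℝ) (hl : l ≠ 0) (φ : KK) (f : SP) (v : EE) :
    D v (mol l hl φ f) = l⁻¹ • mol l hl (dK (Lm l v) φ) f := SP.ext' fun z => by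
  rw [D_apply, SP.smul_apply, mol_apply]
  change fderiv ℝ (fun z => Jm l φ f (Tm l z)) z v = _
  rw [Tm_fderiv l ((J_smooth hl φ (ct f)).differentiable (by simp)), J_fderiv hl φ (ct f)]

theorem D_mol2 (l : ℝ) (hl : l ≠ 0) (φ : KK) (f : SP) (v : EE) :
    D v (mol l hl φ f) = mol l hl φ (D (Lm l v) f) := SP.ext' fun z => by
  rw [D_mol1, SP.smul_apply, mol_apply, mol_apply, J_ibp φ (sm f), ← mul_assoc, inv_mul_cancel₀ hl, one_mul]
  rfl

theorem Lm_ee (l : ℝ) (j : Fin 3) : Lm l (ee j) = ee j := by simp [Lm, ee]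

theorem D_e0_mol (l : ℝ) (hl : l ≠ 0) (φ : KK) (f : SP) :
    D e0 (mol l hl φ f) = (1 - 2 * l) • mol l hl φ (D e0 f) := by
  rw [D_mol2, ← map_smul]
  congr 1
  apply SP.ext'; intro z
  have : Lm l e0 = (1 - 2 * l) • e0 := by simp [Lm, e0]
  rw [D_apply, this, map_smul]; rfl

theorem D_ee_mol (l : ℝ) (hl : l ≠ 0) (φ : KK) (f : SP) (j : Fin 3) :
    D (ee j) (mol l hl φ f) = mol l hl φ (D (ee j) f) := by
  rw [D_mol2, Lm_ee]

theorem Lm_norm {l : ℝ} (h0 : 0 < l) (h1 : l ≤ 1 / 4) {v : EE} (hv : ‖v‖ ≤ 1) : ‖Lm l v‖ ≤ 1 := by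
  rw [Lm, Prod.norm_def, max_le_iff]
  refine ⟨?_, (norm_snd_le v).trans hv⟩
  have := (norm_fst_le v).trans hv
  rw [norm_mul, Real.norm_of_nonneg (by linarith)]
  nlinarith [norm_nonneg v.1]

theorem Tm_mem {l : ℝ} (h0 : 0 < l) (h1 : l ≤ 1 / 4) {z w : EE} (hz : z ∈ Zs) (hw : ‖w‖ ≤ 1) : Tm l z - l • w ∈ Zs := by
  have h2 : |w.1| ≤ 1 := (norm_fst_le w).trans hw
  have h3 := hz.1
  have h4 := hz.2
  rw [abs_le] at h2
  simp only [Zs, Tm, Set.mem_setOf_eq, Set.mem_Icc, Prod.fst_sub, Prod.smul_fst, smul_eq_mul]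
  constructor <;> nlinarith

theorem Tm_dist {l : ℝ} (h0 : 0 < l) {z w : EE} (hz : z ∈ Zs) (hw : ‖w‖ ≤ 1) :
    ‖Tm l z - l • w - z‖ ≤ 2 * l := by
  have h2 : |w.1| ≤ 1 := (norm_fst_le w).trans hw
  have h3 := hz.1
  have h4 := hz.2
  have h5 : ‖w.2‖ ≤ 1 := (norm_snd_le w).trans hw
  rw [Prod.norm_def, max_le_iff]
  constructor
  · simp only [Tm, Prod.fst_sub, Prod.smul_fst, smul_eq_mul, Real.norm_eq_abs]
    rw [abs_le] at *
    constructor <;> nlinarith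
  · have : (Tm l z - l • w - z).2 = -(l • w.2) := by simp [Tm]
    rw [this, norm_neg, norm_smul, Real.norm_of_nonneg h0.le]
    nlinarith

theorem mol_le {l : ℝ} (h0 : 0 < l) (h1 : l ≤ 1 / 4) {φ : KK} (hφ : ∀ w, 0 ≤ φ w) (hi : ∫ w, φ w = 1) {f : SP} {X c : ℝ}
    {z : EE} (h : ∀ w, ‖w‖ ≤ 1 → |f (Tm l z - l • w) - c| ≤ X) : |mol l h0.ne' φ f z - c| ≤ X := by
  have hI : Integrable (φ : EE → ℝ) := (Kct φ).integrable_of_hasCompactSupport (Kcs φ)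
  have e : mol l h0.ne' φ f z - c = ∫ w, φ w * (f (Tm l z - l • w) - c) := by
    simp only [mul_sub]
    rw [integral_sub (J_int l φ (ct f) _) (hI.mul_const c), integral_mul_const, hi, one_mul]
    rfl
  rw [e]
  calc |∫ w, φ w * (f (Tm l z - l • w) - c)| ≤ ∫ w, φ w * X := by
        rw [← Real.norm_eq_abs]
        apply norm_integral_le_of_norm_le (hI.mul_const X)
        refine Filter.Eventually.of_forall fun w => ?_
        rw [norm_mul, Real.norm_of_nonneg (hφ w)]
        by_cases hw : ‖w‖ ≤ 1
        · exact mul_le_mul_of_nonneg_left (h w hw) (hφ w)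
        · rw [Kz φ (not_le.1 hw)]; simp
    _ = X := by rw [integral_mul_const, hi, one_mul]

theorem mol_bd0 {l : ℝ} (h0 : 0 < l) (h1 : l ≤ 1 / 4) {φ : KK} (hφ : ∀ w, 0 ≤ φ w) (hi : ∫ w, φ w = 1) {f : SP} {X : ℝ}
    (h : Bd 0 f X) : Bd 0 (mol l h0.ne' φ f) X := fun z hz => by
  have := mol_le h0 h1 hφ hi (f := f) (X := X) (c := 0) (z := z) (fun w hw => by
    rw [sub_zero]; exact h _ (Tm_mem h0 h1 hz hw))
  rwa [sub_zero] at this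

theorem mol_bd1 {l : ℝ} (h0 : 0 < l) (h1 : l ≤ 1 / 4) {φ : KK} (hφ : ∀ w, 0 ≤ φ w) (hi : ∫ w, φ w = 1) {f : SP} {X : ℝ}
    (h : Bd 1 f X) : Bd 1 (mol l h0.ne' φ f) X := by
  refine ⟨mol_bd0 h0 h1 hφ hi h.pred, fun v hv => ?_⟩
  rw [D_mol2]
  exact mol_bd0 h0 h1 hφ hi (h.d1 (Lm_norm h0 h1 hv))

theorem Zs_convex : Convex ℝ Zs := (convex_Icc (0 : ℝ) 1).linear_preimage (LinearMap.fst ℝ ℝ (Fin 3 → ℝ))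

theorem SP_lip {f : SP} {X : ℝ} (h : Bd 1 f X) {z z' : EE} (hz : z ∈ Zs) (hz' : z' ∈ Zs) : |f z' - f z| ≤ X * ‖z' - z‖ := by
  refine Zs_convex.norm_image_sub_le_of_norm_fderiv_le (𝕜 := ℝ) (f := f) (fun y _ => df f y) (fun y hy => ?_) hz hz'
  refine ContinuousLinearMap.opNorm_le_of_unit_norm h.nonneg fun v hv => ?_
  exact h.2 v hv.le y hy

theorem mol_close {l : ℝ} (h0 : 0 < l) (h1 : l ≤ 1 / 4) {φ : KK} (hφ : ∀ w, 0 ≤ φ w) (hi : ∫ w, φ w = 1) {f : SP} {X : ℝ}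
    (h : Bd 1 f X) {z : EE} (hz : z ∈ Zs) : |mol l h0.ne' φ f z - f z| ≤ X * (2 * l) := by
  apply mol_le h0 h1 hφ hi
  intro w hw
  refine (SP_lip h hz (Tm_mem h0 h1 hz hw)).trans ?_
  exact mul_le_mul_of_nonneg_left (Tm_dist h0 hz hw) h.nonneg

theorem mol_comm {l : ℝ} (h0 : 0 < l) (h1 : l ≤ 1 / 4) {φ : KK} (hφ : ∀ w, 0 ≤ φ w) (hi : ∫ w, φ w = 1) {f g : SP} {X : ℝ}
    (hf : Bd 1 f X) (hg : Bd 1 g X) {z : EE} (hz : z ∈ Zs) :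
    |mol l h0.ne' φ f z * mol l h0.ne' φ g z - mol l h0.ne' φ (f * g) z| ≤ 8 * l * X ^ 2 := by
  have hX := hf.nonneg
  have k1 := mol_close h0 h1 hφ hi (hf.mul hg) hz
  have k2 := mol_close h0 h1 hφ hi hf hz
  have k3 := mol_close h0 h1 hφ hi hg hz
  have k4 := mol_bd0 h0 h1 hφ hi hg.pred z hz
  have k5 := hf.zero z hz
  have e : mol l h0.ne' φ f z * mol l h0.ne' φ g z - mol l h0.ne' φ (f * g) z =
    (mol l h0.ne' φ f z - f z) * mol l h0.ne' φ g z + f z * (mol l h0.ne' φ g z - g z) -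
      (mol l h0.ne' φ (f * g) z - (f * g) z) := by rw [SP.mul_apply]; ring
  rw [e]
  have a1 : |(mol l h0.ne' φ f z - f z) * mol l h0.ne' φ g z| ≤ X * (2 * l) * X := by
    rw [abs_mul]; gcongr
  have a2 : |f z * (mol l h0.ne' φ g z - g z)| ≤ X * (X * (2 * l)) := by
    rw [abs_mul]; gcongr
  rw [pow_one] at k1
  rw [abs_le] at *
  constructor <;> linarith

end

noncomputable section
open MeasureTheory Real Matrix

theorem Kball (φ : KK) (F : EE → ℝ) : ∫ w, φ w * F w = ∫ w in Metric.closedBall (0 : EE) 1, φ w * F w := by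
  refine (setIntegral_eq_integral_of_forall_compl_eq_zero ?_).symm
  intro w hw
  rw [Metric.mem_closedBall, dist_zero_right, not_le] at hw
  rw [Kz φ hw, zero_mul]

theorem J_fub (l : ℝ) (φ : KK) {g : EE → ℝ} (hg : Continuous g) (hp : ∀ s, Per (fun x => g (s, x))) (y0 : ℝ) :
    ∫ x in dom, Jm l φ g (y0, x) = ∫ w, φ w * ∫ x in dom, g (y0 - l * w.1, x) := by
  unfold Jm
  simp only [Kball φ]
  rw [integral_integral_swap]
  · refine integral_congr_ae (Filter.Eventually.of_forall ?_)
    intro w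
    simp only
    rw [integral_const_mul]
    congr 1
    rw [← dom_shift (f := fun x => g (y0 - l * w.1, x)) (by fun_prop) (hp _) (- (l • w.2))]
    refine integral_congr_ae (Filter.Eventually.of_forall ?_)
    intro x
    simp only
    refine congrArg g (Prod.ext ?_ ?_)
    · simp
    · simp [sub_eq_add_neg]
  · rw [Measure.prod_restrict]
    have : Continuous (Function.uncurry fun (x : Fin 3 → ℝ) (w : EE) => φ w * g ((y0, x) - l • w)) := by
      have h1 := Kct φ
      unfold Function.uncurry
      fun_prop
    exact this.continuousOn.integrableOn_compact (dom_compact.prod (isCompact_closedBall _ _))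

theorem mol_mean (l : ℝ) (hl : l ≠ 0) (φ : KK) {f : SP} (h : ∀ t, ∫ x in dom, f (t, x) = 0) (t : ℝ) :
    ∫ x in dom, mol l hl φ f (t, x) = 0 := by
  simp only [mol_apply, Tm]
  rw [J_fub l φ (ct f) (SPper f)]
  simp [h]

theorem mol_L1 {l : ℝ} (h0 : 0 < l) (h1 : l ≤ 1 / 4) {φ : KK} (hφ : ∀ w, 0 ≤ φ w) (hi : ∫ w, φ w = 1) {f : SP} {σ : ℝ}
    (h : ∀ t ∈ Set.Icc (0 : ℝ) 1, ∫ x in dom, |f (t, x)| ≤ σ) {t : ℝ} (ht : t ∈ Set.Icc (0 : ℝ) 1) :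
    ∫ x in dom, |mol l h0.ne' φ f (t, x)| ≤ σ := by
  have hI : Integrable (φ : EE → ℝ) := (Kct φ).integrable_of_hasCompactSupport (Kcs φ)
  have hc : Continuous (fun z => |f z|) := (ct f).abs
  have hp : ∀ s, Per (fun x => |f (s, x)|) := fun s x i => congrArg _ (pe f s x i)
  calc ∫ x in dom, |mol l h0.ne' φ f (t, x)| ≤ ∫ x in dom, Jm l φ (fun z => |f z|) (l + (1 - 2 * l) * t, x) := by
        refine setIntegral_mono_on (contIntOn (SPcont _ t).abs) (contIntOn ?_) dom_meas ?_
        · exact (J_smooth h0.ne' φ hc).continuous.comp (by fun_prop)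
        · intro x _
          rw [mol_apply]
          unfold Jm
          rw [← Real.norm_eq_abs]
          refine norm_integral_le_of_norm_le (J_int l φ hc _) (Filter.Eventually.of_forall fun w => ?_)
          rw [norm_mul, Real.norm_of_nonneg (hφ w)]; rfl
    _ = ∫ w, φ w * ∫ x in dom, |f (l + (1 - 2 * l) * t - l * w.1, x)| := J_fub l φ hc hp _
    _ ≤ ∫ w, φ w * σ := by
        rcases em (Integrable fun w => φ w * ∫ x in dom, |f (l + (1 - 2 * l) * t - l * w.1, x)|) with hJ | hJ
        · refine integral_mono hJ (hI.mul_const σ) fun w => ?_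
          simp only
          by_cases hw : ‖w‖ ≤ 1
          · refine mul_le_mul_of_nonneg_left (h _ ?_) (hφ w)
            exact Tm_mem h0 h1 (z := (t, 0)) ht hw
          · rw [Kz φ (not_le.1 hw)]; simp
        · rw [integral_undef hJ, integral_mul_const, hi, one_mul]
          exact (integral_nonneg fun _ => abs_nonneg _).trans (h t ht)
    _ = σ := by rw [integral_mul_const, hi, one_mul]

theorem ball_int {l : ℝ} (h0 : 0 < l) (h1 : l ≤ 1 / 4) {h : (Fin 3 → ℝ) → ℝ} (hc : Continuous h) (hp : Per h) (hn : ∀ x, 0 ≤ h x)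
    {σ : ℝ} (hs : ∫ x in dom, h x ≤ σ) (x : Fin 3 → ℝ) :
    ∫ y in Metric.closedBall (0 : Fin 3 → ℝ) 1, h (x - l • y) ≤ (l ^ 3)⁻¹ * σ := by
  have e := Measure.setIntegral_comp_smul volume (fun y => h (y + x)) (R := -l) (Metric.closedBall (0 : Fin 3 → ℝ) 1) (by linarith)
  have e2 : ∀ y, h (-l • y + x) = h (x - l • y) := fun y => by congr 1; rw [neg_smul]; abel
  simp only [e2] at e
  rw [e]
  simp only [Module.finrank_fintype_fun_eq_card, Fintype.card_fin, smul_eq_mul]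
  have e3 : |((-l) ^ 3)⁻¹| = (l ^ 3)⁻¹ := by
    rw [abs_inv, abs_pow, abs_neg, abs_of_pos h0]
  rw [e3]
  refine mul_le_mul_of_nonneg_left ?_ (by positivity)
  rw [← dom_shift hc hp x] at hs
  refine le_trans ?_ hs
  refine setIntegral_mono_set (contIntOn (by fun_prop)) (Filter.Eventually.of_forall fun y => hn _) (Filter.Eventually.of_forall ?_)
  rintro _ ⟨y, hy, rfl⟩
  rw [Metric.mem_closedBall, dist_zero_right] at hy
  simp only [dom]
  have hpi := pi_gt_three
  have : ∀ i, |(-l • y) i| ≤ 1 := fun i => by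
    rw [Pi.smul_apply, smul_eq_mul, abs_mul, abs_neg, abs_of_pos h0]
    have := (norm_le_pi_norm y i).trans hy
    rw [Real.norm_eq_abs] at this
    nlinarith [abs_nonneg (y i)]
  refine ⟨fun i => ?_, fun i => ?_⟩
  · have := (abs_le.1 (this i)).1; simp only at *; linarith
  · have := (abs_le.1 (this i)).2; simp only at *; linarith

theorem mol_sup {l : ℝ} (h0 : 0 < l) (h1 : l ≤ 1 / 4) {ψ : KK} {Y : ℝ} (hY : ∀ w, |ψ w| ≤ Y) {f : SP} {σ : ℝ}
    (h : ∀ t ∈ Set.Icc (0 : ℝ) 1, ∫ x in dom, |f (t, x)| ≤ σ) : Bd 0 (mol l h0.ne' ψ f) (Y * (2 * ((l ^ 3)⁻¹ * σ))) := by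
  intro z hz
  have hY0 : 0 ≤ Y := (abs_nonneg _).trans (hY 0)
  have hc : Continuous (fun z => |f z|) := (ct f).abs
  have hp : ∀ s, Per (fun x => |f (s, x)|) := fun s x i => congrArg _ (pe f s x i)
  have hball : Metric.closedBall (0 : EE) 1 = Metric.closedBall (0 : ℝ) 1 ×ˢ Metric.closedBall (0 : Fin 3 → ℝ) 1 :=
    (closedBall_prod_same _ _ _).symm
  have hIf : IntegrableOn (fun w => |f (Tm l z - l • w)|) (Metric.closedBall (0 : EE) 1) :=
    (hc.comp (by fun_prop : Continuous fun w : EE => Tm l z - l • w)).continuousOn.integrableOn_compact (isCompact_closedBall _ _)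
  rw [mol_apply]
  unfold Jm
  rw [Kball, ← Real.norm_eq_abs]
  calc ‖∫ w in Metric.closedBall (0 : EE) 1, ψ w * f (Tm l z - l • w)‖
      ≤ ∫ w in Metric.closedBall (0 : EE) 1, Y * |f (Tm l z - l • w)| := by
        refine norm_integral_le_of_norm_le (hIf.const_mul Y) (Filter.Eventually.of_forall fun w => ?_)
        rw [norm_mul]
        exact mul_le_mul_of_nonneg_right (hY w) (abs_nonneg _)
    _ = Y * ∫ w in Metric.closedBall (0 : EE) 1, |f (Tm l z - l • w)| := integral_const_mul _ _
    _ ≤ Y * (2 * ((l ^ 3)⁻¹ * σ)) := by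
        refine mul_le_mul_of_nonneg_left ?_ hY0
        rw [hball] at hIf ⊢
        rw [Measure.volume_eq_prod] at hIf ⊢
        rw [setIntegral_prod _ hIf]
        have key : ∀ s ∈ Metric.closedBall (0 : ℝ) 1, 
            ∫ y in Metric.closedBall (0 : Fin 3 → ℝ) 1, |f (Tm l z - l • (s, y))| ≤ (l ^ 3)⁻¹ * σ := fun s hs => by
          have := ball_int h0 h1 (h := fun x => |f ((Tm l z).1 - l * s, x)|) (SPcont f _).abs (hp _) (fun _ => abs_nonneg _)
            (σ := σ) (h _ ?_) (Tm l z).2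
          · exact this
          · rw [Metric.mem_closedBall, dist_zero_right] at hs
            exact Tm_mem h0 h1 hz (w := (s, 0)) (by rw [Prod.norm_def]; simpa using hs)
        calc _ ≤ ∫ s in Metric.closedBall (0 : ℝ) 1, (l ^ 3)⁻¹ * σ := by
              refine setIntegral_mono_on ?_ (continuousOn_const.integrableOn_compact (isCompact_closedBall _ _)) measurableSet_closedBall key
              rw [IntegrableOn, ← Measure.prod_restrict] at hIf
              exact hIf.integral_prod_left
          _ = _ := by
              rw [setIntegral_const, Measure.real, Real.volume_closedBall]
              simp

theorem mol_bdn (n : ℕ) {l : ℝ} (h0 : 0 < l) (h1 : l ≤ 1 / 4) {ψ : KK} {Y : ℝ} (hY : KB n ψ Y) {f : SP} {σ : ℝ}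
    (h : ∀ t ∈ Set.Icc (0 : ℝ) 1, ∫ x in dom, |f (t, x)| ≤ σ) :
    Bd n (mol l h0.ne' ψ f) ((l⁻¹) ^ n * (Y * (2 * ((l ^ 3)⁻¹ * σ)))) := by
  have hσ : 0 ≤ σ := (integral_nonneg fun _ => abs_nonneg _).trans (h 0 (by simp))
  induction n generalizing ψ with
  | zero => simpa using mol_sup h0 h1 hY h
  | succ n ih =>
    have hY0 := hY.nonneg
    have hl : 1 ≤ l⁻¹ := (one_le_inv₀ h0).2 (by linarith)
    refine ⟨?_, fun v hv => ?_⟩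
    · have := (mol_sup h0 h1 hY.zero h).mono (Y := (l⁻¹) ^ (n + 1) * (Y * (2 * ((l ^ 3)⁻¹ * σ)))) ?_
      · exact this
      · exact le_mul_of_one_le_left (by positivity) (one_le_pow₀ hl)
    · rw [D_mol1]
      refine ((ih (hY.2 _ (Lm_norm h0 h1 hv))).smul l⁻¹).mono (le_of_eq ?_)
      rw [abs_of_nonneg (by positivity)]; ring

end

noncomputable section
open MeasureTheory Real Matrix

theorem D_smul' (v : EE) (c : ℝ) (f : SP) : D v (c • f) = c • D v f := map_smul _ _ _

theorem mol_sys (l : ℝ) (hl : l ≠ 0) (φ : KK) {u B : Fin 3 → SP} {p : SP} {R Q : Fin 3 → Fin 3 → SP}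
    (h : SPsol u B p R Q) (s : ℝ) (hs : s = 1 - 2 * l) :
    SPsol (fun i => s • mol l hl φ (u i)) (fun i => s • mol l hl φ (B i)) (s ^ 2 • mol l hl φ p)
      (fun i j => s ^ 2 • mol l hl φ (R i j) + ((s • mol l hl φ (u i)) * (s • mol l hl φ (u j))
        - (s • mol l hl φ (B i)) * (s • mol l hl φ (B j)) - s ^ 2 • mol l hl φ (u i * u j - B i * B j)))
      (fun i j => s ^ 2 • mol l hl φ (Q i j) + ((s • mol l hl φ (u i)) * (s • mol l hl φ (B j))
        - (s • mol l hl φ (B i)) * (s • mol l hl φ (u j)) - s ^ 2 • mol l hl φ (u i * B j - B i * u j))) where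
  du := by
    simp only [D_smul', D_ee_mol]
    rw [← Finset.smul_sum, ← map_sum, h.du, map_zero, smul_zero]
  dB := by
    simp only [D_smul', D_ee_mol]
    rw [← Finset.smul_sum, ← map_sum, h.dB, map_zero, smul_zero]
  mu t i := by
    simp only [SP.smul_apply]
    rw [integral_const_mul, mol_mean l hl φ (fun t => h.mu t i), mul_zero]
  mB t i := by
    simp only [SP.smul_apply]
    rw [integral_const_mul, mol_mean l hl φ (fun t => h.mB t i), mul_zero]
  sR i j := by
    rw [h.sR i j, mul_comm (u i), mul_comm (B i), mul_comm (s • mol l hl φ (u i)), mul_comm (s • mol l hl φ (B i))]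
  sQ i j := by
    have : u i * B j - B i * u j = - (u j * B i - B j * u i) := by ring
    rw [h.sQ i j, this, map_neg, map_neg, smul_neg, smul_neg]
    ring
  mom i := by
    have := congrArg (fun f => s ^ 2 • mol l hl φ f) (h.mom i)
    simp only [map_add, map_sum, smul_add, Finset.smul_sum] at this
    simp only [map_add, map_sub, D_smul', D_ee_mol, D_e0_mol, ← hs, Finset.sum_add_distrib, Finset.sum_sub_distrib, smul_smul, smul_sub] at this ⊢
    rw [← this, pow_two]
    abel
  ind i := by
    have := congrArg (fun f => s ^ 2 • mol l hl φ f) (h.ind i)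
    simp only [map_add, map_sum, smul_add, Finset.smul_sum] at this
    simp only [map_add, map_sub, D_smul', D_ee_mol, D_e0_mol, ← hs, Finset.sum_add_distrib, Finset.sum_sub_distrib, smul_smul, smul_sub] at this ⊢
    rw [← this, pow_two]
    abel

theorem step_SP : ∃ C : ℝ, 1 ≤ C ∧ ∃ K : ℕ, ∀ M : ℕ, 2 ≤ M → ∀ (l Y X σ : ℝ) (u B : Fin 3 → SP) (p : SP)
    (R Q : Fin 3 → Fin 3 → SP), 0 < l → l ≤ 1 / 4 → 1 ≤ X → Y ≤ X → σ ≤ 1 → C * l⁻¹ ^ 6 ≤ X → 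
    SPsol u B p R Q → (∀ i, Bd 1 (u i) Y) → (∀ i, Bd 1 (B i) Y) → 
    (∀ t ∈ Set.Icc (0 : ℝ) 1, ∀ i j, ∫ x in dom, |R i j (t, x)| ≤ σ) →
    (∀ t ∈ Set.Icc (0 : ℝ) 1, ∀ i j, ∫ x in dom, |Q i j (t, x)| ≤ σ) →
    ∃ (u' B' : Fin 3 → SP) (p' : SP) (R' Q' : Fin 3 → Fin 3 → SP),
      SPsol u' B' p' R' Q' ∧ ∑ i, R' i i = 0 ∧
      (∀ i, Bd 1 (u' i) (Y + C * X ^ K * M ^ 4)) ∧ (∀ i, Bd 1 (B' i) (Y + C * X ^ K * M ^ 4)) ∧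
      (∀ t ∈ Set.Icc (0 : ℝ) 1, ∀ i j, ∫ x in dom, |R' i j (t, x)| ≤ C * (l * Y ^ 2) + C * X ^ K / M) ∧
      (∀ t ∈ Set.Icc (0 : ℝ) 1, ∀ i j, ∫ x in dom, |Q' i j (t, x)| ≤ C * (l * Y ^ 2) + C * X ^ K / M) ∧
      (∀ t ∈ Set.Icc (0 : ℝ) 1, ∀ i, ∫ x in dom, (u' i (t, x) - u i (t, x)) ^ 2 ≤ 
        C * (l * Y) ^ 2 + C * (σ + 1 / X ^ 2) + C * X ^ K / M) ∧
      (∀ t ∈ Set.Icc (0 : ℝ) 1, ∀ i, ∫ x in dom, (B' i (t, x) - B i (t, x)) ^ 2 ≤ 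
        C * (l * Y) ^ 2 + C * (σ + 1 / X ^ 2) + C * X ^ K / M) := by
  obtain ⟨C, hC, K, hP⟩ := perturb
  obtain ⟨φ, hφ, hi⟩ := exists_ker
  obtain ⟨Yφ, hYφ⟩ := exists_KB 3 φ
  have hYφ0 := hYφ.nonneg
  refine ⟨16 * C + 32 * (2 * π) ^ 3 + 2 * Yφ, by nlinarith [pow_pos two_pi_pos 3], K, ?_⟩
  intro M hM l Y X σ u B p R Q h0 h1 hX hYX hσ hlX hsol hu hB hR hQ
  have hpi : 0 < (2 * π) ^ 3 := by positivity
  have hY0 : 0 ≤ Y := (hu 0).nonneg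
  have hl : 0 < l⁻¹ ^ 6 := by positivity
  have hσ0 : 0 ≤ σ := (integral_nonneg fun _ => abs_nonneg _).trans (hR 0 (by simp) 0 0)
  set m := mol l h0.ne' φ with hm
  set s := 1 - 2 * l with hs
  have hs0 : 0 ≤ s := by linarith
  have hs1 : s ≤ 1 := by linarith
  have hs2 : s ^ 2 ≤ 1 := pow_le_one₀ hs0 hs1
  have hM0 : (0 : ℝ) < M := by positivity
  have bd3 : ∀ f : SP, (∀ t ∈ Set.Icc (0 : ℝ) 1, ∫ x in dom, |f (t, x)| ≤ σ) → Bd 3 (s ^ 2 • m f) X := fun f hf => by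
    refine ((mol_bdn 3 h0 h1 hYφ hf).smul (s ^ 2)).mono ?_
    rw [abs_of_nonneg (by positivity)]
    have e : l⁻¹ ^ 3 * (Yφ * (2 * ((l ^ 3)⁻¹ * σ))) = 2 * Yφ * l⁻¹ ^ 6 * σ := by
      rw [← inv_pow]; ring
    rw [e]
    have e1 : 2 * Yφ * l⁻¹ ^ 6 * σ ≤ 2 * Yφ * l⁻¹ ^ 6 * 1 := by gcongr
    have e2 : 0 ≤ 2 * Yφ * l⁻¹ ^ 6 * σ := by positivity
    have e3 : 0 ≤ (16 * C + 32 * (2 * π) ^ 3) * l⁻¹ ^ 6 := by positivity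
    nlinarith
  have l1 : ∀ f : SP, (∀ t ∈ Set.Icc (0 : ℝ) 1, ∫ x in dom, |f (t, x)| ≤ σ) → ∀ t ∈ Set.Icc (0 : ℝ) 1, 
      ∫ x in dom, |(s ^ 2 • m f) (t, x)| ≤ σ := fun f hf t ht => by
    have := mol_L1 h0 h1 hφ hi hf ht
    simp only [SP.smul_apply, abs_mul]
    rw [integral_const_mul, abs_of_nonneg (by positivity)]
    have e : 0 ≤ ∫ x in dom, |m f (t, x)| := integral_nonneg fun _ => abs_nonneg _
    nlinarith
  have b1 : ∀ f : SP, Bd 1 f Y → Bd 1 (s • m f) Y := fun f hf => by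
    refine ((mol_bd1 h0 h1 hφ hi hf).smul s).mono ?_
    rw [abs_of_nonneg hs0]; nlinarith
  have cl : ∀ f : SP, Bd 1 f Y → ∀ z ∈ Zs, |(s • m f) z - f z| ≤ 4 * (l * Y) := fun f hf z hz => by
    have k1 := mol_close h0 h1 hφ hi hf hz
    have k2 := mol_bd0 h0 h1 hφ hi hf.pred z hz
    have e : (s • m f) z - f z = (m f z - f z) - 2 * l * m f z := by rw [SP.smul_apply, hs]; ring
    rw [e]
    have k3 : |2 * l * m f z| ≤ 2 * l * Y := by rw [abs_mul, abs_of_pos (by linarith)]; gcongr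
    refine (abs_sub _ _).trans ?_
    linarith
  have cm : ∀ f g f' g' : SP, Bd 1 f Y → Bd 1 g Y → Bd 1 f' Y → Bd 1 g' Y → ∀ z ∈ Zs, 
      |((s • m f) * (s • m g) - (s • m f') * (s • m g') - s ^ 2 • m (f * g - f' * g')) z| ≤ 16 * (l * Y ^ 2) := fun f g f' g' hf hg hf' hg' z hz => by
    have k1 := mol_comm h0 h1 hφ hi hf hg hz
    have k2 := mol_comm h0 h1 hφ hi hf' hg' hz
    have e : ((s • m f) * (s • m g) - (s • m f') * (s • m g') - s ^ 2 • m (f * g - f' * g')) z = 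
      s ^ 2 * ((m f z * m g z - m (f * g) z) - (m f' z * m g' z - m (f' * g') z)) := by
      rw [map_sub]
      simp only [SP.sub_apply, SP.mul_apply, SP.smul_apply]; ring
    rw [e, abs_mul, abs_of_nonneg (by positivity)]
    have k3 := (abs_sub _ _).trans (add_le_add k1 k2)
    have k4 := abs_nonneg (m f z * m g z - m (f * g) z - (m f' z * m g' z - m (f' * g') z))
    nlinarith
  have sys := mol_sys l h0.ne' φ hsol s hs
  let d : AD := ⟨X, hX, fun i j => s ^ 2 • m (R i j), fun i j => s ^ 2 • m (Q i j), fun i j => by simp only [hsol.sR i j], 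
    fun i j => by simp only [hsol.sQ i j, map_neg, smul_neg], fun i j => bd3 _ fun t ht => hR t ht i j, 
    fun i j => bd3 _ fun t ht => hQ t ht i j⟩
  obtain ⟨v, w, p', R', Q', q1, q2, q3, q4, q5, q6, q7, q8⟩ := hP M hM d _ _ _ _ _ (16 * (l * Y ^ 2)) σ sys
    (fun i => (b1 _ (hu i)).pred.mono hYX) (fun i => (b1 _ (hB i)).pred.mono hYX)
    (fun z hz i j => cm _ _ _ _ (hu i) (hu j) (hB i) (hB j) z hz)
    (fun z hz i j => cm _ _ _ _ (hu i) (hB j) (hB i) (hu j) z hz)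
    (fun t ht i j => l1 _ (fun t ht => hR t ht i j) t ht) (fun t ht i j => l1 _ (fun t ht => hQ t ht i j) t ht)
  change ∀ i, Bd 1 (v i) (C * X ^ K * M ^ 4) at q3
  change ∀ i, Bd 1 (w i) (C * X ^ K * M ^ 4) at q4
  have hXK : 0 ≤ X ^ K := by positivity
  have hXM : 0 ≤ X ^ K / M := by positivity
  have hCC : C ≤ 16 * C + 32 * (2 * π) ^ 3 + 2 * Yφ := by linarith
  have hE : ∀ f g : SP, Bd 1 f Y → (∀ t ∈ Set.Icc (0 : ℝ) 1, ∫ x in dom, g (t, x) ^ 2 ≤ C * (σ + 1 / X ^ 2) + C * X ^ K / M) →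
     ∀ t ∈ Set.Icc (0 : ℝ) 1, ∫ x in dom, ((s • m f + g) (t, x) - f (t, x)) ^ 2 ≤ (16 * C + 32 * (2 * π) ^ 3 + 2 * Yφ) * (l * Y) ^ 2 + (16 * C + 32 * (2 * π) ^ 3 + 2 * Yφ) * (σ + 1 / X ^ 2) + (16 * C + 32 * (2 * π) ^ 3 + 2 * Yφ) * X ^ K / M := by
    intro f g hf hg t ht
    have k1 : ∫ x in dom, ((s • m f + g) (t, x) - f (t, x)) ^ 2 ≤ ∫ x in dom, (32 * (l * Y) ^ 2 * 1 + 2 * g (t, x) ^ 2) := by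
      refine setIntegral_mono_on (contIntOn ?_) (contIntOn ?_) dom_meas fun x _ => ?_
      · exact ((SPcont _ t).sub (SPcont f t)).pow 2
      · exact continuous_const.add (((SPcont g t).pow 2).const_mul 2)
      · have := cl f hf (t, x) ht
        rw [SP.add_apply]
        have := sq_le_sq' (abs_le.1 this).1 (abs_le.1 this).2
        nlinarith [sq_nonneg ((s • m f) (t, x) - f (t, x) - g (t, x))]
    have kg : Continuous fun x => 2 * g (t, x) ^ 2 := ((SPcont g t).pow 2).const_mul 2
    rw [integral_add (contIntOn continuous_const) (contIntOn kg), integral_const_mul, integral_const_mul, dom_vol] at k1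
    have k2 := hg t ht
    have e1 : 0 ≤ (l * Y) ^ 2 := by positivity
    have e2 : 0 ≤ σ + 1 / X ^ 2 := by positivity
    have e3 : C * X ^ K / M = C * (X ^ K / M) := by ring
    have e4 : (16 * C + 32 * (2 * π) ^ 3 + 2 * Yφ) * X ^ K / M = (16 * C + 32 * (2 * π) ^ 3 + 2 * Yφ) * (X ^ K / M) := by ring
    rw [e4]; rw [e3] at k2
    have f1 : 32 * (2 * π) ^ 3 * (l * Y) ^ 2 ≤ (16 * C + 32 * (2 * π) ^ 3 + 2 * Yφ) * (l * Y) ^ 2 := by gcongr; linarith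
    have f2 : 2 * C * (σ + 1 / X ^ 2) ≤ (16 * C + 32 * (2 * π) ^ 3 + 2 * Yφ) * (σ + 1 / X ^ 2) := by gcongr; linarith
    have f3 : 2 * C * (X ^ K / M) ≤ (16 * C + 32 * (2 * π) ^ 3 + 2 * Yφ) * (X ^ K / M) := by gcongr; linarith
    linarith
  have hF : C * (16 * (l * Y ^ 2)) + C * X ^ K / M ≤ (16 * C + 32 * (2 * π) ^ 3 + 2 * Yφ) * (l * Y ^ 2) + (16 * C + 32 * (2 * π) ^ 3 + 2 * Yφ) * X ^ K / M := by
    have e1 : 0 ≤ l * Y ^ 2 := by positivity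
    have f1 : 16 * C * (l * Y ^ 2) ≤ (16 * C + 32 * (2 * π) ^ 3 + 2 * Yφ) * (l * Y ^ 2) := by gcongr; linarith
    have f2 : C * X ^ K / M ≤ (16 * C + 32 * (2 * π) ^ 3 + 2 * Yφ) * X ^ K / M := by gcongr
    linarith
  have hG : Y + C * X ^ K * M ^ 4 ≤ Y + (16 * C + 32 * (2 * π) ^ 3 + 2 * Yφ) * X ^ K * M ^ 4 := by gcongr
  exact ⟨_, _, p', R', Q', q1, q2, fun i => ((b1 _ (hu i)).add (q3 i)).mono hG, fun i => ((b1 _ (hB i)).add (q4 i)).mono hG,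
    fun t ht i j => (q5 t ht i j).trans hF, fun t ht i j => (q6 t ht i j).trans hF, 
    fun t ht i => hE _ _ (hu i) (fun t ht => q7 t ht i) t ht, fun t ht i => hE _ _ (hB i) (fun t ht => q8 t ht i) t ht⟩

end

noncomputable section
open MeasureTheory Real Matrix

theorem per_red {f : (Fin 3 → ℝ) → ℝ} (hp : Per f) (i : Fin 3) (x : Fin 3 → ℝ) :
    ∃ s ∈ Set.Icc (-π) π, f (Function.update x i s) = f x := by
  have hper : Function.Periodic (fun s => f (Function.update x i s)) (2 * π) := by
    intro s
    simp only
    rw [← hp (Function.update x i s) i]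
    congr 1
    funext j
    by_cases h : j = i
    · subst h; simp
    · simp [h]
  obtain ⟨y, hy, e⟩ := hper.exists_mem_Ico two_pi_pos (x i) (-π)
  refine ⟨y, ⟨hy.1, by linarith [hy.2]⟩, ?_⟩
  rw [← e]; simp

theorem per_dom {f : (Fin 3 → ℝ) → ℝ} (hp : Per f) (x : Fin 3 → ℝ) : ∃ y ∈ dom, f y = f x := by
  obtain ⟨a, ha, e0⟩ := per_red hp 0 x
  obtain ⟨b, hb, e1⟩ := per_red hp 1 (Function.update x 0 a)
  obtain ⟨c, hc, e2⟩ := per_red hp 2 (Function.update (Function.update x 0 a) 1 b)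
  refine ⟨_, ?_, e2.trans (e1.trans e0)⟩
  simp only [dom, Set.mem_Icc, Pi.le_def] at *
  constructor
  · intro i; fin_cases i <;> simp [Function.update] <;> linarith
  · intro i; fin_cases i <;> simp [Function.update] <;> linarith

theorem exists_Bd0 (f : SP) : ∃ X, Bd 0 f X := by
  obtain ⟨X, hX⟩ := ((isCompact_Icc (a := (0 : ℝ)) (b := 1)).prod dom_compact).exists_bound_of_continuousOn (ct f).continuousOn
  refine ⟨X, fun z hz => ?_⟩
  obtain ⟨y, hy, e⟩ := per_dom (SPper f z.1) z.2
  have := hX (z.1, y) ⟨hz, hy⟩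
  rw [Real.norm_eq_abs] at this
  change f (z.1, y) = f z at e
  rwa [e] at this

theorem enormV_le {v : Fin 3 → ℝ} {W : ℝ} (h : ∀ i, |v i| ≤ W) : enormV v ≤ 2 * W := by
  have hW : 0 ≤ W := (abs_nonneg _).trans (h 0)
  refine Real.sqrt_le_iff.2 ⟨by positivity, ?_⟩
  calc ∑ i, v i ^ 2 ≤ ∑ i : Fin 3, W ^ 2 := Finset.sum_le_sum fun i _ => by
        rw [← sq_abs]; exact pow_le_pow_left₀ (abs_nonneg _) (h i) 2
    _ ≤ _ := by simp; nlinarith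

theorem le_enormV (v : Fin 3 → ℝ) (i : Fin 3) : |v i| ≤ enormV v := by
  rw [← Real.sqrt_sq_eq_abs]
  exact Real.sqrt_le_sqrt (Finset.single_le_sum (f := fun i => v i ^ 2) (fun i _ => sq_nonneg _) (Finset.mem_univ i))

theorem le_enormM (A : Matrix (Fin 3) (Fin 3) ℝ) (i j : Fin 3) : |A i j| ≤ enormM A := by
  rw [← Real.sqrt_sq_eq_abs]
  refine Real.sqrt_le_sqrt ?_
  exact (Finset.single_le_sum (f := fun j => A i j ^ 2) (fun i _ => sq_nonneg _) (Finset.mem_univ j)).trans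
    (Finset.single_le_sum (f := fun i => ∑ j, A i j ^ 2) (fun i _ => Finset.sum_nonneg fun j _ => sq_nonneg _) (Finset.mem_univ i))

theorem sqrt_le_W {A : Fin 3 → Fin 3 → ℝ} {W : ℝ} (h : ∀ i j, |A i j| ≤ W) : Real.sqrt (∑ i, ∑ j, A i j ^ 2) ≤ 3 * W := by
  have hW : 0 ≤ W := (abs_nonneg _).trans (h 0 0)
  refine Real.sqrt_le_iff.2 ⟨by positivity, ?_⟩
  calc ∑ i, ∑ j, A i j ^ 2 ≤ ∑ i : Fin 3, ∑ j : Fin 3, W ^ 2 := Finset.sum_le_sum fun i _ => Finset.sum_le_sum fun j _ => by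
        rw [← sq_abs]; exact pow_le_pow_left₀ (abs_nonneg _) (h i j) 2
    _ ≤ _ := by simp; nlinarith

theorem enormM_le (A : Matrix (Fin 3) (Fin 3) ℝ) : enormM A ≤ ∑ i, ∑ j, |A i j| := by
  refine Real.sqrt_le_iff.2 ⟨Finset.sum_nonneg fun i _ => Finset.sum_nonneg fun j _ => abs_nonneg _, ?_⟩
  calc ∑ i, ∑ j, A i j ^ 2 = ∑ i, ∑ j, |A i j| ^ 2 := by simp
    _ ≤ ∑ i, (∑ j, |A i j|) ^ 2 := Finset.sum_le_sum fun i _ => Finset.sum_sq_le_sq_sum_of_nonneg fun j _ => abs_nonneg _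
    _ ≤ _ := Finset.sum_sq_le_sq_sum_of_nonneg fun i _ => Finset.sum_nonneg fun j _ => abs_nonneg _

/-- from field to algebra elements -/
def toF (us : Fin 3 → SP) : ℝ → (Fin 3 → ℝ) → (Fin 3 → ℝ) := fun t x i => us i (t, x)
def toM (R : Fin 3 → Fin 3 → SP) : ℝ → (Fin 3 → ℝ) → Matrix (Fin 3) (Fin 3) ℝ := fun t x i j => R i j (t, x)
def toS (p : SP) : ℝ → (Fin 3 → ℝ) → ℝ := fun t x => p (t, x)

theorem toF_pd (us : Fin 3 → SP) (j i : Fin 3) (t : ℝ) (x : Fin 3 → ℝ) : pd j (fun y => toF us t y i) x = D (ee j) (us i) (t, x) :=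
  pd_eq _ _ _ _
theorem toM_pd (R : Fin 3 → Fin 3 → SP) (k i j : Fin 3) (t : ℝ) (x : Fin 3 → ℝ) : pd k (fun y => toM R t y i j) x = D (ee k) (R i j) (t, x) :=
  pd_eq _ _ _ _
theorem toF_dt (us : Fin 3 → SP) (i : Fin 3) (t : ℝ) (x : Fin 3 → ℝ) : deriv (fun s => toF us s x i) t = D e0 (us i) (t, x) :=
  derivt_eq _ _ _

theorem sys_iff (u B : Fin 3 → SP) (p : SP) (R Q : Fin 3 → Fin 3 → SP) :
    RelaxedMHDSolution (toF u) (toF B) (toS p) (toM R) (toM Q) ↔ SPsol u B p R Q ∧ ∑ i, R i i = 0 := by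
  have em : ∀ t x i j, pd j (fun y => toF u t y i * toF u t y j - toF B t y i * toF B t y j) x =
    D (ee j) (u i * u j - B i * B j) (t, x) := fun t x i j => pd_eq (u i * u j - B i * B j) j t x
  have ei : ∀ t x i j, pd j (fun y => toF u t y i * toF B t y j - toF B t y i * toF u t y j) x =
    D (ee j) (u i * B j - B i * u j) (t, x) := fun t x i j => pd_eq (u i * B j - B i * u j) j t x
  have ep : ∀ t x i, pd i (toS p t) x = D (ee i) p (t, x) := fun t x i => pd_eq p i t x
  constructor
  · rintro ⟨-, -, -, -, -, -, -, -, -, -, h1, h2, h3, h4, h5, h6, h7, h8, h9⟩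
    simp only [toF_pd, toM_pd, toF_dt, em, ei, ep] at h1 h2 h8 h9
    refine ⟨⟨?_, ?_, h3, h4, ?_, ?_, ?_, ?_⟩, ?_⟩
    · apply SP.ext'; rintro ⟨t, x⟩
      rw [SP.sum_apply]; exact h1 t x
    · apply SP.ext'; rintro ⟨t, x⟩
      rw [SP.sum_apply]; exact h2 t x
    · intro i j; apply SP.ext'; rintro ⟨t, x⟩
      exact (congrFun (congrFun (h5 t x) j) i)
    · intro i j; apply SP.ext'; rintro ⟨t, x⟩
      exact (congrFun (congrFun (h7 t x) j) i)
    · intro i; apply SP.ext'; rintro ⟨t, x⟩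
      simpa only [SP.sum_apply, SP.add_apply] using h8 t x i
    · intro i; apply SP.ext'; rintro ⟨t, x⟩
      simpa only [SP.sum_apply, SP.add_apply] using h9 t x i
    · apply SP.ext'; rintro ⟨t, x⟩
      rw [SP.sum_apply]; exact h6 t x
  · rintro ⟨h, ht⟩
    refine ⟨fun i => sm _, fun i => sm _, sm _, fun i j => sm _, fun i j => sm _, fun t i x j => pe _ _ _ _, fun t i x j => pe _ _ _ _, 
      fun t x j => pe _ _ _ _, fun t i j x k => pe _ _ _ _, fun t i j x k => pe _ _ _ _, ?_, ?_, h.mu, h.mB, ?_, ?_, ?_, ?_, ?_⟩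
    · intro t x; simp only [toF_pd]
      have := congrArg (fun f : SP => f (t, x)) h.du
      simp only [SP.sum_apply] at this
      exact this
    · intro t x; simp only [toF_pd]
      have := congrArg (fun f : SP => f (t, x)) h.dB
      simp only [SP.sum_apply] at this
      exact this
    · intro t x; ext i j
      exact congrArg (fun f : SP => f (t, x)) (h.sR j i)
    · intro t x
      have := congrArg (fun f : SP => f (t, x)) ht
      simp only [SP.sum_apply] at this
      exact this
    · intro t x; ext i j
      exact congrArg (fun f : SP => f (t, x)) (h.sQ j i)
    · intro t x i; simp only [toM_pd, toF_dt, em, ep]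
      simpa only [SP.sum_apply, SP.add_apply] using congrArg (fun f : SP => f (t, x)) (h.mom i)
    · intro t x i; simp only [toM_pd, toF_dt, ei]
      simpa only [SP.sum_apply, SP.add_apply] using congrArg (fun f : SP => f (t, x)) (h.ind i)

theorem exists_lift {u B : ℝ → (Fin 3 → ℝ) → (Fin 3 → ℝ)} {p : ℝ → (Fin 3 → ℝ) → ℝ}
    {Ru RB : ℝ → (Fin 3 → ℝ) → Matrix (Fin 3) (Fin 3) ℝ} (h : RelaxedMHDSolution u B p Ru RB) :
    ∃ (us Bs : Fin 3 → SP) (ps : SP) (R Q : Fin 3 → Fin 3 → SP), u = toF us ∧ B = toF Bs ∧ p = toS ps ∧ Ru = toM R ∧ RB = toM Q := by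
  obtain ⟨s1, s2, s3, s4, s5, p1, p2, p3, p4, p5, -⟩ := h
  exact ⟨fun i => ⟨_, s1 i, fun t x k => p1 t i x k⟩, fun i => ⟨_, s2 i, fun t x k => p2 t i x k⟩, ⟨_, s3, fun t x k => p3 t x k⟩,
    fun i j => ⟨_, s4 i j, fun t x k => p4 t i j x k⟩, fun i j => ⟨_, s5 i j, fun t x k => p5 t i j x k⟩, rfl, rfl, rfl, rfl, rfl⟩

theorem C1_le {us : Fin 3 → SP} {W : ℝ} (h : ∀ i, Bd 1 (us i) W) : C1norm (toF us) ≤ 7 * W := by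
  have h1 : (⨆ q : Set.Icc (0 : ℝ) 1 × (Fin 3 → ℝ), enormV (toF us q.1.1 q.2)) ≤ 2 * W :=
    ciSup_le fun q => enormV_le fun i => (h i).1 _ q.1.2
  have h2 : (⨆ q : Set.Icc (0 : ℝ) 1 × (Fin 3 → ℝ),
    Real.sqrt (∑ i, ∑ j, (pd j (fun y => toF us q.1.1 y i) q.2) ^ 2)) ≤ 3 * W :=
    ciSup_le fun q => sqrt_le_W fun i j => by
      rw [toF_pd]; exact (h i).2 _ (norm_ee j) _ q.1.2
  have h3 : (⨆ q : Set.Icc (0 : ℝ) 1 × (Fin 3 → ℝ), enormV (fun i => deriv (fun s => toF us s q.2 i) q.1.1)) ≤ 2 * W :=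
    ciSup_le fun q => enormV_le fun i => by
      rw [toF_dt]; exact (h i).2 _ norm_e0 _ q.1.2
  unfold C1norm
  linarith

theorem sum_bound (f : Fin 3 → Fin 3 → SP) : ∃ X, ∀ i j, Bd 0 (f i j) X := by
  choose X hX using fun i j => exists_Bd0 (f i j)
  refine ⟨∑ i, ∑ j, X i j, fun i j => (hX i j).mono ?_⟩
  exact (Finset.single_le_sum (f := fun j => X i j) (fun k _ => (hX i k).nonneg) (Finset.mem_univ j)).trans
    (Finset.single_le_sum (f := fun i => ∑ j, X i j) (fun i _ => Finset.sum_nonneg fun j _ => (hX i j).nonneg) (Finset.mem_univ i))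

theorem of_C1 {us : Fin 3 → SP} {W : ℝ} (h : C1norm (toF us) ≤ W) (i : Fin 3) : Bd 1 (us i) (4 * W) := by
  have n1 : 0 ≤ (⨆ q : Set.Icc (0 : ℝ) 1 × (Fin 3 → ℝ), enormV (toF us q.1.1 q.2)) := Real.iSup_nonneg fun q => Real.sqrt_nonneg _
  have n2 : 0 ≤ (⨆ q : Set.Icc (0 : ℝ) 1 × (Fin 3 → ℝ),
    Real.sqrt (∑ i, ∑ j, (pd j (fun y => toF us q.1.1 y i) q.2) ^ 2)) := Real.iSup_nonneg fun q => Real.sqrt_nonneg _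
  have n3 : 0 ≤ (⨆ q : Set.Icc (0 : ℝ) 1 × (Fin 3 → ℝ), enormV (fun i => deriv (fun s => toF us s q.2 i) q.1.1)) := Real.iSup_nonneg fun q => Real.sqrt_nonneg _
  unfold C1norm at h
  obtain ⟨X1, b1⟩ := sum_bound fun i _ => us i
  obtain ⟨X2, b2⟩ := sum_bound fun i j => D (ee j) (us i)
  obtain ⟨X3, b3⟩ := sum_bound fun i _ => D e0 (us i)
  have k1 : ∀ i, Bd 0 (us i) W := fun i z hz => by
    have : enormV (toF us z.1 z.2) ≤ (⨆ q : Set.Icc (0 : ℝ) 1 × (Fin 3 → ℝ), enormV (toF us q.1.1 q.2)) :=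
      le_ciSup (f := fun q : Set.Icc (0 : ℝ) 1 × (Fin 3 → ℝ) => enormV (toF us q.1.1 q.2)) 
        ⟨2 * X1, by rintro _ ⟨q, rfl⟩; exact enormV_le fun i => b1 i 0 _ q.1.2⟩ (⟨z.1, hz⟩, z.2)
    have := (le_enormV (toF us z.1 z.2) i).trans this
    change |us i z| ≤ _ at this
    linarith
  have k2 : ∀ i j, Bd 0 (D (ee j) (us i)) W := fun i j z hz => by
    have : Real.sqrt (∑ i, ∑ j, (pd j (fun y => toF us z.1 y i) z.2) ^ 2) ≤ _ :=
      le_ciSup (f := fun q : Set.Icc (0 : ℝ) 1 × (Fin 3 → ℝ) => Real.sqrt (∑ i, ∑ j, (pd j (fun y => toF us q.1.1 y i) q.2) ^ 2)) 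
        ⟨3 * X2, by 
          rintro _ ⟨q, rfl⟩
          refine sqrt_le_W fun i j => ?_
          rw [toF_pd]
          exact b2 i j _ q.1.2⟩ (⟨z.1, hz⟩, z.2)
    have := (le_enormM (fun i j => pd j (fun y => toF us z.1 y i) z.2) i j).trans this
    rw [toF_pd] at this
    change |D (ee j) (us i) z| ≤ _ at this
    linarith
  have k3 : ∀ i, Bd 0 (D e0 (us i)) W := fun i z hz => by
    have : enormV (fun i => deriv (fun s => toF us s z.2 i) z.1) ≤ _ :=
      le_ciSup (f := fun q : Set.Icc (0 : ℝ) 1 × (Fin 3 → ℝ) => enormV (fun i => deriv (fun s => toF us s q.2 i) q.1.1)) 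
        ⟨2 * X3, by 
          rintro _ ⟨q, rfl⟩
          refine enormV_le fun i => ?_
          rw [toF_dt]
          exact b3 i 0 _ q.1.2⟩ (⟨z.1, hz⟩, z.2)
    have := (le_enormV (fun i => deriv (fun s => toF us s z.2 i) z.1) i).trans this
    rw [toF_dt] at this
    change |D e0 (us i) z| ≤ _ at this
    linarith
  have hW := (k1 0).nonneg
  refine ⟨fun z hz => (k1 i z hz).trans (by linarith), fun v hv z hz => ?_⟩
  have e : D v (us i) z = v.1 * D e0 (us i) z + ∑ j, v.2 j * D (ee j) (us i) z := by
    rw [D_apply]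
    conv_lhs => rw [EE_dec v]
    simp only [map_add, map_smul, map_sum, smul_eq_mul]
    rfl
  have hv1 : |v.1| ≤ 1 := (norm_fst_le v).trans hv
  have m1 : |v.1 * D e0 (us i) z| ≤ W := by
    rw [abs_mul]; nlinarith [k3 i z hz, abs_nonneg (D e0 (us i) z)]
  have m2 : ∀ j, |v.2 j * D (ee j) (us i) z| ≤ W := fun j => by
    rw [abs_mul]; nlinarith [k2 i j z hz, abs_nonneg (D (ee j) (us i) z), comp_le hv j]
  rw [e, Fin.sum_univ_three]
  have a0 := m2 0
  have a1 := m2 1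
  have a2 := m2 2
  rw [abs_le] at *
  constructor <;> linarith

theorem enormM_cont (R : Fin 3 → Fin 3 → SP) (t : ℝ) : Continuous fun x => enormM (toM R t x) := by
  unfold enormM toM
  refine Real.continuous_sqrt.comp (continuous_finset_sum _ fun i _ => continuous_finset_sum _ fun j _ => (SPcont _ t).pow 2)

theorem of_L1 {R : Fin 3 → Fin 3 → SP} {t σ : ℝ} (h : L1norm (toM R t) ≤ σ) (i j : Fin 3) : ∫ x in dom, |R i j (t, x)| ≤ σ := by
  refine le_trans ?_ h
  exact setIntegral_mono_on (contIntOn (SPcont _ t).abs) (contIntOn (enormM_cont R t)) dom_meas fun x _ => le_enormM (toM R t x) i j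

theorem L1_le {R : Fin 3 → Fin 3 → SP} {t σ : ℝ} (h : ∀ i j, ∫ x in dom, |R i j (t, x)| ≤ σ) : L1norm (toM R t) ≤ 9 * σ := by
  calc L1norm (toM R t) ≤ ∫ x in dom, ∑ i, ∑ j, |R i j (t, x)| := by
        refine setIntegral_mono_on (contIntOn (enormM_cont R t)) (contIntOn ?_) dom_meas fun x _ => enormM_le (toM R t x)
        exact continuous_finset_sum _ fun i _ => continuous_finset_sum _ fun j _ => (SPcont _ t).abs
    _ = ∑ i, ∑ j, ∫ x in dom, |R i j (t, x)| := by
        rw [integral_finsetSum _ fun i _ => contIntOn (continuous_finset_sum _ fun j _ => (SPcont _ t).abs)]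
        refine Finset.sum_congr rfl fun i _ => ?_
        rw [integral_finsetSum _ fun j _ => contIntOn (SPcont _ t).abs]
    _ ≤ ∑ i : Fin 3, ∑ j : Fin 3, σ := Finset.sum_le_sum fun i _ => Finset.sum_le_sum fun j _ => h i j
    _ = 9 * σ := by simp; ring

theorem sq_enormV (v : Fin 3 → ℝ) : enormV v ^ 2 = ∑ i, v i ^ 2 := Real.sq_sqrt (Finset.sum_nonneg fun i _ => sq_nonneg _)

theorem L2_iff {f : (Fin 3 → ℝ) → (Fin 3 → ℝ)} {A : ℝ} (hA : 0 ≤ A) : L2norm f ≤ A ↔ ∫ x in dom, ∑ i, f x i ^ 2 ≤ A ^ 2 := by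
  unfold L2norm
  simp only [sq_enormV]
  rw [← Real.sqrt_eq_rpow, Real.sqrt_le_left hA]

theorem L2_tri {f g : (Fin 3 → ℝ) → (Fin 3 → ℝ)} (hf : ∀ i, Continuous fun x => f x i) (hg : ∀ i, Continuous fun x => g x i)
    {A E : ℝ} (hA : 0 < A) (hE : 0 < E) (h1 : L2norm f ≤ A) (h2 : L2norm (fun x => g x - f x) ≤ E) : L2norm g ≤ A + E := by
  rw [L2_iff hA.le] at h1
  rw [L2_iff hE.le] at h2
  rw [L2_iff (by positivity)]
  have c1 : Continuous fun x => (1 + E / A) * ∑ i, f x i ^ 2 := (continuous_finset_sum _ fun i _ => (hf i).pow 2).const_mul _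
  have c2 : Continuous fun x => (1 + A / E) * ∑ i, (g x - f x) i ^ 2 := (continuous_finset_sum _ fun i _ => ((hg i).sub (hf i)).pow 2).const_mul _
  have c3 : Continuous fun x => ∑ i, g x i ^ 2 := continuous_finset_sum _ fun i _ => (hg i).pow 2
  calc ∫ x in dom, ∑ i, g x i ^ 2 ≤ ∫ x in dom, ((1 + E / A) * ∑ i, f x i ^ 2 + (1 + A / E) * ∑ i, (g x - f x) i ^ 2) := by
        refine setIntegral_mono_on (contIntOn c3) (contIntOn (c1.add c2)) dom_meas fun x _ => ?_
        rw [Finset.mul_sum, Finset.mul_sum, ← Finset.sum_add_distrib]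
        refine Finset.sum_le_sum fun i _ => ?_
        rw [Pi.sub_apply]
        set a := f x i
        set b := g x i
        have : (1 + E / A) * a ^ 2 + (1 + A / E) * (b - a) ^ 2 - b ^ 2 = (E * a - A * (b - a)) ^ 2 / (A * E) := by
          field_simp; ring
        have k : 0 ≤ (E * a - A * (b - a)) ^ 2 / (A * E) := by positivity
        linarith
    _ = (1 + E / A) * (∫ x in dom, ∑ i, f x i ^ 2) + (1 + A / E) * ∫ x in dom, ∑ i, (g x - f x) i ^ 2 := by
        rw [integral_add (contIntOn c1) (contIntOn c2), integral_const_mul, integral_const_mul]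
    _ ≤ (1 + E / A) * A ^ 2 + (1 + A / E) * E ^ 2 := by gcongr
    _ = (A + E) ^ 2 := by field_simp; ring

theorem L2_of {u v : Fin 3 → SP} {t E : ℝ} (hE : 0 ≤ E) (h : ∀ i, ∫ x in dom, (u i (t, x) - v i (t, x)) ^ 2 ≤ E ^ 2 / 3) :
    L2norm (fun x => toF u t x - toF v t x) ≤ E := by
  rw [L2_iff hE]
  have e : ∀ x i, (toF u t x - toF v t x) i = u i (t, x) - v i (t, x) := fun x i => rfl
  simp only [e]
  have kc : ∀ i, Continuous fun x => (u i (t, x) - v i (t, x)) ^ 2 := fun i => ((SPcont _ t).sub (SPcont _ t)).pow 2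
  rw [integral_finsetSum _ fun i _ => contIntOn (kc i), Fin.sum_univ_three]
  linarith [h 0, h 1, h 2]

end

noncomputable section
open MeasureTheory Real Matrix

theorem rpow_comm_pow {L : ℝ} (hL : 0 < L) (n : ℕ) (β : ℝ) : (L ^ n) ^ β = (L ^ β) ^ n := by
  rw [← Real.rpow_natCast, ← Real.rpow_natCast, ← Real.rpow_mul hL.le, ← Real.rpow_mul hL.le, mul_comm]

theorem del_form {L : ℝ} (hL : 0 < L) (β : ℝ) : L ^ (-(2 * β)) = ((L ^ β)⁻¹) ^ 2 := by
  rw [Real.rpow_neg hL.le, inv_pow, ← Real.rpow_natCast, ← Real.rpow_mul hL.le, mul_comm]; norm_num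

theorem del_half {L : ℝ} (hL : 0 < L) (β : ℝ) : (L ^ (-(2 * β))) ^ ((1 : ℝ) / 2) = (L ^ β)⁻¹ := by
  rw [del_form hL, ← Real.sqrt_eq_rpow, Real.sqrt_sq (by positivity)]

theorem lam_succ (a b q : ℕ) : lam a b (q + 1) = lam a b q ^ b := by
  unfold lam; rw [pow_succ, pow_mul]

set_option maxHeartbeats 1000000 in
theorem main_iteration' :
    ∃ (β : ℝ), 0 < β ∧ β < 1 ∧
    ∃ (b : ℕ), 2 ≤ b ∧
    ∃ cu cB : ℝ, 0 < cu ∧ cu ≤ 1 ∧ 0 < cB ∧ cB ≤ 1 ∧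
    ∃ a₀ : ℕ, ∀ a : ℕ, a₀ ≤ a → ∀ q : ℕ,
    ∀ (u B : ℝ → (Fin 3 → ℝ) → (Fin 3 → ℝ)) (p : ℝ → (Fin 3 → ℝ) → ℝ)
      (Ru RB : ℝ → (Fin 3 → ℝ) → Matrix (Fin 3) (Fin 3) ℝ),
      RelaxedMHDSolution u B p Ru RB →
      InductiveBounds a b β cu cB q u B Ru RB →
      ∃ (u' B' : ℝ → (Fin 3 → ℝ) → (Fin 3 → ℝ)) (p' : ℝ → (Fin 3 → ℝ) → ℝ)
        (Ru' RB' : ℝ → (Fin 3 → ℝ) → Matrix (Fin 3) (Fin 3) ℝ),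
        RelaxedMHDSolution u' B' p' Ru' RB' ∧
        InductiveBounds a b β cu cB (q + 1) u' B' Ru' RB' ∧
        (∀ t ∈ Set.Icc (0 : ℝ) 1,
          L2norm (fun x => u' t x - u t x) ≤ del a b β (q + 1) ^ ((1 : ℝ) / 2)) ∧
        (∀ t ∈ Set.Icc (0 : ℝ) 1,
          L2norm (fun x => B' t x - B t x) ≤ del a b β (q + 1) ^ ((1 : ℝ) / 2)) := by
  obtain ⟨C, hC, K, hstep⟩ := step_SP
  obtain ⟨b', hb'⟩ : ∃ b', b' = 40 * K + 2 := ⟨_, rfl⟩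
  obtain ⟨b, hb⟩ : ∃ b, b = 3 * b' := ⟨_, rfl⟩
  have hb2 : 6 ≤ b := by omega
  have hbR : (6 : ℝ) ≤ b := by exact_mod_cast hb2
  set β : ℝ := 1 / (2 * (b : ℝ) ^ 2) with hβ
  have hβ0 : 0 < β := by positivity
  have hβ1 : β < 1 := by
    rw [hβ, div_lt_one (by positivity)]; nlinarith
  set c : ℝ := 1 / (6 * C) with hc
  have hc0 : 0 < c := by positivity
  have hcC : c * C = 1 / 6 := by rw [hc]; field_simp
  have hc1 : c ≤ 1 := by rw [hc, div_le_one (by positivity)]; linarith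
  refine ⟨β, hβ0, hβ1, b, by omega, c, c, hc0, hc1, hc0, hc1, ⌈1000 * C ^ 2⌉₊ + 2 ^ (2 * b ^ 2), ?_⟩
  intro a ha q u B p Ru RB hsol hbd
  obtain ⟨us, Bs, ps, R, Q, rfl, rfl, rfl, rfl, rfl⟩ := exists_lift hsol
  have hS := ((sys_iff _ _ _ _ _).1 hsol).1
  -- the frequency
  set ΛN : ℕ := a ^ (b ^ q) with hΛN
  set L : ℝ := lam a b q with hLdef
  have hLN : L = (ΛN : ℝ) := by rw [hLdef, hΛN]; simp [lam]
  have ha1 : 2 ^ (2 * b ^ 2) ≤ a := (Nat.le_add_left _ _).trans ha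
  have ha0 : 1 ≤ a := le_trans Nat.one_le_two_pow ha1
  have haΛ : a ≤ ΛN := by
    calc a = a ^ 1 := (pow_one a).symm
      _ ≤ a ^ (b ^ q) := Nat.pow_le_pow_right ha0 (Nat.one_le_pow _ _ (by omega))
  have haL : (a : ℝ) ≤ L := by rw [hLN]; exact_mod_cast haΛ
  have hLC : 1000 * C ^ 2 ≤ L := by
    have h1 : 1000 * C ^ 2 ≤ (⌈1000 * C ^ 2⌉₊ : ℝ) := Nat.le_ceil _
    have h2 : (⌈1000 * C ^ 2⌉₊ : ℝ) ≤ a := by exact_mod_cast ((Nat.le_add_right _ _).trans ha : ⌈1000 * C ^ 2⌉₊ ≤ a)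
    linarith
  have hLC1 : 1000 * C ≤ L := by nlinarith
  have hL1 : 1000 ≤ L := by linarith
  have hL0 : 0 < L := by linarith
  have hL2 : (2 : ℝ) ^ (2 * b ^ 2) ≤ L := by
    refine le_trans ?_ haL
    exact_mod_cast ha1
  set τ := L ^ β with hτ
  have hτ0 : 0 < τ := by positivity
  have hβb : (2 * b ^ 2 : ℕ) * β = 1 := by
    rw [hβ]; push_cast; field_simp
  have hτ2 : 2 ≤ τ := by
    calc (2 : ℝ) = ((2 : ℝ) ^ (2 * b ^ 2)) ^ β := by
          rw [← Real.rpow_natCast, ← Real.rpow_mul (by norm_num), hβb, Real.rpow_one]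
      _ ≤ τ := Real.rpow_le_rpow (by positivity) hL2 hβ0.le
  have hτL : τ ^ (2 * b ^ 2) = L := by
    rw [hτ, ← Real.rpow_natCast, ← Real.rpow_mul hL0.le, mul_comm, hβb, Real.rpow_one]
  -- deltas
  have hLb : lam a b (q + 1) = L ^ b := lam_succ a b q
  have hLbb : lam a b (q + 1 + 1) = L ^ (b * b) := by rw [lam_succ, hLb]; exact (pow_mul L b b).symm
  have d0 : del a b β q ^ ((1 : ℝ) / 2) = τ⁻¹ := del_half hL0 β
  have d1 : del a b β (q + 1) = ((τ ^ b)⁻¹) ^ 2 := by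
    unfold del; rw [hLb, del_form (by positivity), rpow_comm_pow hL0]
  have d1h : del a b β (q + 1) ^ ((1 : ℝ) / 2) = (τ ^ b)⁻¹ := by
    unfold del; rw [hLb, del_half (by positivity), rpow_comm_pow hL0]
  have d2 : del a b β (q + 1 + 1) = L⁻¹ := by
    unfold del; rw [hLbb, del_form (by positivity), rpow_comm_pow hL0, inv_pow, ← pow_mul]
    rw [show b * b * 2 = 2 * b ^ 2 by ring, ← hτ, hτL]
  have d12 : L⁻¹ ≤ del a b β (q + 1) := by
    rw [d1, inv_pow, ← pow_mul, ← hτL]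
    refine inv_anti₀ (by positivity) (pow_le_pow_right₀ (by linarith) ?_)
    nlinarith
  have d1p : 0 < del a b β (q + 1) := by rw [d1]; positivity
  have d1le : del a b β (q + 1) ≤ 1 := by
    rw [d1]
    refine pow_le_one₀ (by positivity) (inv_le_one_of_one_le₀ (one_le_pow₀ (by linarith)))
  have dgap : τ⁻¹ ≥ 2 * (τ ^ b)⁻¹ := by
    have e1 : τ ^ 2 ≤ τ ^ b := pow_le_pow_right₀ (by linarith) (by omega)
    have e2 : (τ ^ b)⁻¹ ≤ (τ ^ 2)⁻¹ := inv_anti₀ (by positivity) e1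
    have e3 : 2 * (τ ^ 2)⁻¹ ≤ τ⁻¹ := by
      rw [pow_two, mul_inv, ← mul_assoc]
      have : 2 * τ⁻¹ ≤ 1 := by rw [← div_eq_mul_inv, div_le_one hτ0]; exact hτ2
      have h := inv_pos.2 hτ0
      nlinarith
    linarith
  have d0lt : τ⁻¹ ≤ 1 / 2 := by rw [one_div]; exact inv_anti₀ (by norm_num) hτ2
  -- parameters
  obtain ⟨hB2, hBC, hQ1, hu2, huC, hR1⟩ := hbd
  set M : ℕ := ΛN ^ b' with hM
  have hMR : (M : ℝ) = L ^ b' := by rw [hM, hLN]; push_cast; rfl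
  have hLM : L ≤ M := by
    rw [hMR]
    exact le_self_pow₀ (by linarith) (by omega)
  have hM2 : 2 ≤ M := by
    have : (2 : ℝ) ≤ M := by linarith
    exact_mod_cast this
  have hMp : (0 : ℝ) < M := by linarith
  have hlinv : ((L ^ 6)⁻¹)⁻¹ ^ 6 = L ^ 36 := by rw [inv_inv, ← pow_mul]
  have hX1 : (1 : ℝ) ≤ L ^ 40 := one_le_pow₀ (by linarith)
  have hYX : 4 * L ^ 2 ≤ L ^ 40 := by
    have : L ^ 3 ≤ L ^ 40 := pow_le_pow_right₀ (by linarith) (by norm_num)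
    have e : L ^ 3 = L * L ^ 2 := by ring
    have e2 : 4 * L ^ 2 ≤ L * L ^ 2 := by gcongr; linarith
    linarith
  have hl14 : (L ^ 6)⁻¹ ≤ 1 / 4 := by
    rw [one_div]
    refine inv_anti₀ (by norm_num) ?_
    have : L ≤ L ^ 6 := le_self_pow₀ (by linarith) (by norm_num)
    linarith
  have hlX : C * ((L ^ 6)⁻¹)⁻¹ ^ 6 ≤ L ^ 40 := by
    rw [hlinv]
    have : L ^ 37 ≤ L ^ 40 := pow_le_pow_right₀ (by linarith) (by norm_num)
    have e : L ^ 37 = L * L ^ 36 := by ring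
    have e2 : C * L ^ 36 ≤ L * L ^ 36 := by gcongr; linarith
    linarith
  have hσ1 : c * del a b β (q + 1) ≤ 1 := mul_le_one₀ hc1 d1p.le d1le
  obtain ⟨u', B', p', R', Q', s1, s2, s3, s4, s5, s6, s7, s8⟩ := hstep M hM2 (L ^ 6)⁻¹ (4 * L ^ 2) (L ^ 40) (c * del a b β (q + 1)) us Bs ps R Q
    (by positivity) hl14 hX1 hYX hσ1 hlX hS (of_C1 huC) (of_C1 hBC) (fun t ht => of_L1 (hR1 t ht)) (fun t ht => of_L1 (hQ1 t ht))
  -- numerology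
  have hXKM : C * (L ^ 40) ^ K / M = C * (L⁻¹) ^ 2 := by
    rw [hMR, hb', pow_add, ← pow_mul, inv_pow]
    field_simp
  have hLi : 0 < L⁻¹ := by positivity
  have hLL : L⁻¹ * L = 1 := inv_mul_cancel₀ hL0.ne'
  have g1 : C * ((L ^ 6)⁻¹ * (4 * L ^ 2) ^ 2) = 16 * C * (L⁻¹) ^ 2 := by
    field_simp; norm_num
  have g2 : C * ((L ^ 6)⁻¹ * (4 * L ^ 2)) ^ 2 ≤ 16 * C * (L⁻¹) ^ 2 := by
    have e : C * ((L ^ 6)⁻¹ * (4 * L ^ 2)) ^ 2 = 16 * C * (L⁻¹) ^ 8 := by field_simp; norm_num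
    rw [e]
    refine mul_le_mul_of_nonneg_left ?_ (by positivity)
    exact pow_le_pow_of_le_one hLi.le (inv_le_one_of_one_le₀ (by linarith)) (by norm_num)
  have g3 : 1 / (L ^ 40) ^ 2 ≤ (L⁻¹) ^ 2 := by
    have e : 1 / (L ^ 40) ^ 2 = (L⁻¹) ^ 80 := by rw [← pow_mul, inv_pow, one_div]
    rw [e]
    exact pow_le_pow_of_le_one hLi.le (inv_le_one_of_one_le₀ (by linarith)) (by norm_num)
  have hCL : C * L⁻¹ ≤ c / 160 := by
    have : 1000 * C ^ 2 * L⁻¹ ≤ 1 := by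
      calc 1000 * C ^ 2 * L⁻¹ ≤ L * L⁻¹ := by gcongr
        _ = 1 := by rw [mul_comm, hLL]
    rw [hc, div_div, le_div_iff₀ (by positivity)]
    nlinarith
  have hE : C * ((L ^ 6)⁻¹ * (4 * L ^ 2)) ^ 2 + C * (c * del a b β (q + 1) + 1 / (L ^ 40) ^ 2) + C * (L ^ 40) ^ K / M
      ≤ ((τ ^ b)⁻¹) ^ 2 / 3 := by
    rw [← d1, hXKM]
    have e1 : C * (1 / (L ^ 40) ^ 2) ≤ C * (L⁻¹) ^ 2 := by gcongr
    have e2 : 18 * C * (L⁻¹) ^ 2 ≤ 18 * (1 / 160) * L⁻¹ := by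
      have f1 : C * L⁻¹ ≤ 1 / 160 := by linarith
      have f2 := mul_le_mul_of_nonneg_right f1 hLi.le
      have f3 : 18 * C * (L⁻¹) ^ 2 = 18 * (C * L⁻¹ * L⁻¹) := by ring
      linarith
    have e3 : C * (c * del a b β (q + 1)) = del a b β (q + 1) / 6 := by
      rw [← mul_assoc, mul_comm C, hcC]; ring
    rw [mul_add, e3]
    linarith
  have hRR : 9 * (C * ((L ^ 6)⁻¹ * (4 * L ^ 2) ^ 2) + C * (L ^ 40) ^ K / M) ≤ c * del a b β (q + 1 + 1) := by
    rw [g1, hXKM, d2]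
    have e1 := mul_le_mul_of_nonneg_right hCL hLi.le
    have e2 : 9 * (16 * C * (L⁻¹) ^ 2 + C * (L⁻¹) ^ 2) = 153 * (C * L⁻¹ * L⁻¹) := by ring
    have e3 : c / 160 * L⁻¹ = c * L⁻¹ / 160 := by ring
    have e4 : 0 < c * L⁻¹ := by positivity
    linarith
  have hCC : 7 * (4 * L ^ 2 + C * (L ^ 40) ^ K * M ^ 4) ≤ lam a b (q + 1) ^ 2 := by
    have e : lam a b (q + 1) ^ 2 = (M : ℝ) ^ 6 := by
      rw [hLb, hMR, ← pow_mul, ← pow_mul]; congr 1; omega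
    rw [e]
    have e1 : L ^ 2 ≤ M := by
      rw [hMR]; exact pow_le_pow_right₀ (by linarith) (by omega)
    have e2 : (L ^ 40) ^ K ≤ M := by
      rw [hMR, ← pow_mul]; exact pow_le_pow_right₀ (by linarith) (by omega)
    have e3 : (M : ℝ) ≤ M ^ 5 := le_self_pow₀ (by linarith) (by norm_num)
    have e4 : C * (L ^ 40) ^ K * M ^ 4 ≤ C * M * M ^ 4 := by gcongr
    have e5 : C * M * M ^ 4 = C * (M : ℝ) ^ 5 := by ring
    have e6 : (M : ℝ) ^ 6 = M * M ^ 5 := by ring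
    have h5 : (0 : ℝ) < M ^ 5 := by positivity
    have e7 : 1000 * C * (M : ℝ) ^ 5 ≤ M * M ^ 5 := by gcongr; linarith
    have e8 : (M : ℝ) ^ 5 ≤ C * M ^ 5 := le_mul_of_one_le_left h5.le hC
    rw [e6]
    linarith
  have hL2u : ∀ t ∈ Set.Icc (0 : ℝ) 1, L2norm (fun x => toF u' t x - toF us t x) ≤ (τ ^ b)⁻¹ := fun t ht =>
    L2_of (by positivity) fun i => (s7 t ht i).trans hE
  have hL2B : ∀ t ∈ Set.Icc (0 : ℝ) 1, L2norm (fun x => toF B' t x - toF Bs t x) ≤ (τ ^ b)⁻¹ := fun t ht =>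
    L2_of (by positivity) fun i => (s8 t ht i).trans hE
  rw [d0] at hu2 hB2
  have hτb : 0 < (τ ^ b)⁻¹ := by positivity
  refine ⟨toF u', toF B', toS p', toM R', toM Q', (sys_iff _ _ _ _ _).2 ⟨s1, s2⟩, ⟨?_, ?_, ?_, ?_, ?_, ?_⟩, ?_, ?_⟩
  · intro t ht
    rw [d1h]
    refine (L2_tri (fun i => SPcont _ t) (fun i => SPcont _ t) (by linarith : 0 < 1 - τ⁻¹) hτb (hB2 t ht) (hL2B t ht)).trans ?_
    linarith
  · exact (C1_le s4).trans hCC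
  · exact fun t ht => (L1_le (s6 t ht)).trans hRR
  · intro t ht
    rw [d1h]
    refine (L2_tri (fun i => SPcont _ t) (fun i => SPcont _ t) (by linarith : 0 < 1 - τ⁻¹) hτb (hu2 t ht) (hL2u t ht)).trans ?_
    linarith
  · exact (C1_le s3).trans hCC
  · exact fun t ht => (L1_le (s5 t ht)).trans hRR
  · rw [d1h]; exact hL2u
  · rw [d1h]; exact hL2B

end

theorem main_iteration :
    ∃ (β : ℝ), 0 < β ∧ β < 1 ∧
    ∃ (b : ℕ), 2 ≤ b ∧
    ∃ cu cB : ℝ, 0 < cu ∧ cu ≤ 1 ∧ 0 < cB ∧ cB ≤ 1 ∧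
    ∃ a₀ : ℕ, ∀ a : ℕ, a₀ ≤ a → ∀ q : ℕ,
    ∀ (u B : ℝ → (Fin 3 → ℝ) → (Fin 3 → ℝ)) (p : ℝ → (Fin 3 → ℝ) → ℝ)
      (Ru RB : ℝ → (Fin 3 → ℝ) → Matrix (Fin 3) (Fin 3) ℝ),
      RelaxedMHDSolution u B p Ru RB →
      InductiveBounds a b β cu cB q u B Ru RB →
      ∃ (u' B' : ℝ → (Fin 3 → ℝ) → (Fin 3 → ℝ)) (p' : ℝ → (Fin 3 → ℝ) → ℝ)
        (Ru' RB' : ℝ → (Fin 3 → ℝ) → Matrix (Fin 3) (Fin 3) ℝ),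
        RelaxedMHDSolution u' B' p' Ru' RB' ∧
        InductiveBounds a b β cu cB (q + 1) u' B' Ru' RB' ∧
        (∀ t ∈ Set.Icc (0 : ℝ) 1,
          L2norm (fun x => u' t x - u t x) ≤ del a b β (q + 1) ^ ((1 : ℝ) / 2)) ∧
        (∀ t ∈ Set.Icc (0 : ℝ) 1,
          L2norm (fun x => B' t x - B t x) ≤ del a b β (q + 1) ^ ((1 : ℝ) / 2)) :=
  main_iteration'

end
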